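/- arXiv:1307.4919 — 3 statements merged into one kernel-verified Lean document; each statement's English description precedes it below -/
import Mathlib

section
/- Let ν ∈ ℚ^n be a Newton datum and k ≥ 1. Then |k·ν, μ(b_{min,ν}^k)| ≤ n/4, where k·ν = (kν_1,…,kν_n) and μ(b_{min,ν}^k) is the Hodge point of b_{min,ν}^k (both tuples sorted decreasingly; note b_{min,ν}^k is the matrix part of (b_{min,ν}σ)^k since b_{min,ν} is fixed by σ). -/
/-!
Statement 5.  A Newton datum `ν ∈ ℚ^n` (decreasing, each distinct value `h/m` in
lowest terms having multiplicity divisible by `m`) is encoded by its list of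
superbasic blocks `(mᵢ, hᵢ)` (coprime, slopes `hᵢ/mᵢ` weakly decreasing, sizes
summing to `n`), together with the order-preserving identification of
`Σ i, Fin (mᵢ)` with `Fin n` (block `i` occupying consecutive positions).  The
minimal element `b_{min,ν}` is the corresponding block-diagonal matrix with
blocks `B_{mᵢ,hᵢ}`; it is fixed by `σ`, so `(b_{min,ν}σ)^k` has matrix part
`b_{min,ν}^k`.

Claim: `|k·ν, μ(b_{min,ν}^k)| ≤ n/4` for all `k ≥ 1`, where
`|x,x'| = Σ_{i : xᵢ > x'ᵢ} (xᵢ − x'ᵢ)`.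
-/

open Matrix

noncomputable section

variable (p : ℕ) [Fact p.Prime] (κ : Type) [Field κ] [IsAlgClosed κ] [CharP κ p]

local notation "𝕎" => WittVector p κ
local notation "K" => FractionRing (WittVector p κ)

/-- `c ∈ GL_n(W(κ)) ⊆ GL_n(K)`. -/
def IsIntegralUnit {n : ℕ} (c : Matrix (Fin n) (Fin n) K) : Prop :=
  ∃ d : Matrix (Fin n) (Fin n) 𝕎, IsUnit d.det ∧ c = d.map (algebraMap 𝕎 K)

/-- `μ` is the Hodge point of `b`. -/
def IsHodgePoint {n : ℕ} (b : Matrix (Fin n) (Fin n) K) (μ : Fin n → ℤ) : Prop :=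
  Antitone μ ∧ ∃ c₁ c₂ : Matrix (Fin n) (Fin n) K, IsIntegralUnit p κ c₁ ∧ IsIntegralUnit p κ c₂ ∧
    b = c₁ * Matrix.diagonal (fun i => (p : K) ^ (μ i)) * c₂

/-- The matrix `B_{m,h}`. -/
def Bmat (m : ℕ) (h : ℤ) : Matrix (Fin m) (Fin m) K :=
  fun r j => if (r : ℤ) % m = ((j : ℤ) + h) % m then (p : K) ^ (((j : ℤ) + h) / m) else 0

/-- A Newton datum for `GL_n`, encoded by its superbasic blocks. -/
structure BlockData (n : ℕ) where
  /-- number of blocks -/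
  len : ℕ
  /-- sizes of the blocks -/
  m : Fin len → ℕ
  /-- numerators of the blocks -/
  h : Fin len → ℤ
  m_pos : ∀ i, 0 < m i
  coprime : ∀ i, Int.gcd (m i) (h i) = 1
  slopes_antitone : Antitone fun i => (h i : ℚ) / (m i)
  /-- the identification of the blocks with consecutive segments of `Fin n`,
  in order -/
  equiv : (Σ i : Fin len, Fin (m i)) ≃ Fin n
  equiv_val : ∀ x : (Σ i : Fin len, Fin (m i)),
    ((equiv x : ℕ)) = (∑ j : Fin len, if j < x.1 then m j else 0) + (x.2 : ℕ)

/-- The Newton point `ν` determined by the block data: `m i` slopes `h i / m i`. -/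
def nuOf {n : ℕ} (D : BlockData n) : Fin n → ℚ :=
  fun j => (D.h (D.equiv.symm j).1 : ℚ) / (D.m (D.equiv.symm j).1)

/-- The minimal element `b_{min,ν}`: block diagonal with blocks `B_{mᵢ,hᵢ}`. -/
def minMatrix {n : ℕ} (D : BlockData n) : Matrix (Fin n) (Fin n) K :=
  (Matrix.blockDiagonal' fun i => Bmat p κ (D.m i) (D.h i)).submatrix
    ⇑D.equiv.symm ⇑D.equiv.symm

/-- The distance `|x, x'| = Σ_{i : xᵢ > x'ᵢ} (xᵢ − x'ᵢ)` between two tuples. -/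
def tdist {n : ℕ} (x x' : Fin n → ℚ) : ℚ := ∑ i, max (x i - x' i) 0

section Combin

lemma layer_cake (x : ℚ) (y L : ℤ) (hL : L ≤ y) (N : ℕ) :
    ∑ s ∈ Finset.range N, (if y ≤ L + s then
      (max (x - (L + s : ℤ)) 0 - max (x - ((L + s : ℤ) + 1)) 0) else 0)
      = max (x - y) 0 - max (x - (max y (L + N) : ℤ)) 0 := by
  induction N with
  | zero => simp [max_eq_left hL]
  | succ N ih =>
    rw [Finset.sum_range_succ, ih]
    split_ifs with h
    · have h' : y ≤ L + ((N + 1 : ℕ) : ℤ) := by push_cast; omega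
      rw [max_eq_right h, max_eq_right h']
      push_cast
      rw [add_assoc]; ring
    · have h1 : L + (N : ℤ) ≤ y := by omega
      have h' : L + ((N + 1 : ℕ) : ℤ) ≤ y := by push_cast; omega
      rw [max_eq_left h1, max_eq_left h']
      ring

lemma layer_cake' (x : ℚ) (y L : ℤ) (hL : L ≤ y) (N : ℕ) (hN : x ≤ (L + N : ℤ)) :
    max (x - y) 0 = ∑ s ∈ Finset.range N, (if y ≤ L + s then
      (max (x - (L + s : ℤ)) 0 - max (x - ((L + s : ℤ) + 1)) 0) else 0) := by
  rw [layer_cake x y L hL N]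
  have h1 : (L + N : ℤ) ≤ max y (L + N) := le_max_right _ _
  have h2 : ((L + N : ℤ) : ℚ) ≤ ((max y (L + N) : ℤ) : ℚ) := by exact_mod_cast h1
  rw [max_eq_right (a := x - ((max y (L + N) : ℤ) : ℚ)) (by linarith)]
  ring

lemma g_mono (t : ℚ) : Monotone fun x : ℚ => max (x - t) 0 - max (x - (t + 1)) 0 := by
  intro x y h
  simp only
  rcases le_total (x - t) 0 with h1 | h1 <;> rcases le_total (x - (t+1)) 0 with h2 | h2 <;>
  rcases le_total (y - t) 0 with h3 | h3 <;> rcases le_total (y - (t+1)) 0 with h4 | h4 <;>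
  simp only [h1, h2, h3, h4, max_eq_left, max_eq_right] <;> linarith

lemma g_nonneg (t x : ℚ) : 0 ≤ max (x - t) 0 - max (x - (t + 1)) 0 := by
  have : max (x - (t + 1)) 0 ≤ max (x - t) 0 := max_le_max (by linarith) le_rfl
  linarith

lemma upper_sum_le {n : ℕ} (g : Fin n → ℚ) (hg : Antitone g) (hg0 : ∀ i, 0 ≤ g i)
    (S A : Finset (Fin n)) (hS : ∀ i ∈ S, ∀ j, i ≤ j → j ∈ S) (hc : S.card ≤ A.card) :
    ∑ i ∈ S, g i ≤ ∑ i ∈ A, g i := by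
  rcases S.eq_empty_or_nonempty with rfl | hne
  · simpa using Finset.sum_nonneg fun i _ => hg0 i
  set c := g (S.min' hne)
  have h1 : ∑ i ∈ S \ A, g i ≤ (S \ A).card • c :=
    Finset.sum_le_card_nsmul _ _ _ fun i hi =>
      hg (Finset.min'_le _ _ (Finset.mem_sdiff.1 hi).1)
  have h2 : (A \ S).card • c ≤ ∑ i ∈ A \ S, g i := by
    refine Finset.card_nsmul_le_sum _ _ _ fun i hi => hg ?_
    by_contra hlt
    exact (Finset.mem_sdiff.1 hi).2 (hS _ (S.min'_mem hne) i (le_of_not_ge hlt))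
  have h3 : (S \ A).card ≤ (A \ S).card := by
    have e1 := Finset.card_sdiff_add_card_inter S A
    have e2 := Finset.card_sdiff_add_card_inter A S
    rw [Finset.inter_comm] at e2
    omega
  have h4 : (S \ A).card • c ≤ (A \ S).card • c := nsmul_le_nsmul_left (hg0 _) h3
  have e1 := Finset.sum_inter_add_sum_sdiff S A g
  have e2 := Finset.sum_inter_add_sum_sdiff A S g
  rw [Finset.inter_comm] at e2
  linarith

lemma sorted_le {n : ℕ} (x : Fin n → ℚ) (hx : Antitone x) (μ a : Fin n → ℤ) (hμ : Antitone μ)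
    (hc : ∀ t : ℤ, (Finset.univ.filter fun i => μ i ≤ t).card
      ≤ (Finset.univ.filter fun i => a i ≤ t).card) :
    ∑ i, max (x i - μ i) 0 ≤ ∑ i, max (x i - a i) 0 := by
  obtain ⟨L, hL⟩ : ∃ L : ℤ, ∀ i, L ≤ μ i ∧ L ≤ a i := by
    obtain ⟨L1, h1⟩ := (Set.finite_range μ).bddBelow
    obtain ⟨L2, h2⟩ := (Set.finite_range a).bddBelow
    exact ⟨min L1 L2, fun i => ⟨(min_le_left _ _).trans (h1 ⟨i, rfl⟩),
      (min_le_right _ _).trans (h2 ⟨i, rfl⟩)⟩⟩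
  obtain ⟨N, hN⟩ : ∃ N : ℕ, ∀ i, x i ≤ (L + N : ℤ) := by
    obtain ⟨U, hU⟩ := (Set.finite_range x).bddAbove
    obtain ⟨N, hN⟩ := exists_nat_ge (U - L)
    refine ⟨N, fun i => ?_⟩
    have := hU ⟨i, rfl⟩
    push_cast
    linarith
  rw [Finset.sum_congr rfl fun i _ => layer_cake' (x i) (μ i) L (hL i).1 N (hN i),
    Finset.sum_congr rfl fun i _ => layer_cake' (x i) (a i) L (hL i).2 N (hN i),
    Finset.sum_comm, Finset.sum_comm (s := Finset.univ)]
  refine Finset.sum_le_sum fun s _ => ?_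
  rw [← Finset.sum_filter, ← Finset.sum_filter]
  refine upper_sum_le _ (fun i j h => g_mono _ (hx h)) (fun i => g_nonneg _ _) _ _ ?_ (hc _)
  intro i hi j hij
  simp only [Finset.mem_filter, Finset.mem_univ, true_and] at hi ⊢
  exact (hμ hij).trans hi

lemma block_bound (m : ℕ) (hm : 0 < m) (N : ℤ) :
    ∑ j : Fin m, max ((N : ℚ) / m - ((((j : ℕ) : ℤ) + N) / m : ℤ)) 0 ≤ (m : ℚ) / 4 := by
  have hm' : (0 : ℤ) < m := by exact_mod_cast hm
  have hmq : (0 : ℚ) < m := by exact_mod_cast hm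
  obtain ⟨r, hr⟩ : ∃ r : ℕ, (r : ℤ) = N % m :=
    ⟨(N % m).toNat, Int.toNat_of_nonneg (Int.emod_nonneg _ hm'.ne')⟩
  have hrm : r < m := by have := Int.emod_lt_of_pos N hm'; omega
  have hNq : N = m * (N / m) + r := by rw [hr]; exact (Int.mul_ediv_add_emod N m).symm
  set q := N / (m : ℤ)
  have hx : (N : ℚ) / m = q + r / m := by
    rw [hNq]; push_cast; field_simp
  have hr1 : (r : ℚ) / m ≤ 1 := by
    rw [div_le_one hmq]; exact_mod_cast hrm.le
  have hterm : ∀ j : ℕ, j < m → max ((N : ℚ) / m - (((j : ℤ) + N) / m : ℤ)) 0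
      ≤ if j < m - r then (r : ℚ) / m else 0 := by
    intro j hj
    split_ifs with h
    · have : q ≤ ((j : ℤ) + N) / m := Int.ediv_le_ediv hm' (by omega)
      have : (q : ℚ) ≤ (((j : ℤ) + N) / m : ℤ) := by exact_mod_cast this
      rw [hx]
      apply max_le _ (by positivity)
      linarith
    · have : q + 1 ≤ ((j : ℤ) + N) / m := by
        rw [Int.le_ediv_iff_mul_le hm']
        have : (q + 1) * (m : ℤ) = m * q + m := by ring
        omega
      have : (q : ℚ) + 1 ≤ (((j : ℤ) + N) / m : ℤ) := by exact_mod_cast this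
      rw [hx]
      apply max_le _ le_rfl
      linarith
  have hcard : (Finset.range m).filter (fun j => j < m - r) = Finset.range (m - r) := by
    ext j; simp; omega
  calc _ ≤ ∑ j : Fin m, if (j : ℕ) < m - r then (r : ℚ) / m else 0 :=
        Finset.sum_le_sum fun j _ => hterm j j.2
    _ = ((m - r : ℕ) : ℚ) * (r / m) := by
        rw [Fin.sum_univ_eq_sum_range (fun j => if j < m - r then (r : ℚ) / m else 0),
          ← Finset.sum_filter, hcard]
        simp
    _ ≤ m / 4 := by
        rw [Nat.cast_sub hrm.le, ← mul_div_assoc, div_le_div_iff₀ hmq (by norm_num)]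
        nlinarith [sq_nonneg ((m : ℚ) - 2 * r)]

end Combin

section Val

lemma mulVec_val_le {F Γ : Type*} [Field F] [LinearOrderedCommGroupWithZero Γ] (V : Valuation F Γ)
    {n : ℕ} (M : Matrix (Fin n) (Fin n) F) (w : Fin n → F) (c : Γ)
    (h : ∀ r j, V (M r j * w j) ≤ c) (r : Fin n) : V ((M *ᵥ w) r) ≤ c := by
  rw [Matrix.mulVec_eq_sum, Finset.sum_apply]
  refine V.map_sum_le fun j _ => ?_
  simpa [mul_comm] using h r j

lemma count_le {F Γ : Type*} [Field F] [LinearOrderedCommGroupWithZero Γ] (V : Valuation F Γ)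
    (π : F) (hπ0 : π ≠ 0) (hπ : V π < 1) {n : ℕ} (M u₁ u₂ : Matrix (Fin n) (Fin n) F)
    (μ a : Fin n → ℤ)
    (hu₁ : ∀ i j, V (u₁ i j) ≤ 1) (hu₂ : ∀ i j, V (u₂ i j) ≤ 1)
    (hM : ∀ i j, V (M i j) ≤ V π ^ (a j))
    (hD : Matrix.diagonal (fun i => π ^ μ i) = u₁ * M * u₂) (t : ℤ) :
    (Finset.univ.filter fun i => μ i ≤ t).card ≤ (Finset.univ.filter fun i => a i ≤ t).card := by
  by_contra hlt
  push Not at hlt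
  have hV0 : 0 < V π := zero_lt_iff.2 ((V.ne_zero_iff).2 hπ0)
  set S := Finset.univ.filter fun i => μ i ≤ t with hS
  set A := Finset.univ.filter fun i => a i ≤ t with hA
  let ι : (S → F) →ₗ[F] (Fin n → F) :=
    { toFun := fun v i => if h : i ∈ S then v ⟨i, h⟩ else 0
      map_add' := by intro v w; ext i; by_cases h : i ∈ S <;> simp [h]
      map_smul' := by intro c w; ext i; by_cases h : i ∈ S <;> simp [h] }
  let φ : (S → F) →ₗ[F] (A → F) :=
    (LinearMap.funLeft F F (fun j : A => (j : Fin n))) ∘ₗ (Matrix.mulVecLin u₂) ∘ₗ ι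
  have hker : LinearMap.ker φ ≠ ⊥ := by
    apply LinearMap.ker_ne_bot_of_finrank_lt
    simpa using hlt
  obtain ⟨v₀, hv₀, hne⟩ := (Submodule.ne_bot_iff _).1 hker
  set v := ι v₀ with hv
  have hvS : ∀ i, i ∉ S → v i = 0 := fun i hi => by simp [hv, ι, hi]
  obtain ⟨s, hs⟩ := Function.ne_iff.1 hne
  have hvs : v s ≠ 0 := by simpa [hv, ι] using hs
  obtain ⟨i₀, -, hi₀⟩ := Finset.exists_max_image Finset.univ (fun i => V (v i)) ⟨s, Finset.mem_univ _⟩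
  have hi₀' : ∀ i, V (v i) ≤ V (v i₀) := fun i => hi₀ i (Finset.mem_univ _)
  have hpos : 0 < V (v i₀) := lt_of_lt_of_le (zero_lt_iff.2 (V.ne_zero_iff.2 hvs)) (hi₀' s)
  have hi₀S : i₀ ∈ S := by
    by_contra h
    rw [hvS _ h] at hpos
    simp at hpos
  set c := V (v i₀)
  have hw0 : ∀ j ∈ A, (u₂ *ᵥ v) j = 0 := fun j hj => congrFun (LinearMap.mem_ker.1 hv₀) ⟨j, hj⟩
  have hw : ∀ j, V ((u₂ *ᵥ v) j) ≤ c := mulVec_val_le V _ _ _ fun r j => by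
    rw [map_mul]; exact mul_le_of_le_one_of_le (hu₂ r j) (hi₀' j)
  have hMw : ∀ j, V ((M *ᵥ (u₂ *ᵥ v)) j) ≤ V π ^ (t + 1) * c := mulVec_val_le V _ _ _ fun r j => by
    by_cases hj : j ∈ A
    · rw [hw0 j hj]; simp
    · rw [map_mul]
      refine mul_le_mul' ((hM r j).trans ?_) (hw j)
      have : t < a j := by simpa [hA] using hj
      exact zpow_le_zpow_right_of_le_one₀ hV0 hπ.le this
  have hDv : V ((u₁ *ᵥ (M *ᵥ (u₂ *ᵥ v))) i₀) ≤ V π ^ (t + 1) * c :=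
    mulVec_val_le V _ _ _ (fun r j => by
      rw [map_mul]; exact mul_le_of_le_one_of_le (hu₁ r j) (hMw j)) i₀
  rw [Matrix.mulVec_mulVec, Matrix.mulVec_mulVec, ← hD, Matrix.mulVec_diagonal, map_mul,
    map_zpow₀] at hDv
  have h1 := le_of_mul_le_mul_right hDv hpos
  have h2 : μ i₀ ≤ t := by simpa [hS] using hi₀S
  have h3 : V π ^ (t + 1) < V π ^ (μ i₀) := zpow_lt_zpow_right_of_lt_one₀ hV0 hπ (by omega)
  exact absurd h1 (not_le.2 h3)

end Val

lemma Bmat_pow_col (hp : (p : K) ≠ 0) (m : ℕ) (hm : 0 < m) (h : ℤ) (k : ℕ) (r j : Fin m) :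
    (Bmat p κ m h ^ k) r j = if (r : ℤ) % m = ((j : ℤ) + k * h) % m then
      (p : K) ^ (((j : ℤ) + k * h) / m) else 0 := by
  have hm' : (0 : ℤ) < m := by exact_mod_cast hm
  have hmod : ∀ i : Fin m, ((i : ℕ) : ℤ) % m = i := fun i =>
    Int.emod_eq_of_lt (by positivity) (by exact_mod_cast i.2)
  induction k generalizing r j with
  | zero =>
    have := hmod j
    have := hmod r
    have h0 : (((j : ℕ) : ℤ)) / m = 0 :=
      Int.ediv_eq_zero_of_lt (by positivity) (by exact_mod_cast j.2)
    simp [Matrix.one_apply, hmod, h0, Fin.ext_iff]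
  | succ k ih =>
    rw [pow_succ, Matrix.mul_apply]
    have hs0 := Int.emod_nonneg ((j : ℤ) + h) hm'.ne'
    have hs1 := Int.emod_lt_of_pos ((j : ℤ) + h) hm'
    let s : Fin m := ⟨(((j : ℤ) + h) % m).toNat, by omega⟩
    have hs : ((s : ℕ) : ℤ) = ((j : ℤ) + h) % m := Int.toNat_of_nonneg hs0
    rw [Finset.sum_eq_single s]
    · have hB : Bmat p κ m h s j = (p : K) ^ (((j : ℤ) + h) / m) := by
        unfold Bmat
        rw [if_pos (by rw [hmod, hs])]
      rw [ih, hB]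
      have e : ((j : ℤ) + ((k + 1 : ℕ) : ℤ) * h) = (s + k * h) + m * (((j : ℤ) + h) / m) := by
        have := Int.emod_add_mul_ediv ((j : ℤ) + h) m
        rw [← hs] at this
        push_cast
        linarith
      rw [e, Int.add_mul_emod_self_left, Int.add_mul_ediv_left _ _ hm'.ne']
      split_ifs
      · rw [zpow_add₀ hp]
      · simp
    · intro b _ hb
      have : Bmat p κ m h b j = 0 := by
        unfold Bmat
        rw [if_neg]
        rw [hmod, ← hs]
        intro h
        exact hb (Fin.ext (by exact_mod_cast h))
      rw [this, mul_zero]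
    · simp

lemma minMatrix_pow {n : ℕ} (D : BlockData n) (k : ℕ) :
    minMatrix p κ D ^ k = (Matrix.blockDiagonal' fun i => Bmat p κ (D.m i) (D.h i) ^ k).submatrix
      ⇑D.equiv.symm ⇑D.equiv.symm := by
  have h : (fun i => Bmat p κ (D.m i) (D.h i) ^ k) = (fun i => Bmat p κ (D.m i) (D.h i)) ^ k := rfl
  rw [h, Matrix.blockDiagonal'_pow]
  unfold minMatrix
  induction k with
  | zero => simp
  | succ k ih => rw [pow_succ, pow_succ, ih rfl, Matrix.submatrix_mul_equiv]

/-- exponent of column `j` of the `k`-th power -/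
def aOf {n : ℕ} (D : BlockData n) (k : ℕ) (j : Fin n) : ℤ :=
  ((((D.equiv.symm j).2 : ℕ) : ℤ) + k * D.h (D.equiv.symm j).1) / D.m (D.equiv.symm j).1

lemma minMatrix_pow_entry (hp : (p : K) ≠ 0) {n : ℕ} (D : BlockData n) (k : ℕ) (r j : Fin n) :
    (minMatrix p κ D ^ k) r j = 0 ∨ (minMatrix p κ D ^ k) r j = (p : K) ^ aOf D k j := by
  rw [minMatrix_pow, Matrix.submatrix_apply]
  unfold aOf
  generalize D.equiv.symm r = x
  generalize D.equiv.symm j = y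
  obtain ⟨i, x⟩ := x
  obtain ⟨i', y⟩ := y
  by_cases hi : i = i'
  · subst hi
    rw [Matrix.blockDiagonal'_apply_eq, Bmat_pow_col p κ hp _ (D.m_pos i)]
    split_ifs
    · right; rfl
    · left; rfl
  · left; exact Matrix.blockDiagonal'_apply_ne _ _ _ hi

lemma nuOf_antitone {n : ℕ} (D : BlockData n) : Antitone (nuOf D) := by
  intro a b hab
  unfold nuOf
  apply D.slopes_antitone
  have ha := D.equiv_val (D.equiv.symm a)
  have hb := D.equiv_val (D.equiv.symm b)
  rw [Equiv.apply_symm_apply] at ha hb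
  generalize D.equiv.symm a = x at *
  generalize D.equiv.symm b = y at *
  by_contra hlt
  push Not at hlt
  have h1 : (∑ j : Fin D.len, if j < y.1 then D.m j else 0) + D.m y.1
      ≤ ∑ j : Fin D.len, if j < x.1 then D.m j else 0 := by
    have : D.m y.1 = ∑ j : Fin D.len, if j = y.1 then D.m j else 0 := by simp
    rw [this, ← Finset.sum_add_distrib]
    refine Finset.sum_le_sum fun j _ => ?_
    by_cases h2 : j = y.1
    · subst h2; simp [hlt]
    · by_cases h3 : j < y.1
      · simp [h2, h3, h3.trans hlt]
      · simp [h2, h3]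
  have := y.2.2
  have : (a : ℕ) ≤ b := hab
  omega

lemma unsorted_bound {n : ℕ} (D : BlockData n) (k : ℕ) :
    ∑ i, max ((k : ℚ) * nuOf D i - (aOf D k i : ℚ)) 0 ≤ (n : ℚ) / 4 := by
  rw [← D.equiv.sum_comp, Fintype.sum_sigma]
  have hn : (n : ℚ) = ∑ i, (D.m i : ℚ) := by
    have := Fintype.card_congr D.equiv
    simp at this
    exact_mod_cast this.symm
  rw [hn, Finset.sum_div]
  refine Finset.sum_le_sum fun i _ => ?_
  have := block_bound (D.m i) (D.m_pos i) (k * D.h i)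
  refine le_trans (le_of_eq ?_) this
  refine Finset.sum_congr rfl fun j _ => ?_
  rw [nuOf, aOf, Equiv.symm_apply_apply]
  simp [mul_div_assoc]

theorem statement_5 (n : ℕ) (D : BlockData n) (k : ℕ) (hk : 1 ≤ k)
    (μ : Fin n → ℤ) (hμ : IsHodgePoint p κ ((minMatrix p κ D) ^ k) μ) :
    tdist (fun i => (k : ℚ) * nuOf D i) (fun i => (μ i : ℚ)) ≤ (n : ℚ) / 4 := by
  have hpW : (p : 𝕎) ≠ 0 := (WittVector.irreducible p).ne_zero
  have hinj := IsFractionRing.injective 𝕎 K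
  have hp : (p : K) ≠ 0 := by
    rw [← map_natCast (algebraMap 𝕎 K)]
    exact fun h => hpW (hinj (by rw [h, map_zero]))
  let V := ValuationRing.valuation 𝕎 K
  have hint : ∀ x : 𝕎, V (algebraMap 𝕎 K x) ≤ 1 := fun x =>
    (ValuationRing.mem_integer_iff 𝕎 K _).2 ⟨x, rfl⟩
  have hVp : V (p : K) < 1 := by
    rw [← map_natCast (algebraMap 𝕎 K)]
    refine lt_of_le_of_ne (hint _) fun h => ?_
    have h' : V (algebraMap 𝕎 K p)⁻¹ ≤ 1 := by rw [map_inv₀, h, inv_one]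
    obtain ⟨y, hy⟩ := (ValuationRing.mem_integer_iff 𝕎 K _).1 h'
    refine (WittVector.irreducible p (k := κ)).not_isUnit (IsUnit.of_mul_eq_one y (hinj ?_))
    rw [map_mul, hy, map_one, mul_inv_cancel₀]
    rwa [map_natCast]
  obtain ⟨hanti, c₁, c₂, ⟨d₁, hd₁, rfl⟩, ⟨d₂, hd₂, rfl⟩, hb⟩ := hμ
  have hinv₁ : (d₁⁻¹).map (algebraMap 𝕎 K) * d₁.map (algebraMap 𝕎 K) = 1 := by
    rw [← Matrix.map_mul, Matrix.nonsing_inv_mul _ hd₁, Matrix.map_one _ (map_zero _) (map_one _)]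
  have hinv₂ : d₂.map (algebraMap 𝕎 K) * (d₂⁻¹).map (algebraMap 𝕎 K) = 1 := by
    rw [← Matrix.map_mul, Matrix.mul_nonsing_inv _ hd₂, Matrix.map_one _ (map_zero _) (map_one _)]
  refine le_trans ?_ (unsorted_bound D k)
  refine sorted_le _ (fun i j h => mul_le_mul_of_nonneg_left (nuOf_antitone D h) (by positivity))
    μ (aOf D k) hanti ?_
  refine count_le V (p : K) hp hVp (minMatrix p κ D ^ k) ((d₁⁻¹).map (algebraMap 𝕎 K))
    ((d₂⁻¹).map (algebraMap 𝕎 K)) μ (aOf D k) (fun i j => hint _) (fun i j => hint _) ?_ ?_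
  · intro i j
    rcases minMatrix_pow_entry p κ hp D k i j with h | h
    · rw [h, map_zero]; exact zero_le
    · rw [h, map_zpow₀]
  · rw [hb]
    simp only [mul_assoc]
    rw [hinv₂, mul_one, ← mul_assoc, hinv₁, one_mul]

end
end

section
/- For all A, B ∈ GL_n(K), every 1 ≤ l ≤ n and every subset S ⊆ {1,…,n} with |S| = l: Σ_{i=n−l+1}^n μ(AB)_i ≤ Σ_{i∈S} μ(A)_i + Σ_{i∈S} μ(B)_{n+1−i}. (Equivalently, in the dominance order, μ(A) ⊕_{w_0} μ(B) ≼ μ(AB), where ⊕_{w_0} adds the decreasing representative of μ(A) to the increasing rearrangement of μ(B).) -/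
/-!
Statement 7.  For `A, B ∈ GL_n(K)`, `1 ≤ l ≤ n` and `S ⊆ {1,…,n}` with `|S| = l`:
`Σ_{i=n−l+1}^n μ(AB)_i ≤ Σ_{i∈S} μ(A)_i + Σ_{i∈S} μ(B)_{n+1−i}`.
With 0-indexed decreasing tuples, `μ(B)_{n+1−i}` is `μB (Fin.rev i)`.
-/

open Matrix

noncomputable section

variable (p : ℕ) [Fact p.Prime] (κ : Type) [Field κ] [IsAlgClosed κ] [CharP κ p]

local notation "𝕎" => WittVector p κ
local notation "K" => FractionRing (WittVector p κ)

section Helpers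

set_option linter.unusedSectionVars false

variable {R F : Type*} [CommRing R] [IsDomain R] [IsDiscreteValuationRing R]
  [Field F] [Algebra R F] [IsFractionRing R F]

/-- `c` lies in `GL_n(R)` inside the matrices over `F`. -/
def IntU (R : Type*) {F : Type*} [CommRing R] [Field F] [Algebra R F] {n : ℕ}
    (c : Matrix (Fin n) (Fin n) F) : Prop :=
  ∃ d : Matrix (Fin n) (Fin n) R, IsUnit d.det ∧ c = d.map (algebraMap R F)

theorem IntU.mul {n : ℕ} {c d : Matrix (Fin n) (Fin n) F} (hc : IntU R c) (hd : IntU R d) :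
    IntU R (c * d) := by
  obtain ⟨c', hc, rfl⟩ := hc
  obtain ⟨d', hd, rfl⟩ := hd
  exact ⟨c' * d', by rw [det_mul]; exact hc.mul hd, by rw [Matrix.map_mul]⟩

theorem IntU.exists_inv {n : ℕ} {c : Matrix (Fin n) (Fin n) F} (hc : IntU R c) :
    ∃ d, IntU R d ∧ c * d = 1 ∧ d * c = 1 := by
  obtain ⟨c', hc, rfl⟩ := hc
  refine ⟨c'⁻¹.map (algebraMap R F), ⟨c'⁻¹, ?_, rfl⟩, ?_, ?_⟩
  · exact (Matrix.isUnit_nonsing_inv_det_iff).2 hc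
  · rw [← Matrix.map_mul, Matrix.mul_nonsing_inv _ hc]; simp
  · rw [← Matrix.map_mul, Matrix.nonsing_inv_mul _ hc]; simp

/-- Unordered Smith form. -/
def HP (R : Type*) {F : Type*} [CommRing R] [Field F] [Algebra R F] (ϖ : R) {n : ℕ}
    (b : Matrix (Fin n) (Fin n) F) (μ : Fin n → ℤ) : Prop :=
  ∃ c₁ c₂ : Matrix (Fin n) (Fin n) F, IntU R c₁ ∧ IntU R c₂ ∧
    b = c₁ * Matrix.diagonal (fun i => (algebraMap R F ϖ) ^ (μ i)) * c₂

theorem IntU.perm {n : ℕ} (σ : Equiv.Perm (Fin n)) :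
    IntU R ((1 : Matrix (Fin n) (Fin n) F).submatrix σ id) := by
  refine ⟨(1 : Matrix (Fin n) (Fin n) R).submatrix σ id, ?_, ?_⟩
  · rw [Matrix.det_permute]
    simp
    exact (Int.isUnit_iff_natAbs_eq.2 (by simp)).map (Int.castRingHom R) 
  · rw [← Matrix.submatrix_map]; simp

theorem IntU.perm' {n : ℕ} (σ : Equiv.Perm (Fin n)) :
    IntU R ((1 : Matrix (Fin n) (Fin n) F).submatrix id σ) := by
  refine ⟨(1 : Matrix (Fin n) (Fin n) R).submatrix id σ, ?_, ?_⟩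
  · rw [Matrix.det_permute']
    simp
    exact (Int.isUnit_iff_natAbs_eq.2 (by simp)).map (Int.castRingHom R) 
  · rw [← Matrix.submatrix_map]; simp

theorem HP.perm {ϖ : R} {n : ℕ} {b : Matrix (Fin n) (Fin n) F} {μ : Fin n → ℤ}
    (h : HP R ϖ b μ) (σ : Equiv.Perm (Fin n)) : HP R ϖ b (μ ∘ σ) := by
  obtain ⟨c₁, c₂, h₁, h₂, rfl⟩ := h
  refine ⟨c₁ * (1 : Matrix (Fin n) (Fin n) F).submatrix id σ,
    (1 : Matrix (Fin n) (Fin n) F).submatrix σ id * c₂, h₁.mul (IntU.perm' σ),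
    (IntU.perm σ).mul h₂, ?_⟩
  have : Matrix.diagonal (fun i => (algebraMap R F ϖ) ^ (μ i)) =
      (1 : Matrix (Fin n) (Fin n) F).submatrix id σ *
      Matrix.diagonal (fun i => (algebraMap R F ϖ) ^ ((μ ∘ σ) i)) *
      (1 : Matrix (Fin n) (Fin n) F).submatrix σ id := by
    have e : Matrix.diagonal (fun i => (algebraMap R F ϖ) ^ ((μ ∘ σ) i)) =
      (Matrix.diagonal (fun i => (algebraMap R F ϖ) ^ (μ i))).submatrix σ σ := by
      rw [Matrix.submatrix_diagonal_equiv]; rfl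
    rw [e, Matrix.submatrix_mul_equiv, Matrix.submatrix_mul_equiv]
    simp
  rw [this]
  simp only [Matrix.mul_assoc]

theorem HP.mul_left {ϖ : R} {n : ℕ} {b c : Matrix (Fin n) (Fin n) F} {μ : Fin n → ℤ}
    (h : HP R ϖ b μ) (hc : IntU R c) : HP R ϖ (c * b) μ := by
  obtain ⟨c₁, c₂, h₁, h₂, rfl⟩ := h
  exact ⟨c * c₁, c₂, hc.mul h₁, h₂, by simp only [Matrix.mul_assoc]⟩

theorem HP.mul_right {ϖ : R} {n : ℕ} {b c : Matrix (Fin n) (Fin n) F} {μ : Fin n → ℤ}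
    (h : HP R ϖ b μ) (hc : IntU R c) : HP R ϖ (b * c) μ := by
  obtain ⟨c₁, c₂, h₁, h₂, rfl⟩ := h
  exact ⟨c₁, c₂ * c, h₁, h₂.mul hc, by simp only [Matrix.mul_assoc]⟩

theorem q_ne_zero {ϖ : R} (hϖ : Irreducible ϖ) : algebraMap R F ϖ ≠ 0 := by
  simpa using hϖ.ne_zero

theorem dvd_of_zpow {ϖ : R} (hϖ : Irreducible ϖ) {x y : R} {a b : ℤ} (hab : b < a)
    (h : (algebraMap R F ϖ) ^ a * algebraMap R F x = algebraMap R F y * (algebraMap R F ϖ) ^ b) :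
    ϖ ∣ y := by
  have q0 : algebraMap R F ϖ ≠ 0 := q_ne_zero hϖ
  obtain ⟨k, hk⟩ : ∃ k : ℕ, a = b + 1 + k := ⟨(a - b - 1).toNat, by omega⟩
  refine ⟨ϖ ^ k * x, ?_⟩
  apply IsFractionRing.injective R F
  have hb : (algebraMap R F ϖ) ^ b ≠ 0 := zpow_ne_zero _ q0
  apply mul_right_cancel₀ hb
  rw [← h, hk, zpow_add₀ q0, zpow_add₀ q0]
  simp
  ring

theorem mono {ϖ : R} (hϖ : Irreducible ϖ) {n : ℕ} {X Y : Matrix (Fin n) (Fin n) F}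
    {μ ν : Fin n → ℤ} (hX : HP R ϖ X μ) (hY : HP R ϖ Y ν) (hμ : Antitone μ) (hν : Antitone ν)
    (T : Matrix (Fin n) (Fin n) R) (h : Y = X * T.map (algebraMap R F)) (i : Fin n) :
    μ i ≤ ν i := by
  by_contra! hlt
  obtain ⟨c₁, c₂, h₁, ⟨c₂', -, rfl⟩, rfl⟩ := hX
  obtain ⟨d₁, d₂, k₁, k₂, rfl⟩ := hY
  obtain ⟨e₁, he₁, -, hec⟩ := h₁.exists_inv
  obtain ⟨e₂, ⟨e₂', -, rfl⟩, hde, -⟩ := k₂.exists_inv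
  obtain ⟨Q, hQ, hQe⟩ := he₁.mul k₁
  have key : Q.map (algebraMap R F) * Matrix.diagonal (fun i => (algebraMap R F ϖ) ^ (ν i)) =
      Matrix.diagonal (fun i => (algebraMap R F ϖ) ^ (μ i)) *
        (c₂' * T * e₂').map (algebraMap R F) := by
    rw [← hQe, Matrix.map_mul, Matrix.map_mul]
    calc _ = e₁ * (d₁ * Matrix.diagonal (fun i => (algebraMap R F ϖ) ^ (ν i)) * d₂) *
            e₂'.map (algebraMap R F) := by
          simp only [Matrix.mul_assoc, hde, Matrix.mul_one]
      _ = (e₁ * c₁) * _ := by rw [h]; simp only [Matrix.mul_assoc]; rfl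
      _ = _ := by rw [hec, Matrix.one_mul]; simp only [Matrix.mul_assoc]
  have hdvd : ∀ a b : Fin n, a ≤ i → i ≤ b → ϖ ∣ Q a b := by
    intro a b ha hb
    have e := congrFun (congrFun key a) b
    rw [Matrix.mul_diagonal, Matrix.diagonal_mul] at e
    have := hμ ha
    have := hν hb
    exact dvd_of_zpow (F := F) hϖ (show ν b < μ a by omega) e.symm
  apply hϖ.not_isUnit
  refine isUnit_of_dvd_unit ?_ hQ
  rw [Matrix.det_apply']
  refine Finset.dvd_sum fun σ _ => Dvd.dvd.mul_left ?_ _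
  obtain ⟨j, hj1, hj2⟩ : ∃ j, i ≤ j ∧ σ j ≤ i := by
    by_contra! hcon
    have : (Finset.Ici i).card ≤ (Finset.Ioi i).card :=
      Finset.card_le_card_of_injOn σ (fun j hj => by
        have := hcon j (by simpa using hj)
        simpa using this) σ.injective.injOn
    simp at this
    omega
  exact (hdvd _ _ hj2 hj1).trans (Finset.dvd_prod_of_mem _ (Finset.mem_univ j))

theorem HP.det {ϖ : R} (hϖ : Irreducible ϖ) {n : ℕ} {X : Matrix (Fin n) (Fin n) F}
    {μ : Fin n → ℤ} (hX : HP R ϖ X μ) :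
    ∃ u : R, IsUnit u ∧ X.det = algebraMap R F u * (algebraMap R F ϖ) ^ (∑ i, μ i) := by
  obtain ⟨c₁, c₂, ⟨c₁', h₁, rfl⟩, ⟨c₂', h₂, rfl⟩, rfl⟩ := hX
  refine ⟨c₁'.det * c₂'.det, h₁.mul h₂, ?_⟩
  have hp : ∀ s : Finset (Fin n), ∏ i ∈ s, (algebraMap R F ϖ) ^ (μ i) =
      (algebraMap R F ϖ) ^ (∑ i ∈ s, μ i) := by
    intro s
    induction s using Finset.induction_on with
    | empty => simp
    | insert a s ha ih =>
      rw [Finset.prod_insert ha, Finset.sum_insert ha, zpow_add₀ (q_ne_zero hϖ), ih]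
  have e : ∀ c : Matrix (Fin n) (Fin n) R, (c.map (algebraMap R F)).det = algebraMap R F c.det :=
    fun c => ((algebraMap R F).map_det c).symm
  rw [det_mul, det_mul, det_diagonal, hp, e, e, map_mul]
  ring

theorem zpow_unique {ϖ : R} (hϖ : Irreducible ϖ) {u v : R} (hu : IsUnit u) (hv : IsUnit v)
    {a b : ℤ} (h : algebraMap R F u * (algebraMap R F ϖ) ^ a =
      algebraMap R F v * (algebraMap R F ϖ) ^ b) : a = b := by
  rcases lt_trichotomy a b with hl | hl | hl
  · exact absurd (isUnit_of_dvd_unit (dvd_of_zpow hϖ hl (by rw [h, mul_comm])) hu) hϖ.not_isUnit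
  · exact hl
  · exact absurd (isUnit_of_dvd_unit (dvd_of_zpow hϖ hl (by rw [← h, mul_comm])) hv) hϖ.not_isUnit

theorem snf_int {n : ℕ} (M : Matrix (Fin n) (Fin n) R) (hM : M.det ≠ 0) :
    ∃ (c₁ c₂ : Matrix (Fin n) (Fin n) R) (a : Fin n → R), IsUnit c₁.det ∧ IsUnit c₂.det ∧
      M = c₁ * Matrix.diagonal a * c₂ := by
  have hinj : Function.Injective M.mulVecLin := by
    rw [← LinearMap.ker_eq_bot, Matrix.ker_mulVecLin_eq_bot_iff]
    intro v hv
    exact Matrix.eq_zero_of_mulVec_eq_zero hM hv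
  let f := LinearEquiv.ofInjective M.mulVecLin hinj
  obtain ⟨b', a, ab', hab⟩ := Submodule.exists_smith_normal_form_of_rank_eq
    (N := LinearMap.range M.mulVecLin) (Pi.basisFun R (Fin n)) f.finrank_eq.symm
  let v := ab'.map f.symm
  let V := (Pi.basisFun R (Fin n)).toMatrix v
  let B := (Pi.basisFun R (Fin n)).toMatrix b'
  have hV : IsUnit V.det := by
    have := (Pi.basisFun R (Fin n)).isUnit_det v
    rwa [Module.Basis.det_apply] at this
  have hB : IsUnit B.det := by
    have := (Pi.basisFun R (Fin n)).isUnit_det b'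
    rwa [Module.Basis.det_apply] at this
  have hMV : M * V = B * Matrix.diagonal a := by
    ext i j
    rw [Matrix.mul_diagonal]
    have h1 : M.mulVecLin (v j) = a j • b' j := by
      rw [← hab j]
      have : f (v j) = ab' j := by simp [v]
      rw [← this]; rfl
    have h2 := congrFun h1 i
    simp only [Matrix.mulVecLin_apply, Matrix.mulVec, dotProduct, Pi.smul_apply, smul_eq_mul] at h2
    rw [Matrix.mul_apply]
    simp only [V, B, Module.Basis.toMatrix_apply, Pi.basisFun_repr]
    rw [h2, mul_comm]
  refine ⟨B, V⁻¹, a, hB, (Matrix.isUnit_nonsing_inv_det_iff).2 hV, ?_⟩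
  rw [← hMV, Matrix.mul_assoc, Matrix.mul_nonsing_inv _ hV, Matrix.mul_one]

theorem snf {ϖ : R} (hϖ : Irreducible ϖ) {n : ℕ} (Z : Matrix (Fin n) (Fin n) F)
    (hZ : Z.det ≠ 0) : ∃ μ : Fin n → ℤ, Antitone μ ∧ HP R ϖ Z μ := by
  have q0 : algebraMap R F ϖ ≠ 0 := q_ne_zero hϖ
  suffices ∃ μ : Fin n → ℤ, HP R ϖ Z μ by
    obtain ⟨μ, hμ⟩ := this
    refine ⟨μ ∘ (Tuple.sort (fun i => - μ i)), ?_, hμ.perm _⟩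
    have := Tuple.monotone_sort (fun i => - μ i)
    intro i j hij
    have := this hij
    simp at this
    simpa using this
  obtain ⟨d, hd⟩ := IsLocalization.exist_integer_multiples_of_finite (nonZeroDivisors R)
    (fun ij : Fin n × Fin n => Z ij.1 ij.2)
  choose m hm using hd
  have hd0 : (d : R) ≠ 0 := nonZeroDivisors.ne_zero d.2
  have hdF : algebraMap R F d ≠ 0 := by simpa using hd0
  let M : Matrix (Fin n) (Fin n) R := Matrix.of fun i j => m (i, j)
  have hMZ : M.map (algebraMap R F) = algebraMap R F d • Z := by
    ext i j
    have := hm (i, j)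
    simp only [M, Matrix.map_apply, Matrix.of_apply, Matrix.smul_apply, smul_eq_mul, this]
    rw [Algebra.smul_def]
  have hMdet : M.det ≠ 0 := by
    intro h0
    have : (M.map (algebraMap R F)).det = 0 := by
      rw [← RingHom.mapMatrix_apply, ← RingHom.map_det, h0, map_zero]
    rw [hMZ, det_smul] at this
    exact (mul_ne_zero (pow_ne_zero _ hdF) hZ) this
  obtain ⟨c₁, c₂, a, h₁, h₂, hM⟩ := snf_int M hMdet
  have ha : ∀ i, a i ≠ 0 := by
    intro i hi
    apply hMdet
    rw [hM, det_mul, det_mul, det_diagonal, Finset.prod_eq_zero (Finset.mem_univ i) hi]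
    simp
  choose e u hu using fun i => IsDiscreteValuationRing.eq_unit_mul_pow_irreducible (ha i) hϖ
  obtain ⟨k, w, hw⟩ := IsDiscreteValuationRing.eq_unit_mul_pow_irreducible hd0 hϖ
  refine ⟨fun i => (e i : ℤ) - k,
    (c₁ * Matrix.diagonal (fun i => (u i : R) * (w⁻¹ : Rˣ))).map (algebraMap R F),
    c₂.map (algebraMap R F), ⟨_, ?_, rfl⟩, ⟨_, h₂, rfl⟩, ?_⟩
  · rw [det_mul, det_diagonal]
    refine h₁.mul ?_
    have : ∏ i, ((u i : R) * (w⁻¹ : Rˣ)) = ((∏ i, (u i * w⁻¹) : Rˣ) : R) := by simp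
    rw [this]; exact Units.isUnit _
  · have hZM : Z = (algebraMap R F d)⁻¹ • M.map (algebraMap R F) := by
      rw [hMZ, smul_smul, inv_mul_cancel₀ hdF, one_smul]
    rw [hZM, hM, Matrix.map_mul, Matrix.map_mul, Matrix.map_mul, ← Matrix.smul_mul,
      Matrix.mul_assoc (c₁.map _), ← Matrix.mul_smul]
    congr 2
    rw [Matrix.diagonal_map (map_zero _), Matrix.diagonal_map (map_zero _),
      Matrix.diagonal_mul_diagonal, ← Matrix.diagonal_smul]
    congr 1
    funext i
    have hwF : algebraMap R F (w : R) * algebraMap R F ((w⁻¹ : Rˣ) : R) = 1 := by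
      rw [← map_mul]; simp
    have hk : (algebraMap R F ϖ) ^ k ≠ 0 := pow_ne_zero _ q0
    simp only [Pi.smul_apply, smul_eq_mul, Function.comp_apply]
    rw [inv_mul_eq_iff_eq_mul₀ hdF, hu, hw, zpow_sub₀ q0]
    simp only [map_mul, map_pow, zpow_natCast]
    field_simp
    linear_combination (-1 : F) * hwF

theorem map_diag {ϖ : R} (hϖ : Irreducible ϖ) {n : ℕ} (m : Fin n → ℤ) (hm : ∀ i, 0 ≤ m i) :
    ∃ T : Matrix (Fin n) (Fin n) R,
      Matrix.diagonal (fun i => (algebraMap R F ϖ) ^ (m i)) = T.map (algebraMap R F) := by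
  refine ⟨Matrix.diagonal fun i => ϖ ^ (m i).toNat, ?_⟩
  rw [Matrix.diagonal_map (map_zero _)]
  congr 1
  funext i
  simp only [Function.comp_apply, map_pow]
  rw [← zpow_natCast, Int.toNat_of_nonneg (hm i)]

theorem main_ineq {ϖ : R} (hϖ : Irreducible ϖ) (n : ℕ) (A B : Matrix (Fin n) (Fin n) F)
    (hA : IsUnit A.det)
    (μA μB μM : Fin n → ℤ) (sA : Antitone μA) (sB : Antitone μB) (sM : Antitone μM)
    (hμA : HP R ϖ A μA) (hμB : HP R ϖ B μB)
    (hμM : HP R ϖ (A * B) μM)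
    (l : ℕ) (hl : 1 ≤ l) (hln : l ≤ n)
    (S : Finset (Fin n)) (hS : S.card = l) :
    (∑ i : Fin n, if n - l ≤ (i : ℕ) then μM i else 0) ≤
      (∑ i ∈ S, μA i) + ∑ i ∈ S, μB i.rev := by
  have q0 : algebraMap R F ϖ ≠ 0 := q_ne_zero hϖ
  set t : ℤ := μM ⟨n - l, by omega⟩ with ht
  obtain ⟨c₁, c₂, h₁, ⟨c₂', h₂, rfl⟩, hM⟩ := hμM
  have hinv : HP R ϖ (A⁻¹ * c₁ * Matrix.diagonal (fun _ => (algebraMap R F ϖ) ^ t))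
      (fun i => t - μA i) := by
    obtain ⟨a₁, a₂, k₁, k₂, hAe⟩ := hμA
    obtain ⟨b₁, j₁, hab₁, hba₁⟩ := k₁.exists_inv
    obtain ⟨b₂, j₂, hab₂, hba₂⟩ := k₂.exists_inv
    have hAi : A⁻¹ = b₂ * Matrix.diagonal (fun i => (algebraMap R F ϖ) ^ (- μA i)) * b₁ := by
      apply Matrix.inv_eq_right_inv
      rw [hAe]
      calc _ = a₁ * (Matrix.diagonal (fun i => (algebraMap R F ϖ) ^ (μA i)) * ((a₂ * b₂) *
            Matrix.diagonal (fun i => (algebraMap R F ϖ) ^ (- μA i)))) * b₁ := by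
              simp only [Matrix.mul_assoc]
        _ = 1 := by
          rw [hab₂, Matrix.one_mul, Matrix.diagonal_mul_diagonal]
          have : (fun i => (algebraMap R F ϖ) ^ (μA i) * (algebraMap R F ϖ) ^ (- μA i)) =
              fun _ => (1 : F) := by
            funext i
            rw [← zpow_add₀ q0]; simp
          rw [this, Matrix.diagonal_one, Matrix.mul_one, hab₁]
    refine ⟨b₂, b₁ * c₁, j₂, j₁.mul h₁, ?_⟩
    have hsc : ∀ X : Matrix (Fin n) (Fin n) F,
        X * Matrix.diagonal (fun _ => (algebraMap R F ϖ) ^ t) = (algebraMap R F ϖ) ^ t • X := by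
      intro X
      ext i j
      rw [Matrix.mul_diagonal, Matrix.smul_apply, smul_eq_mul, mul_comm]
    have hd : Matrix.diagonal (fun i => (algebraMap R F ϖ) ^ (t - μA i)) =
        (algebraMap R F ϖ) ^ t • Matrix.diagonal (fun i => (algebraMap R F ϖ) ^ (- μA i)) := by
      rw [← Matrix.diagonal_smul]
      congr 1
      funext i
      simp only [Pi.smul_apply, smul_eq_mul]
      rw [← zpow_add₀ q0]; congr 1
    rw [hsc, hAi, hd]
    simp only [Matrix.mul_assoc, Matrix.smul_mul, Matrix.mul_smul]
  have hinv' := hinv.perm Fin.revPerm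
  have sinv : Antitone ((fun i => t - μA i) ∘ (Fin.revPerm : Equiv.Perm (Fin n))) := by
    intro i j hij
    have := sA (Fin.rev_le_rev.2 hij)
    simp only [Function.comp_apply, Fin.revPerm_apply]
    omega
  set D' : Matrix (Fin n) (Fin n) F :=
    Matrix.diagonal (fun i => (algebraMap R F ϖ) ^ (min (μM i) t)) with hD'
  set Z := A⁻¹ * c₁ * D' with hZdef
  have hDdet : HP R ϖ (c₁ * D') (fun i => min (μM i) t) :=
    ⟨c₁, 1, h₁, ⟨1, by simp, by simp⟩, by rw [Matrix.mul_one]⟩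
  have hAZ : A * Z = c₁ * D' := by
    rw [hZdef, ← Matrix.mul_assoc, ← Matrix.mul_assoc, Matrix.mul_nonsing_inv _ hA, Matrix.one_mul]
  obtain ⟨u, hu, hue⟩ := hDdet.det hϖ
  have hZ : Z.det ≠ 0 := by
    intro h0
    have := congrArg Matrix.det hAZ
    rw [det_mul, h0, mul_zero, hue] at this
    exact mul_ne_zero (by simpa using hu.ne_zero) (zpow_ne_zero _ q0) this.symm
  obtain ⟨ζ, sζ, hζ⟩ := snf hϖ Z hZ
  have hsum : (∑ i, μA i) + ∑ i, ζ i = ∑ i, min (μM i) t := by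
    obtain ⟨v, hv, hve⟩ := hμA.det hϖ
    obtain ⟨w, hw, hwe⟩ := hζ.det hϖ
    refine zpow_unique (F := F) hϖ (hv.mul hw) hu ?_
    rw [← hue, ← hAZ, det_mul, hve, hwe, zpow_add₀ q0, map_mul]
    ring
  have hup : ∀ i : Fin n, ζ i.rev ≤ t - μA i := by
    intro i
    obtain ⟨T, hT⟩ := map_diag (F := F) hϖ (fun i => t - min (μM i) t) (fun i => by simp)
    have := mono hϖ hζ hinv' sζ sinv T (by
      rw [← hT, hZdef, Matrix.mul_assoc _ D', hD', Matrix.diagonal_mul_diagonal]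
      congr 2
      funext i
      rw [← zpow_add₀ q0]
      congr 1; omega) i.rev
    simpa using this
  have hlow : ∀ i : Fin n, ζ i ≤ μB i := by
    obtain ⟨T, hT⟩ := map_diag (F := F) hϖ (fun i => μM i - min (μM i) t) (fun i => by simp)
    refine mono hϖ hζ hμB sζ sB (T * c₂') ?_
    have hB : B = A⁻¹ * (A * B) := by
      rw [← Matrix.mul_assoc, Matrix.nonsing_inv_mul _ hA, Matrix.one_mul]
    rw [hB, hM, Matrix.map_mul, ← hT, hZdef, hD']
    simp only [Matrix.mul_assoc]
    rw [← Matrix.mul_assoc (Matrix.diagonal _) (Matrix.diagonal _), Matrix.diagonal_mul_diagonal]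
    congr 4
    funext i
    rw [← zpow_add₀ q0]
    congr 1; omega
  have hrev : ∑ i, ζ (Fin.rev i) = ∑ i, ζ i := Equiv.sum_comp Fin.revPerm ζ
  have e1 : ∑ i, (t - μA i - ζ (Fin.rev i)) = ∑ i, (t - min (μM i) t) := by
    simp only [Finset.sum_sub_distrib]
    rw [hrev, ← hsum]; ring
  have e2 : ∑ i ∈ S, (t - μA i - ζ (Fin.rev i)) ≤ ∑ i, (t - μA i - ζ (Fin.rev i)) :=
    Finset.sum_le_sum_of_subset_of_nonneg (Finset.subset_univ _)
      (fun i _ _ => by have := hup i; omega)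
  have e3 : ∑ i ∈ S, ζ (Fin.rev i) ≤ ∑ i ∈ S, μB (Fin.rev i) :=
    Finset.sum_le_sum fun i _ => hlow _
  have e4 : ∑ i, (t - min (μM i) t) =
      ∑ i : Fin n, ((if n - l ≤ (i : ℕ) then t else 0) - if n - l ≤ (i : ℕ) then μM i else 0) := by
    refine Finset.sum_congr rfl fun i _ => ?_
    split_ifs with h
    · have : μM i ≤ t := sM (show (⟨n - l, by omega⟩ : Fin n) ≤ i from h)
      omega
    · have : t ≤ μM i := sM (show i ≤ (⟨n - l, by omega⟩ : Fin n) from by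
        rw [Fin.le_def]; simp only; omega)
      omega
  have e5 : (∑ i : Fin n, if n - l ≤ (i : ℕ) then t else 0) = l * t := by
    rw [← Finset.sum_filter, Finset.sum_const]
    have : (Finset.univ.filter fun i : Fin n => n - l ≤ (i : ℕ)) =
        Finset.Ici (⟨n - l, by omega⟩ : Fin n) := by
      ext i; simp [Fin.le_def]
    rw [this, Fin.card_Ici]
    have : n - (n - l) = l := by omega
    simp [this]
  have e7 := e1.trans e4
  rw [e7, Finset.sum_sub_distrib (fun i : Fin n => if n - l ≤ (i : ℕ) then t else 0), e5] at e2
  have e6 : ∑ i ∈ S, (t - μA i - ζ (Fin.rev i)) =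
      l * t - ∑ i ∈ S, μA i - ∑ i ∈ S, ζ (Fin.rev i) := by
    simp [Finset.sum_sub_distrib, hS]
  linarith

end Helpers

theorem statement_7 (n : ℕ) (A B : Matrix (Fin n) (Fin n) K)
    (hA : IsUnit A.det) (hB : IsUnit B.det)
    (μA μB μAB : Fin n → ℤ)
    (hμA : IsHodgePoint p κ A μA) (hμB : IsHodgePoint p κ B μB)
    (hμAB : IsHodgePoint p κ (A * B) μAB)
    (l : ℕ) (hl : 1 ≤ l) (hln : l ≤ n)
    (S : Finset (Fin n)) (hS : S.card = l) :
    (∑ i : Fin n, if n - l ≤ (i : ℕ) then μAB i else 0) ≤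
      (∑ i ∈ S, μA i) + ∑ i ∈ S, μB i.rev := by
  have hϖ : Irreducible (p : WittVector p κ) := WittVector.irreducible p
  have conv : ∀ (b : Matrix (Fin n) (Fin n) (FractionRing (WittVector p κ))) (μ : Fin n → ℤ),
      IsHodgePoint p κ b μ → HP (WittVector p κ) (p : WittVector p κ) b μ := by
    rintro b μ ⟨-, c₁, c₂, h₁, h₂, h⟩
    exact ⟨c₁, c₂, h₁, h₂, by rw [h, map_natCast]⟩
  exact main_ineq hϖ n A B hA μA μB μAB hμA.1 hμB.1 hμAB.1 (conv _ _ hμA) (conv _ _ hμB)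
    (conv _ _ hμAB) l hl hln S hS

end
end

section
/- Let ν ∈ ℚ^n be a Newton datum and μ ∈ ℤ^n a decreasing tuple. Then there exists a finite set 𝒮 of decreasing integer n-tuples (depending only on n, ν and μ) with the following property: for every b ∈ GL_n(K) with μ(b) = μ which is σ-conjugate to b_{min,ν} (i.e. b = g'⁻¹·b_{min,ν}·σ(g') for some g' ∈ GL_n(K)), there exists g ∈ GL_n(K) with μ(g) ∈ 𝒮 and b = g⁻¹·b_{min,ν}·σ(g). -/
/-!
Statement 9.  Let `ν` be a Newton datum (encoded by its superbasic block data)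
and `μ` a decreasing integer tuple.  There is a finite set `𝒮` of decreasing
integer tuples, depending only on `n`, `ν`, `μ`, such that every `b ∈ GL_n(K)`
with Hodge point `μ` which is `σ`-conjugate to `b_{min,ν}` can be written as
`b = g⁻¹·b_{min,ν}·σ(g)` with `μ(g) ∈ 𝒮`.
-/

open Matrix

noncomputable section

variable (p : ℕ) [Fact p.Prime] (κ : Type) [Field κ] [IsAlgClosed κ] [CharP κ p]

local notation "𝕎" => WittVector p κ
local notation "K" => FractionRing (WittVector p κ)

/-- `twistedPow σ b i = (bσ)^i = b·σ(b)·σ²(b)···σ^{i−1}(b)`. -/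
def twistedPow {n : ℕ} (σ : K ≃+* K) (b : Matrix (Fin n) (Fin n) K) :
    ℕ → Matrix (Fin n) (Fin n) K
  | 0 => 1
  | (i + 1) => b * (twistedPow σ b i).map ⇑σ

set_option linter.unusedSectionVars false



/-- A finite-dimensional Frobenius-semilinear injection has a nonzero fixed vector. -/
def langPoly {k : Type*} [Field k] (q : ℕ) (a : ℕ → k) : ℕ → Polynomial k
  | 0 => Polynomial.C (a 0) * Polynomial.X ^ q
  | (i + 1) => langPoly q a i ^ q + Polynomial.C (a (i + 1)) * Polynomial.X ^ q

theorem langPoly_dvd {k : Type*} [Field k] (q : ℕ) (hq : 2 ≤ q) (a : ℕ → k) (i : ℕ) :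
    Polynomial.X ^ 2 ∣ langPoly q a i := by
  have h2 : (Polynomial.X : Polynomial k) ^ 2 ∣ Polynomial.X ^ q := pow_dvd_pow _ hq
  induction i with
  | zero => exact Dvd.dvd.mul_left h2 _
  | succ i ih =>
    exact dvd_add (ih.trans (dvd_pow_self _ (by omega))) (Dvd.dvd.mul_left h2 _)

theorem langPoly_deg {k : Type*} [Field k] (q : ℕ) (hq : 2 ≤ q) (a : ℕ → k) (i : ℕ) :
    (langPoly q a i = 0 ∧ ∀ j ≤ i, a j = 0) ∨ q ≤ (langPoly q a i).natDegree := by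
  have hX : ∀ c : k, c ≠ 0 → (Polynomial.C c * Polynomial.X ^ q).natDegree = q := by
    intro c hc
    exact Polynomial.natDegree_C_mul_X_pow q c hc
  induction i with
  | zero =>
    by_cases h : a 0 = 0
    · left; simp [langPoly, h]
    · right; simp only [langPoly]; rw [hX _ h]
  | succ i ih =>
    rcases ih with ⟨h0, h1⟩ | h
    · by_cases h : a (i+1) = 0
      · left
        constructor
        · simp [langPoly, h, h0]; omega
        · intro j hj
          rcases Nat.lt_or_ge i j with h' | h'
          · have : j = i + 1 := by omega
            rw [this, h]
          · exact h1 j h'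
      · right
        simp only [langPoly]
        rw [h0, zero_pow (by omega), zero_add, hX _ h]
    · right
      have e : (langPoly q a i ^ q).natDegree = q * (langPoly q a i).natDegree :=
        Polynomial.natDegree_pow _ _
      have l : (Polynomial.C (a (i+1)) * Polynomial.X ^ q).natDegree ≤ q :=
        Polynomial.natDegree_C_mul_X_pow_le _ _
      have : q < q * (langPoly q a i).natDegree := by nlinarith
      simp only [langPoly]
      rw [Polynomial.natDegree_add_eq_left_of_natDegree_lt (by omega), e]
      omega

theorem langPoly_root {k : Type*} [Field k] [IsAlgClosed k] (q : ℕ) (hq : 2 ≤ q) (a : ℕ → k)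
    (i : ℕ) (ha : ∃ j ≤ i, a j ≠ 0) : ∃ t : k, t ≠ 0 ∧ (langPoly q a i).eval t = t := by
  obtain ⟨R, hR⟩ := langPoly_dvd q hq a i
  rcases langPoly_deg q hq a i with ⟨_, h1⟩ | h
  · obtain ⟨j, hj, hj'⟩ := ha
    exact absurd (h1 j hj) hj'
  · have hR0 : R ≠ 0 := by
      rintro rfl
      simp [hR] at h; omega
    have hdeg : (Polynomial.X * R - 1 : Polynomial k).natDegree = (Polynomial.X * R).natDegree := by
      rw [Polynomial.natDegree_sub_eq_left_of_natDegree_lt]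
      rw [Polynomial.natDegree_X_mul hR0]; simp
    obtain ⟨t, ht⟩ := IsAlgClosed.exists_root (Polynomial.X * R - 1 : Polynomial k) (by
      apply ne_of_gt
      rw [← Polynomial.natDegree_pos_iff_degree_pos, hdeg, Polynomial.natDegree_X_mul hR0]
      omega)
    have ht' : t * R.eval t = 1 := by
      simpa [Polynomial.IsRoot, sub_eq_zero] using ht
    refine ⟨t, ?_, ?_⟩
    · rintro rfl; simp at ht'
    · rw [hR]; simp only [Polynomial.eval_mul, Polynomial.eval_pow, Polynomial.eval_X]
      rw [pow_two, mul_assoc, ht', mul_one]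

theorem lang_fixed {k V : Type*} [Field k] [IsAlgClosed k] [AddCommGroup V] [Module k V]
    [FiniteDimensional k V] [Nontrivial V] (q : ℕ) (hq : 2 ≤ q) (φ : V →+ V)
    (hφ : Function.Injective φ) (hs : ∀ (c : k) v, φ (c • v) = c ^ q • φ v) :
    ∃ w : V, w ≠ 0 ∧ φ w = w := by
  classical
  obtain ⟨v, hv⟩ := exists_ne (0 : V)
  let f : ℕ → V := fun i => φ^[i] v
  have hf : ∀ i, φ (f i) = f (i+1) := fun i => (Function.iterate_succ_apply' φ i v).symm
  have hf0 : ∀ i, f i ≠ 0 := by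
    intro i
    induction i with
    | zero => exact hv
    | succ i ih => rw [← hf]; intro h; exact ih (hφ (by rw [h, map_zero]))
  have hex : ∃ r, f r ∈ Submodule.span k (f '' (Set.Iio r)) := by
    let c : ℕ →o Submodule k V :=
      ⟨fun r => Submodule.span k (f '' (Set.Iio r)), fun r r' h =>
        Submodule.span_mono (Set.image_mono (Set.Iio_subset_Iio h))⟩
    obtain ⟨r, hr⟩ := monotone_stabilizes_iff_noetherian.2 (inferInstance : IsNoetherian k V) c
    refine ⟨r, ?_⟩
    have h1 : f r ∈ c (r+1) := Submodule.subset_span ⟨r, by simp, rfl⟩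
    rw [← hr (r+1) (by omega)] at h1
    exact h1
  have hmin := fun i hi => Nat.find_min hex (m := i) hi
  obtain ⟨r, hr⟩ : ∃ r, r = Nat.find hex := ⟨_, rfl⟩
  have hspec := Nat.find_spec hex
  rw [← hr] at hspec hmin
  have hr0 : r ≠ 0 := by
    rintro rfl
    have : f 0 = 0 := by simpa using hspec
    exact hf0 0 this
  obtain ⟨s, rfl⟩ := Nat.exists_eq_succ_of_ne_zero hr0
  obtain ⟨a, ha⟩ : ∃ a : ℕ → k, f (s+1) = ∑ i ∈ Finset.range (s+1), a i • f i := by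
    have : f '' (Set.Iio (s+1)) = f '' (Finset.range (s+1) : Finset ℕ) := by simp
    rw [Nat.succ_eq_add_one, this, Submodule.mem_span_image_finset_iff_exists_fun'] at hspec
    obtain ⟨c, hc⟩ := hspec
    exact ⟨c, hc.symm⟩
  have hane : ∃ j ≤ s, a j ≠ 0 := by
    by_contra hcon
    push Not at hcon
    apply hf0 (s+1)
    rw [ha]
    exact Finset.sum_eq_zero fun i hi => by
      rw [hcon i (by simpa [Nat.lt_succ_iff] using hi), zero_smul]
  obtain ⟨t, ht0, ht⟩ := langPoly_root q hq a s hane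
  let x : ℕ → k := fun i => (langPoly q a i).eval t
  have hx0 : x 0 = a 0 * t ^ q := by simp [x, langPoly]
  have hx1 : ∀ i, x (i+1) = x i ^ q + a (i+1) * t ^ q := by intro i; simp [x, langPoly]
  have hxs : x s = t := ht
  refine ⟨∑ i ∈ Finset.range (s+1), x i • f i, ?_, ?_⟩
  · intro h0
    apply hmin s (by omega)
    rw [Finset.sum_range_succ, hxs] at h0
    have : f s = (-t⁻¹) • ∑ i ∈ Finset.range s, x i • f i := by
      rw [eq_neg_of_add_eq_zero_left h0, smul_neg, neg_smul, neg_neg, smul_smul,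
        inv_mul_cancel₀ ht0, one_smul]
    rw [this]
    refine Submodule.smul_mem _ _ (Submodule.sum_mem _ fun i hi => Submodule.smul_mem _ _ ?_)
    exact Submodule.subset_span ⟨i, by simpa using hi, rfl⟩
  · rw [map_sum]
    simp only [hs, hf]
    rw [Finset.sum_range_succ, hxs, ha, Finset.smul_sum, Finset.sum_range_succ' (fun i => x i • f i),
      Finset.sum_range_succ' (fun i => t ^ q • a i • f i), hx0]
    simp only [hx1, add_smul, Finset.sum_add_distrib, smul_smul]
    simp only [mul_comm, add_assoc]

theorem lang_basis {k V : Type*} [Field k] [IsAlgClosed k] [AddCommGroup V] [Module k V]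
    [FiniteDimensional k V] (q : ℕ) (hq : 2 ≤ q) (φ : V →+ V)
    (hφ : Function.Injective φ) (hs : ∀ (c : k) v, φ (c • v) = c ^ q • φ v) :
    (∃ (d : ℕ) (b : Module.Basis (Fin d) k V), ∀ i, φ (b i) = b i) ∧
      ∀ w, ∃ z, φ z - z = w := by
  let U : Submodule k V := Submodule.span k {w | φ w = w}
  have hroot : ∀ c : k, ∃ z : k, z ^ q = c := fun c => IsAlgClosed.exists_pow_nat_eq c (by omega)
  have hAS : ∀ c : k, ∃ z : k, z ^ q - z = c := by
    intro c
    have hd : (Polynomial.X ^ q - (Polynomial.X + Polynomial.C c) : Polynomial k).natDegree = q := by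
      rw [Polynomial.natDegree_sub_eq_left_of_natDegree_lt]
      · simp
      · simp; omega
    obtain ⟨z, hz⟩ := IsAlgClosed.exists_root
      (Polynomial.X ^ q - (Polynomial.X + Polynomial.C c) : Polynomial k) (by
        apply ne_of_gt
        rw [← Polynomial.natDegree_pos_iff_degree_pos, hd]
        omega)
    refine ⟨z, ?_⟩
    simp [Polynomial.IsRoot] at hz
    linear_combination hz
  have hsurj : ∀ u ∈ U, ∀ c : k, ∃ z ∈ U, φ z - z = c • u := by
    intro u hu
    induction hu using Submodule.span_induction with
    | mem w hw =>
      intro c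
      obtain ⟨z, hz⟩ := hAS c
      refine ⟨z • w, U.smul_mem _ (Submodule.subset_span hw), ?_⟩
      rw [hs, show φ w = w from hw, ← sub_smul, hz]
    | zero => intro c; exact ⟨0, U.zero_mem, by simp⟩
    | add x y _ _ hx hy =>
      intro c
      obtain ⟨z, hz, h⟩ := hx c
      obtain ⟨z', hz', h'⟩ := hy c
      refine ⟨z + z', U.add_mem hz hz', ?_⟩
      rw [smul_add, ← h, ← h', map_add]; abel
    | smul a x _ hx =>
      intro c
      rw [smul_smul]; exact hx _
  have honto : ∀ u ∈ U, ∀ c : k, ∃ z ∈ U, φ z = c • u := by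
    intro u hu
    induction hu using Submodule.span_induction with
    | mem w hw =>
      intro c
      obtain ⟨z, hz⟩ := hroot c
      refine ⟨z • w, U.smul_mem _ (Submodule.subset_span hw), ?_⟩
      rw [hs, show φ w = w from hw, hz]
    | zero => intro c; exact ⟨0, U.zero_mem, by simp⟩
    | add x y _ _ hx hy =>
      intro c
      obtain ⟨z, hz, h⟩ := hx c
      obtain ⟨z', hz', h'⟩ := hy c
      refine ⟨z + z', U.add_mem hz hz', ?_⟩
      rw [smul_add, ← h, ← h', map_add]
    | smul a x _ hx =>
      intro c
      rw [smul_smul]; exact hx _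
  have hmap : ∀ u ∈ U, φ u ∈ U := by
    intro u hu
    induction hu using Submodule.span_induction with
    | mem w hw => rw [show φ w = w from hw]; exact Submodule.subset_span hw
    | zero => simp
    | add x y hx0 hy0 hx hy => rw [map_add]; exact U.add_mem hx hy
    | smul a x hx0 hx => rw [hs]; exact U.smul_mem _ hx
  have htop : U = ⊤ := by
    by_contra hne
    have : Nontrivial (V ⧸ U) := Submodule.Quotient.nontrivial_iff.2 hne
    let ψ : (V ⧸ U) →+ (V ⧸ U) :=
      QuotientAddGroup.map U.toAddSubgroup U.toAddSubgroup φ (fun u hu => hmap u hu)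
    have hψ : ∀ v : V, ψ (Submodule.Quotient.mk v) = Submodule.Quotient.mk (φ v) := fun v => rfl
    obtain ⟨w, hw0, hw⟩ := lang_fixed (k := k) q hq ψ (by
      rw [injective_iff_map_eq_zero]
      intro a
      obtain ⟨v, rfl⟩ := Submodule.Quotient.mk_surjective U a
      rw [hψ, Submodule.Quotient.mk_eq_zero, Submodule.Quotient.mk_eq_zero]
      intro h
      obtain ⟨z, hz, h'⟩ := honto _ h 1
      rw [one_smul] at h'
      rw [← hφ h']; exact hz) (by
      intro c a
      obtain ⟨v, rfl⟩ := Submodule.Quotient.mk_surjective U a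
      rw [← Submodule.Quotient.mk_smul, hψ, hψ, hs, Submodule.Quotient.mk_smul])
    obtain ⟨v, rfl⟩ := Submodule.Quotient.mk_surjective U w
    rw [hψ, Submodule.Quotient.eq] at hw
    obtain ⟨z, hz, h⟩ := hsurj _ hw 1
    apply hw0
    rw [Submodule.Quotient.mk_eq_zero]
    have : v - z ∈ U := by
      apply Submodule.subset_span
      change φ (v - z) = v - z
      rw [one_smul] at h
      rw [map_sub]
      rw [sub_eq_sub_iff_sub_eq_sub, h]
    simpa using U.add_mem this hz
  refine ⟨?_, ?_⟩
  · obtain ⟨b, hb, hsp, hli⟩ := exists_linearIndependent k {w : V | φ w = w}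
    have hfin : Finite b := hli.finite
    let B : Module.Basis b k V := Module.Basis.mk hli (by
      rw [Subtype.range_coe, hsp]; exact htop.ge)
    have := Fintype.ofFinite b
    refine ⟨Fintype.card b, B.reindex (Fintype.equivFin b), fun i => ?_⟩
    rw [Module.Basis.reindex_apply, Module.Basis.mk_apply]
    exact hb (Subtype.property _)
  · intro w
    obtain ⟨z, _, h⟩ := hsurj w (htop ▸ Submodule.mem_top) 1
    exact ⟨z, by rw [h, one_smul]⟩

section WittLang

variable {p : ℕ} [Fact p.Prime] {κ : Type} [Field κ] [IsAlgClosed κ] [CharP κ p]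

theorem witt_p_dvd_iff (x : WittVector p κ) : (p : WittVector p κ) ∣ x ↔ x.coeff 0 = 0 := by
  rw [← WittVector.mem_span_p_iff_coeff_zero_eq_zero, Ideal.mem_span_singleton]

theorem witt_coeff_zero_add (x y : WittVector p κ) :
    (x + y).coeff 0 = x.coeff 0 + y.coeff 0 :=
  map_add (WittVector.constantCoeff (p := p) (R := κ)) x y

theorem witt_coeff_zero_sub (x y : WittVector p κ) :
    (x - y).coeff 0 = x.coeff 0 - y.coeff 0 :=
  map_sub (WittVector.constantCoeff (p := p) (R := κ)) x y

theorem witt_eq_zero (x : WittVector p κ) (h : ∀ N : ℕ, (p : WittVector p κ) ^ N ∣ x) : x = 0 := by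
  apply IsHausdorff.haus (I := Ideal.span {(p : WittVector p κ)}) inferInstance
  intro n
  rw [SModEq.zero, Ideal.span_singleton_pow, smul_eq_mul, Ideal.mul_top,
    Ideal.mem_span_singleton]
  exact h n

theorem witt_limit (f : ℕ → WittVector p κ)
    (h : ∀ n, (p : WittVector p κ) ^ n ∣ f (n+1) - f n) :
    ∃ L, ∀ n, (p : WittVector p κ) ^ n ∣ L - f n := by
  have hpc : IsPrecomplete (Ideal.span {(p : WittVector p κ)}) (WittVector p κ) := inferInstance
  have key : ∀ a b n, a ≡ b [SMOD (Ideal.span {(p : WittVector p κ)} ^ n •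
      (⊤ : Submodule (WittVector p κ) (WittVector p κ)))] ↔ (p : WittVector p κ) ^ n ∣ b - a := by
    intro a b n
    rw [SModEq.comm, SModEq.sub_mem, Ideal.span_singleton_pow, smul_eq_mul, Ideal.mul_top,
      Ideal.mem_span_singleton]
  obtain ⟨L, hL⟩ := hpc.prec (f := f) (by
    intro m n hmn
    rw [key]
    induction n, hmn using Nat.le_induction with
    | base => simp
    | succ n hn ih =>
      have := dvd_add ((pow_dvd_pow _ hn).trans (h n)) ih
      simpa using this)
  exact ⟨L, fun n => (key _ _ _).1 (hL n)⟩

/-- Vector space structure over the residue field on a module killed by `p`. -/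
@[reducible] def kModule {V : Type*} [AddCommGroup V] [Module (WittVector p κ) V]
    (hV : ∀ v : V, (p : WittVector p κ) • v = 0) : Module κ V where
  smul c v := WittVector.teichmuller p c • v
  one_smul v := by
    change WittVector.teichmuller p (1 : κ) • v = v
    rw [map_one, one_smul]
  mul_smul a b v := by
    change WittVector.teichmuller p (a * b) • v =
      WittVector.teichmuller p a • WittVector.teichmuller p b • v
    rw [map_mul, mul_smul]
  smul_zero a := smul_zero (WittVector.teichmuller p a)
  smul_add a v w := smul_add (WittVector.teichmuller p a) v w
  zero_smul v := by
    change WittVector.teichmuller p (0 : κ) • v = 0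
    rw [WittVector.teichmuller_zero, zero_smul]
  add_smul a b v := by
    change WittVector.teichmuller p (a + b) • v =
      WittVector.teichmuller p a • v + WittVector.teichmuller p b • v
    have : (p : WittVector p κ) ∣ WittVector.teichmuller p (a + b) -
        (WittVector.teichmuller p a + WittVector.teichmuller p b) := by
      rw [witt_p_dvd_iff, witt_coeff_zero_sub, witt_coeff_zero_add]
      simp
    obtain ⟨c, hc⟩ := this
    rw [sub_eq_iff_eq_add] at hc
    rw [hc, add_smul, mul_comm, mul_smul, hV, smul_zero, zero_add, add_smul]

theorem frob_iter_coeff_zero (m : ℕ) (c : WittVector p κ) :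
    ((WittVector.frobenius : WittVector p κ → WittVector p κ)^[m] c).coeff 0 = c.coeff 0 ^ p ^ m := by
  rw [WittVector.iterate_frobenius_coeff]

theorem lang_witt {V : Type*} [AddCommGroup V] [Module (WittVector p κ) V]
    [Module.Finite (WittVector p κ) V] (hV : ∀ v : V, (p : WittVector p κ) • v = 0)
    (m : ℕ) (hm : 0 < m) (φ : V →+ V) (hφ : Function.Injective φ)
    (hs : ∀ (c : WittVector p κ) v,
      φ (c • v) = (WittVector.frobenius : WittVector p κ → WittVector p κ)^[m] c • φ v) :
    (∃ (d : ℕ) (b : Fin d → V), (∀ i, φ (b i) = b i) ∧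
      (∀ v, ∃ c : Fin d → WittVector p κ, v = ∑ i, c i • b i) ∧
      (∀ c : Fin d → WittVector p κ, ∑ i, c i • b i = 0 → ∀ i, (p : WittVector p κ) ∣ c i)) ∧
      ∀ w, ∃ z, φ z - z = w := by
  letI := kModule hV
  have hdef : ∀ (c : κ) (v : V), c • v = WittVector.teichmuller p c • v := fun _ _ => rfl
  have hdvd : ∀ (c : WittVector p κ) (v : V), (p : WittVector p κ) ∣ c → c • v = 0 := by
    rintro _ v ⟨c, rfl⟩
    rw [mul_comm, mul_smul, hV, smul_zero]
  have hco : ∀ (c : WittVector p κ) (v : V), c • v = (c.coeff 0) • v := by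
    intro c v
    rw [hdef, ← sub_eq_zero, ← sub_smul]
    apply hdvd
    rw [witt_p_dvd_iff, witt_coeff_zero_sub]; simp
  have hfd : Module.Finite κ V := by
    obtain ⟨S, hS⟩ := Module.Finite.fg_top (R := WittVector p κ) (M := V)
    refine ⟨S, ?_⟩
    rw [eq_top_iff]
    intro v _
    have hv : v ∈ Submodule.span (WittVector p κ) (S : Set V) := hS ▸ Submodule.mem_top
    induction hv using Submodule.span_induction with
    | mem x h => exact Submodule.subset_span h
    | zero => exact Submodule.zero_mem _
    | add x y _ _ hx hy => exact Submodule.add_mem _ (hx trivial) (hy trivial)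
    | smul a x _ hx => rw [hco]; exact Submodule.smul_mem _ _ (hx trivial)
  have hp := (Fact.out : p.Prime).two_le
  obtain ⟨⟨d, b, hb⟩, hsurj⟩ := lang_basis (k := κ) (V := V) (p ^ m)
    (hp.trans (Nat.le_self_pow hm.ne' p)) φ hφ (by
      intro c v
      rw [hdef, hs, hco, frob_iter_coeff_zero, WittVector.teichmuller_coeff_zero])
  refine ⟨⟨d, b, hb, ?_, ?_⟩, hsurj⟩
  · intro v
    refine ⟨fun i => WittVector.teichmuller p (b.repr v i), ?_⟩
    exact (b.sum_repr v).symm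
  · intro c hc i
    rw [witt_p_dvd_iff]
    simp only [hco] at hc
    exact Fintype.linearIndependent_iff.1 b.linearIndependent _ hc i

theorem iso_surj {T : Type*} [AddCommGroup T] [Module (WittVector p κ) T]
    [Module.Free (WittVector p κ) T] [Module.Finite (WittVector p κ) T]
    (τ : WittVector p κ →+* WittVector p κ)
    (Ψ : T →+ T)
    (hΨs : ∀ (c : WittVector p κ) v, Ψ (c • v) = τ c • Ψ v)
    (h : ∀ w, ∃ z u, Ψ z - z + (p : WittVector p κ) • u = w) (w : T) : ∃ z, Ψ z - z = w := by
  classical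
  choose Z U hZU using h
  let ws : ℕ → T := fun n => U^[n] w
  have hws : ∀ n, ws (n+1) = U (ws n) := fun n => Function.iterate_succ_apply' U n w
  let S : ℕ → T := fun n => ∑ i ∈ Finset.range n, (p : WittVector p κ) ^ i • Z (ws i)
  have hS : ∀ n, Ψ (S n) - S n + (p : WittVector p κ) ^ n • ws n = w := by
    intro n
    induction n with
    | zero => simp [S, ws]
    | succ n ih =>
      have e : S (n+1) = S n + (p : WittVector p κ) ^ n • Z (ws n) := Finset.sum_range_succ _ _
      rw [← ih, e, hws, map_add, hΨs, map_pow, map_natCast, pow_succ, mul_smul]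
      conv_rhs => rw [← hZU (ws n)]
      simp only [smul_add, smul_sub]
      abel
  let b := Module.Free.chooseBasis (WittVector p κ) T
  have hlim : ∀ i, ∃ L, ∀ n, (p : WittVector p κ) ^ n ∣ L - b.repr (S n) i := by
    intro i
    apply witt_limit
    intro n
    have e : S (n+1) = S n + (p : WittVector p κ) ^ n • Z (ws n) := Finset.sum_range_succ _ _
    rw [e]
    simp
  choose L hL using hlim
  let z : T := ∑ i, L i • b i
  have hz : ∀ n, ∃ y, z = S n + (p : WittVector p κ) ^ n • y := by
    intro n
    choose y hy using fun i => hL i n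
    refine ⟨∑ i, y i • b i, ?_⟩
    conv_rhs => rw [← b.sum_repr (S n)]
    rw [Finset.smul_sum, ← Finset.sum_add_distrib]
    refine Finset.sum_congr rfl fun i _ => ?_
    rw [smul_smul, ← hy i, ← add_smul]; ring_nf
  refine ⟨z, ?_⟩
  rw [← sub_eq_zero]
  apply b.repr.injective
  refine Finsupp.ext fun i => ?_
  rw [map_zero, Finsupp.zero_apply]
  apply witt_eq_zero
  intro n
  obtain ⟨y, hy⟩ := hz n
  have : Ψ z - z - w = (p : WittVector p κ) ^ n • (Ψ y - y - ws n) := by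
    rw [hy]
    conv_lhs => rw [← hS n]
    rw [map_add, hΨs, map_pow, map_natCast]
    simp only [smul_sub]
    abel
  rw [this]
  simp

theorem iso_lemma {T : Type*} [AddCommGroup T] [Module (WittVector p κ) T]
    [Module.Free (WittVector p κ) T] [Module.Finite (WittVector p κ) T]
    (m s x : ℕ) (hm : 0 < m) (hrank : Module.finrank (WittVector p κ) T = m * s)
    (τ : WittVector p κ ≃+* WittVector p κ)
    (θ Ψ : T →+ T) (hθ : Function.Injective θ) (hΨ : Function.Bijective Ψ)
    (hθs : ∀ (c : WittVector p κ) v, θ (c • v) = τ c • θ v)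
    (hΨs : ∀ (c : WittVector p κ) v,
      Ψ (c • v) = (WittVector.frobenius : WittVector p κ → WittVector p κ)^[m] c • Ψ v)
    (hcomm : ∀ v, θ (Ψ v) = Ψ (θ v))
    (hpow : ∀ v, θ^[m] v = (p : WittVector p κ) • Ψ^[x] v) :
    ∃ v : Fin s → T, (∀ k, Ψ (v k) = v k) ∧
      ∀ t, t ∈ Submodule.span (WittVector p κ)
        (Set.range fun y : Fin m × Fin s => θ^[(y.1 : ℕ)] (v y.2)) := by
  classical
  have hτp : τ (p : WittVector p κ) = p := map_natCast τ p
  have hit_add : ∀ j v w, θ^[j] (v + w) = θ^[j] v + θ^[j] w := fun j v w => iterate_map_add θ j v w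
  have hit_smul : ∀ j (c : WittVector p κ) v, θ^[j] (c • v) = τ^[j] c • θ^[j] v := by
    intro j
    induction j with
    | zero => intro c v; rfl
    | succ j ih =>
      intro c v
      rw [Function.iterate_succ_apply', ih, hθs, Function.iterate_succ_apply',
        Function.iterate_succ_apply']
  have hitc : ∀ j v, θ^[j] (Ψ v) = Ψ (θ^[j] v) := by
    intro j
    induction j with
    | zero => intro v; rfl
    | succ j ih =>
      intro v
      rw [Function.iterate_succ_apply', ih, hcomm, Function.iterate_succ_apply']
  have hpT : ∀ v, ∃ u, (p : WittVector p κ) • v = θ^[m] u := by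
    intro v
    obtain ⟨u, hu⟩ := (hΨ.2.iterate x) v
    exact ⟨u, by rw [hpow, hu]⟩
  have hpT' : ∀ l ≤ m, ∀ v, ∃ u, (p : WittVector p κ) • v = θ^[l] u := by
    intro l hl v
    obtain ⟨u, hu⟩ := hpT v
    refine ⟨θ^[m - l] u, ?_⟩
    rw [hu, ← Function.iterate_add_apply]
    congr 2; omega
  -- the quotient by the image of θ
  let Q : Submodule (WittVector p κ) T :=
    { carrier := Set.range θ
      zero_mem' := ⟨0, map_zero _⟩
      add_mem' := by
        rintro _ _ ⟨a, rfl⟩ ⟨b, rfl⟩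
        exact ⟨a + b, map_add _ _ _⟩
      smul_mem' := by
        rintro c _ ⟨a, rfl⟩
        exact ⟨τ.symm c • a, by rw [hθs, RingEquiv.apply_symm_apply]⟩ }
  have hQ : ∀ v, v ∈ Q ↔ ∃ u, θ u = v := fun v => Iff.rfl
  let φ : (T ⧸ Q) →+ (T ⧸ Q) :=
    QuotientAddGroup.map Q.toAddSubgroup Q.toAddSubgroup Ψ (by
      rintro _ ⟨u, rfl⟩
      exact ⟨Ψ u, hcomm u⟩)
  have hφ : ∀ v : T, φ (Submodule.Quotient.mk v) = Submodule.Quotient.mk (Ψ v) := fun v => rfl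
  obtain ⟨⟨d, b, hb1, hb2, hb3⟩, hsurj⟩ := lang_witt (p := p) (κ := κ) (V := T ⧸ Q) (by
      intro v
      obtain ⟨v, rfl⟩ := Submodule.Quotient.mk_surjective Q v
      rw [← Submodule.Quotient.mk_smul, Submodule.Quotient.mk_eq_zero, hQ]
      obtain ⟨u, hu⟩ := hpT' 1 hm v
      exact ⟨u, hu.symm⟩) m hm φ (by
      rw [injective_iff_map_eq_zero]
      intro a
      obtain ⟨v, rfl⟩ := Submodule.Quotient.mk_surjective Q a
      rw [hφ, Submodule.Quotient.mk_eq_zero, Submodule.Quotient.mk_eq_zero, hQ, hQ]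
      rintro ⟨u, hu⟩
      obtain ⟨u', rfl⟩ := hΨ.2 u
      exact ⟨u', hΨ.1 (by rw [← hcomm, hu])⟩) (by
      intro c a
      obtain ⟨v, rfl⟩ := Submodule.Quotient.mk_surjective Q a
      rw [← Submodule.Quotient.mk_smul, hφ, hφ, hΨs, Submodule.Quotient.mk_smul])
  -- surjectivity of Ψ - 1 on T
  have hsurjT : ∀ w, ∃ z, Ψ z - z = w := by
    have h1 : ∀ w, ∃ z u, Ψ z - z + θ u = w := by
      intro w
      obtain ⟨z, hz⟩ := hsurj (Submodule.Quotient.mk w)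
      obtain ⟨z, rfl⟩ := Submodule.Quotient.mk_surjective Q z
      rw [hφ, ← Submodule.Quotient.mk_sub, eq_comm, Submodule.Quotient.eq, hQ] at hz
      obtain ⟨u, hu⟩ := hz
      exact ⟨z, u, by rw [hu]; abel⟩
    have h2 : ∀ j w, ∃ z u, Ψ z - z + θ^[j] u = w := by
      intro j
      induction j with
      | zero => intro w; exact ⟨0, w, by simp⟩
      | succ j ih =>
        intro w
        obtain ⟨z, u, h⟩ := ih w
        obtain ⟨z', u', h'⟩ := h1 u
        refine ⟨z + θ^[j] z', u', ?_⟩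
        have e1 : θ^[j] (Ψ z' - z') = Ψ (θ^[j] z') - θ^[j] z' := by
          rw [iterate_map_sub, hitc]
        have e2 : θ^[j] u = Ψ (θ^[j] z') - θ^[j] z' + θ^[j+1] u' := by
          rw [← h', hit_add, e1, Function.iterate_succ_apply]
        rw [← h, e2, map_add]
        abel
    refine iso_surj ((WittVector.frobenius : WittVector p κ →+* WittVector p κ) ^ m) Ψ ?_ ?_
    · intro c v; rw [hΨs, RingHom.coe_pow]
    · intro w
      obtain ⟨z, u, h⟩ := h2 m w
      exact ⟨z, Ψ^[x] u, by rw [← hpow, h]⟩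
  -- lifting
  have hlift : ∀ k, ∃ v : T, Ψ v = v ∧ Submodule.Quotient.mk (p := Q) v = b k := by
    intro k
    obtain ⟨v, hv⟩ := Submodule.Quotient.mk_surjective Q (b k)
    have := hb1 k
    rw [← hv, hφ, Submodule.Quotient.eq, hQ] at this
    obtain ⟨w, hw⟩ := this
    obtain ⟨z, hz⟩ := hsurjT w
    refine ⟨v - θ z, ?_, ?_⟩
    · rw [map_sub, ← hcomm, sub_eq_sub_iff_sub_eq_sub, ← hw, ← hz, map_sub]
    · rw [← hv, Submodule.Quotient.eq, hQ]
      exact ⟨-z, by rw [map_neg]; abel⟩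
  choose v hv1 hv2 using hlift
  -- generation
  have hgen1 : ∀ t, ∃ (c : Fin d → WittVector p κ) (u : T), t = ∑ k, c k • v k + θ u := by
    intro t
    obtain ⟨c, hc⟩ := hb2 (Submodule.Quotient.mk t)
    have : (Submodule.Quotient.mk t : T ⧸ Q) = Submodule.Quotient.mk (∑ k, c k • v k) := by
      rw [hc, ← Submodule.mkQ_apply, map_sum]
      simp [hv2]
    rw [Submodule.Quotient.eq, hQ] at this
    obtain ⟨u, hu⟩ := this
    exact ⟨c, u, by rw [hu]; abel⟩
  let f : Fin m × Fin d → T := fun y => θ^[(y.1 : ℕ)] (v y.2)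
  have hgen2 : ∀ j ≤ m, ∀ t, ∃ s ∈ Submodule.span (WittVector p κ) (Set.range f),
      ∃ u, t = s + θ^[j] u := by
    intro j
    induction j with
    | zero => intro _ t; exact ⟨0, Submodule.zero_mem _, t, by simp⟩
    | succ j ih =>
      intro hj t
      obtain ⟨s, hs, u, rfl⟩ := ih (by omega) t
      obtain ⟨c, u', rfl⟩ := hgen1 u
      refine ⟨s + θ^[j] (∑ k, c k • v k), Submodule.add_mem _ hs ?_, u', ?_⟩
      · have : θ^[j] (∑ k, c k • v k) = ∑ k, τ^[j] (c k) • f (⟨j, by omega⟩, k) := by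
          let θj : T →+ T := ⟨⟨θ^[j], iterate_map_zero θ j⟩, hit_add j⟩
          have e : ∀ t, θ^[j] t = θj t := fun t => rfl
          rw [e, map_sum]
          simp only [← e, hit_smul, f]
        rw [this]
        exact Submodule.sum_mem _ fun k _ => Submodule.smul_mem _ _
          (Submodule.subset_span ⟨_, rfl⟩)
      · rw [hit_add, Function.iterate_succ_apply, add_assoc]
  have hspan : Submodule.span (WittVector p κ) (Set.range f) = ⊤ := by
    rw [eq_top_iff]
    refine Submodule.le_of_le_smul_of_le_jacobson_bot (I := Ideal.span {(p : WittVector p κ)})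
      Module.Finite.fg_top (IsAdicComplete.le_jacobson_bot _) ?_
    intro t _
    obtain ⟨s, hs, u, rfl⟩ := hgen2 m le_rfl t
    refine Submodule.add_mem_sup hs ?_
    rw [hpow]
    exact Submodule.smul_mem_smul (Ideal.mem_span_singleton_self _) trivial
  -- independence
  have hind1 : ∀ l ≤ m, ∀ c : ℕ → Fin d → WittVector p κ,
      (∃ u, ∑ j ∈ Finset.range l, ∑ k, c j k • θ^[j] (v k) = θ^[l] u) →
      ∀ j < l, ∀ k, (p : WittVector p κ) ∣ c j k := by
    intro l
    induction l with
    | zero => intro _ c _ j hj; omega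
    | succ l ih =>
      rintro hl c ⟨u, hu⟩
      have e : ∀ j t, θ (θ^[j] t) = θ^[j+1] t := fun j t => (Function.iterate_succ_apply' θ j t).symm
      have hsum : ∑ j ∈ Finset.range l, ∑ k, c (j+1) k • θ^[j+1] (v k) =
          θ (∑ j ∈ Finset.range l, ∑ k, τ.symm (c (j+1) k) • θ^[j] (v k)) := by
        rw [map_sum]
        refine Finset.sum_congr rfl fun j _ => ?_
        rw [map_sum]
        refine Finset.sum_congr rfl fun k _ => ?_
        rw [hθs, RingEquiv.apply_symm_apply, e]
      rw [Finset.sum_range_succ', hsum] at hu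
      simp only [Function.iterate_zero, id] at hu
      have h0 : ∀ k, (p : WittVector p κ) ∣ c 0 k := by
        apply hb3
        have : ∑ k, c 0 k • b k = Submodule.Quotient.mk (p := Q) (∑ k, c 0 k • v k) := by
          rw [← Submodule.mkQ_apply, map_sum]
          simp [hv2]
        rw [this, Submodule.Quotient.mk_eq_zero, hQ]
        rw [add_comm, ← eq_sub_iff_add_eq] at hu
        rw [hu, ← e]
        exact ⟨_, map_sub _ _ _⟩
      choose c' hc' using h0
      obtain ⟨u', hu'⟩ := hpT' (l+1) hl (∑ k, c' k • v k)
      have hu0 : ∑ k, c 0 k • v k = θ^[l+1] u' := by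
        rw [← hu', Finset.smul_sum]
        exact Finset.sum_congr rfl fun k _ => by rw [hc', mul_smul]
      rw [hu0, ← eq_sub_iff_add_eq, ← e, ← e, ← map_sub] at hu
      have hu2 := hθ hu
      have := ih (by omega) (fun j k => τ.symm (c (j+1) k)) ⟨u - u', by
        rw [hu2, sub_eq_add_neg, sub_eq_add_neg, hit_add, iterate_map_neg]⟩
      intro j hj k
      rcases j with _ | j
      · exact ⟨_, hc' k⟩
      · obtain ⟨y, hy⟩ := this j (by omega) k
        refine ⟨τ y, ?_⟩
        rw [← hτp, ← map_mul, ← hy, RingEquiv.apply_symm_apply]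
        
  have hind2 : ∀ c : Fin m × Fin d → WittVector p κ, ∑ y, c y • f y = 0 →
      ∀ y, (p : WittVector p κ) ∣ c y := by
    intro c hc
    have := hind1 m le_rfl (fun j k => if h : j < m then c (⟨j, h⟩, k) else 0) ⟨0, by
      rw [iterate_map_zero, ← hc, Fintype.sum_prod_type, Finset.sum_range]
      refine Finset.sum_congr rfl fun j _ => Finset.sum_congr rfl fun k _ => ?_
      simp [f]⟩
    rintro ⟨j, k⟩
    simpa using this j j.2 k
  have hli : LinearIndependent (WittVector p κ) f := by
    rw [Fintype.linearIndependent_iff]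
    intro c hc
    have : ∀ N : ℕ, ∃ c' : Fin m × Fin d → WittVector p κ,
        (∀ y, c y = (p : WittVector p κ) ^ N * c' y) ∧ ∑ y, c' y • f y = 0 := by
      intro N
      induction N with
      | zero => exact ⟨c, by simp, hc⟩
      | succ N ih =>
        obtain ⟨c', h1, h2⟩ := ih
        choose c'' h3 using hind2 c' h2
        refine ⟨c'', fun y => by rw [h1, h3, pow_succ, mul_assoc], ?_⟩
        have h4 : (p : WittVector p κ) • ∑ y, c'' y • f y = 0 := by
          rw [← h2, Finset.smul_sum]
          exact Finset.sum_congr rfl fun y _ => by rw [smul_smul, h3]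
        rcases smul_eq_zero.1 h4 with h | h
        · exact absurd h (WittVector.p_nonzero p κ)
        · exact h
    intro y
    apply witt_eq_zero
    intro N
    obtain ⟨c', h1, _⟩ := this N
    exact ⟨_, h1 y⟩
  have hcard := Module.finrank_eq_card_basis (Module.Basis.mk hli hspan.ge)
  rw [hrank] at hcard
  simp only [Fintype.card_prod, Fintype.card_fin] at hcard
  have hds : s = d := Nat.eq_of_mul_eq_mul_left hm hcard
  subst hds
  exact ⟨v, hv1, fun t => hspan ▸ Submodule.mem_top⟩

end WittLang


section Act

variable {p κ}

theorem pK_ne : (p : K) ≠ 0 := by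
  have h := WittVector.p_nonzero p κ
  intro h'
  apply h
  apply IsFractionRing.injective 𝕎 K
  rw [map_natCast, map_zero, h']

theorem Bmat_mul_aux (m : ℕ) (hm : 0 < m) (h h' : ℤ) (r j : Fin m) :
    ∑ s, Bmat p κ m h r s * Bmat p κ m h' s j = Bmat p κ m (h + h') r j := by
  have hm' : (0 : ℤ) < m := by exact_mod_cast hm
  have h0 := Int.emod_nonneg ((j : ℤ) + h') hm'.ne'
  have h1 := Int.emod_lt_of_pos ((j : ℤ) + h') hm'
  have hq := Int.emod_add_mul_ediv ((j : ℤ) + h') m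
  let s0 : Fin m := ⟨(((j : ℤ) + h') % m).toNat, by omega⟩
  have hs0 : ((s0 : ℕ) : ℤ) = ((j : ℤ) + h') % m := Int.toNat_of_nonneg h0
  have hlt : ∀ s : Fin m, (s : ℤ) % m = s := fun s =>
    Int.emod_eq_of_lt (by positivity) (by exact_mod_cast s.2)
  rw [Finset.sum_eq_single s0]
  · unfold Bmat
    have e2 : ((s0 : ℕ) : ℤ) % m = ((j : ℤ) + h') % m := by rw [hlt, hs0]
    rw [if_pos e2]
    have e3 : (j : ℤ) + (h + h') = (s0 : ℕ) + h + m * (((j : ℤ) + h') / m) := by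
      rw [hs0]; linarith
    have e4 : ((j : ℤ) + (h + h')) % m = ((s0 : ℕ) + h) % m := by
      rw [e3, Int.add_mul_emod_self_left]
    have e5 : ((j : ℤ) + (h + h')) / m = ((s0 : ℕ) + h) / m + ((j : ℤ) + h') / m := by
      rw [e3, Int.add_mul_ediv_left _ _ hm'.ne']
    rw [e4, e5, zpow_add₀ pK_ne]
    split_ifs <;> simp
  · intro s _ hs
    have : Bmat p κ m h' s j = 0 := by
      unfold Bmat
      rw [if_neg]
      intro e
      apply hs
      rw [hlt, ← hs0] at e
      exact Fin.ext (by exact_mod_cast e)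
    rw [this, mul_zero]
  · simp

theorem Bmat_scalar (m : ℕ) (hm : 0 < m) (e : ℤ) (r j : Fin m) :
    Bmat p κ m (e * m) r j = if j = r then (p : K) ^ e else 0 := by
  have hm' : (m : ℤ) ≠ 0 := by exact_mod_cast hm.ne'
  have hlt : ∀ s : Fin m, (s : ℤ) % m = s := fun s =>
    Int.emod_eq_of_lt (by positivity) (by exact_mod_cast s.2)
  have hdv : ∀ s : Fin m, (s : ℤ) / m = 0 := fun s =>
    Int.ediv_eq_zero_of_lt (by positivity) (by exact_mod_cast s.2)
  unfold Bmat
  rw [Int.add_mul_emod_self_right, Int.add_mul_ediv_right _ _ hm', hdv, zero_add, hlt, hlt]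
  by_cases hh : j = r
  · simp [hh]
  · rw [if_neg hh, if_neg]
    intro e
    exact hh (Fin.ext (by exact_mod_cast e.symm))

theorem Bmat_integral (m : ℕ) (hm : 0 < m) (h : ℤ) (hh : 0 ≤ h) (r j : Fin m) :
    ∃ y : 𝕎, algebraMap 𝕎 K y = Bmat p κ m h r j := by
  unfold Bmat
  split_ifs
  · have : 0 ≤ ((j : ℤ) + h) / m := Int.ediv_nonneg (by positivity) (by positivity)
    obtain ⟨q, hq⟩ := Int.eq_ofNat_of_zero_le this
    refine ⟨(p : 𝕎) ^ q, ?_⟩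
    rw [hq]; simp
  · exact ⟨0, map_zero _⟩

theorem Bmat_sig (τ : K →+* K) (m : ℕ) (h : ℤ) (r j : Fin m) :
    τ (Bmat p κ m h r j) = Bmat p κ m h r j := by
  unfold Bmat
  split_ifs <;> simp

/-- Integral powers of `σ`. -/
def sig (σ : K ≃+* K) (k : ℤ) : K ≃+* K := (id σ : RingAut K) ^ k

theorem sig_add (σ : K ≃+* K) (k l : ℤ) (x : K) : sig σ (k + l) x = sig σ k (sig σ l x) := by
  unfold sig
  rw [_root_.zpow_add]; rfl

theorem sig_zero (σ : K ≃+* K) (x : K) : sig σ 0 x = x := by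
  unfold sig
  rw [zpow_zero]; rfl

theorem sig_one (σ : K ≃+* K) (x : K) : sig σ 1 x = σ x := by
  unfold sig
  rw [zpow_one]; rfl

/-- Integral powers of Frobenius on Witt vectors. -/
def tau (k : ℤ) : 𝕎 ≃+* 𝕎 := (id (WittVector.frobeniusEquiv p κ) : RingAut 𝕎) ^ k

theorem tau_add (k l : ℤ) (x : 𝕎) : tau (k + l) x = tau k (tau l x) := by
  unfold tau
  rw [_root_.zpow_add]; rfl

theorem tau_zero (x : 𝕎) : tau 0 x = x := by
  unfold tau
  rw [zpow_zero]; rfl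

theorem tau_one (x : 𝕎) : tau 1 x = WittVector.frobenius x := by
  unfold tau
  rw [zpow_one]; rfl

theorem tau_nat (k : ℕ) (x : 𝕎) : tau (k : ℤ) x = (WittVector.frobenius : 𝕎 → 𝕎)^[k] x := by
  induction k generalizing x with
  | zero => exact tau_zero x
  | succ k ih =>
    rw [Nat.cast_succ, tau_add, tau_one, ih, Function.iterate_succ_apply]

theorem sig_alg (σ : K ≃+* K)
    (hσ : ∀ x : 𝕎, σ (algebraMap 𝕎 K x) = algebraMap 𝕎 K (WittVector.frobenius x))
    (k : ℤ) (x : 𝕎) : sig σ k (algebraMap 𝕎 K x) = algebraMap 𝕎 K (tau k x) := by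
  have h1 : ∀ (k : ℕ) (x : 𝕎), sig σ (k : ℤ) (algebraMap 𝕎 K x) = algebraMap 𝕎 K (tau k x) := by
    intro k
    induction k with
    | zero => intro x; simp [sig_zero, tau_zero]
    | succ k ih =>
      intro x
      rw [Nat.cast_succ, sig_add, sig_one, hσ, ih, tau_add, tau_one]
  rcases Int.eq_nat_or_neg k with ⟨n, rfl | rfl⟩
  · exact h1 n x
  · apply (sig σ n).injective
    rw [h1, ← sig_add, ← tau_add]
    simp [sig_zero, tau_zero]

variable {ι : Type} [Fintype ι] [DecidableEq ι]

/-- `act d k` is multiplication by the block matrix `B_{m_i,d_i}` composed with `σ^k`. -/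
def act (σ : K ≃+* K) (m : ι → ℕ) (d : ι → ℤ) (k : ℤ) :
    ((Σ i, Fin (m i)) → K) →+ ((Σ i, Fin (m i)) → K) where
  toFun v := fun x => ∑ j, Bmat p κ (m x.1) (d x.1) x.2 j * sig σ k (v ⟨x.1, j⟩)
  map_zero' := by funext x; simp
  map_add' v w := by funext x; simp [mul_add, Finset.sum_add_distrib]

theorem act_apply (σ : K ≃+* K) (m : ι → ℕ) (d : ι → ℤ) (k : ℤ) (v : (Σ i, Fin (m i)) → K) (x) :
    act σ m d k v x = ∑ j, Bmat p κ (m x.1) (d x.1) x.2 j * sig σ k (v ⟨x.1, j⟩) := rfl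

theorem act_act (σ : K ≃+* K) (m : ι → ℕ) (hm : ∀ i, 0 < m i) (d d' : ι → ℤ) (k k' : ℤ)
    (v : (Σ i, Fin (m i)) → K) :
    act σ m d k (act σ m d' k' v) = act σ m (d + d') (k + k') v := by
  funext x
  rw [act_apply, act_apply]
  have : ∀ j, sig σ k (act σ m d' k' v ⟨x.1, j⟩) =
      ∑ s, Bmat p κ (m x.1) (d' x.1) j s * sig σ (k + k') (v ⟨x.1, s⟩) := by
    intro j
    rw [act_apply, map_sum]
    refine Finset.sum_congr rfl fun s _ => ?_
    rw [map_mul, sig_add]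
    congr 1
    exact Bmat_sig (sig σ k).toRingHom _ _ _ _
  simp only [this, Finset.mul_sum]
  rw [Finset.sum_comm]
  refine Finset.sum_congr rfl fun s _ => ?_
  rw [Pi.add_apply, ← Bmat_mul_aux _ (hm x.1), Finset.sum_mul]
  exact Finset.sum_congr rfl fun _ _ => by ring

theorem act_scalar (σ : K ≃+* K) (m : ι → ℕ) (hm : ∀ i, 0 < m i) (e : ℤ)
    (v : (Σ i, Fin (m i)) → K) :
    act σ m (fun i => e * m i) 0 v = (p : K) ^ e • v := by
  funext x
  rw [act_apply]
  simp only [Bmat_scalar _ (hm x.1), sig_zero, ite_mul, zero_mul]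
  simp

theorem act_zero (σ : K ≃+* K) (m : ι → ℕ) (hm : ∀ i, 0 < m i)
    (v : (Σ i, Fin (m i)) → K) : act σ m 0 0 v = v := by
  have := act_scalar σ m hm 0 v
  simp only [zero_mul, zpow_zero, one_smul] at this
  exact this

theorem act_p (σ : K ≃+* K) (m : ι → ℕ) (hm : ∀ i, 0 < m i) (e : ℕ)
    (v : (Σ i, Fin (m i)) → K) :
    act σ m (fun i => e * m i) 0 v = (p : 𝕎) ^ e • v := by
  rw [act_scalar σ m hm]
  funext x
  rw [Pi.smul_apply, Pi.smul_apply, smul_eq_mul, Algebra.smul_def]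
  simp

theorem act_smul (σ : K ≃+* K)
    (hσ : ∀ x : 𝕎, σ (algebraMap 𝕎 K x) = algebraMap 𝕎 K (WittVector.frobenius x))
    (m : ι → ℕ) (d : ι → ℤ) (k : ℤ) (c : 𝕎)
    (v : (Σ i, Fin (m i)) → K) :
    act σ m d k (c • v) = tau k c • act σ m d k v := by
  funext x
  rw [Pi.smul_apply, act_apply, act_apply, Finset.smul_sum]
  refine Finset.sum_congr rfl fun s _ => ?_
  rw [Pi.smul_apply, Algebra.smul_def, Algebra.smul_def, map_mul, sig_alg σ hσ]
  ring

theorem tau_p (k : ℤ) (e : ℕ) : tau k ((p : 𝕎) ^ e) = (p : 𝕎) ^ e := by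
  rw [map_pow, map_natCast]

/-- Projection to the blocks in `S`. -/
def proj (m : ι → ℕ) (S : Finset ι) :
    ((Σ i, Fin (m i)) → K) →ₗ[𝕎] ((Σ i, Fin (m i)) → K) where
  toFun v := fun x => if x.1 ∈ S then v x else 0
  map_add' v w := by
    funext x
    simp only [Pi.add_apply]; split_ifs <;> simp
  map_smul' c v := by
    funext x
    simp only [Pi.smul_apply, RingHom.id_apply]; split_ifs <;> simp

theorem proj_apply (m : ι → ℕ) (S : Finset ι) (v : (Σ i, Fin (m i)) → K) (x) :
    proj m S v x = if x.1 ∈ S then v x else 0 := rfl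

theorem proj_proj (m : ι → ℕ) (S S' : Finset ι) (v : (Σ i, Fin (m i)) → K) :
    proj m S (proj m S' v) = proj m (S ∩ S') v := by
  funext x
  simp only [proj_apply, Finset.mem_inter]
  split_ifs <;> tauto

theorem proj_sdiff (m : ι → ℕ) (S S' : Finset ι) (h : S' ⊆ S) (v : (Σ i, Fin (m i)) → K) :
    proj m (S \ S') v = proj m S v - proj m S' v := by
  funext x
  have := @h x.1
  simp only [proj_apply, Finset.mem_sdiff, Pi.sub_apply]
  split_ifs <;> simp_all

theorem proj_univ (m : ι → ℕ) (v : (Σ i, Fin (m i)) → K) :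
    proj m Finset.univ v = v := by
  funext x
  simp [proj_apply]

theorem act_proj (σ : K ≃+* K) (m : ι → ℕ) (d : ι → ℤ) (k : ℤ) (S : Finset ι)
    (v : (Σ i, Fin (m i)) → K) :
    act σ m d k (proj m S v) = proj m S (act σ m d k v) := by
  funext x
  simp only [act_apply, proj_apply]
  split_ifs <;> simp

/-- The standard lattice. -/
def M0 (p : ℕ) [Fact p.Prime] (κ : Type) [Field κ] [IsAlgClosed κ] [CharP κ p]
    {ι : Type} (m : ι → ℕ) :
    Submodule (WittVector p κ) ((Σ i, Fin (m i)) → FractionRing (WittVector p κ)) where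
  carrier := {v | ∀ x, ∃ y : WittVector p κ, algebraMap _ _ y = v x}
  zero_mem' := fun x => ⟨0, map_zero _⟩
  add_mem' := fun {v w} hv hw x => by
    obtain ⟨a, ha⟩ := hv x
    obtain ⟨b, hb⟩ := hw x
    exact ⟨a + b, by rw [map_add, ha, hb]; rfl⟩
  smul_mem' := fun c v hv x => by
    obtain ⟨a, ha⟩ := hv x
    exact ⟨c * a, by rw [map_mul, ha, Pi.smul_apply, Algebra.smul_def]⟩

theorem mem_M0 (m : ι → ℕ) (v : (Σ i, Fin (m i)) → K) :
    v ∈ M0 p κ m ↔ ∀ x, ∃ y : 𝕎, algebraMap 𝕎 K y = v x := Iff.rfl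

theorem proj_M0 (m : ι → ℕ) (S : Finset ι) (v : (Σ i, Fin (m i)) → K) (hv : v ∈ M0 p κ m) :
    proj m S v ∈ M0 p κ m := by
  intro x
  rw [proj_apply]
  split_ifs
  · exact hv x
  · exact ⟨0, map_zero _⟩

theorem act_M0 (σ : K ≃+* K)
    (hσ : ∀ x : 𝕎, σ (algebraMap 𝕎 K x) = algebraMap 𝕎 K (WittVector.frobenius x))
    (m : ι → ℕ) (hm : ∀ i, 0 < m i) (d : ι → ℤ) (k : ℤ) (S : Finset ι)
    (hd : ∀ i ∈ S, 0 ≤ d i)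
    (v : (Σ i, Fin (m i)) → K) (hv : v ∈ M0 p κ m) (hS : proj m S v = v) :
    act σ m d k v ∈ M0 p κ m := by
  rw [← hS, act_proj]
  intro x
  rw [proj_apply]
  split_ifs with hx
  · rw [act_apply]
    choose y hy using fun j => Bmat_integral (p := p) (κ := κ) (m x.1) (hm x.1) (d x.1) (hd _ hx) x.2 j
    choose z hz using hv
    refine ⟨∑ j, y j * tau k (z ⟨x.1, j⟩), ?_⟩
    rw [map_sum]
    refine Finset.sum_congr rfl fun j _ => ?_
    rw [map_mul, hy, ← sig_alg σ hσ, hz]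
  · exact ⟨0, map_zero _⟩

theorem pow_smul_cancel (m : ι → ℕ) (e : ℕ) (v w : (Σ i, Fin (m i)) → K)
    (h : (p : 𝕎) ^ e • v = (p : 𝕎) ^ e • w) : v = w := by
  funext x
  have := congrFun h x
  rw [Pi.smul_apply, Pi.smul_apply, Algebra.smul_def, Algebra.smul_def] at this
  refine mul_left_cancel₀ ?_ this
  rw [map_pow, map_natCast]
  exact pow_ne_zero _ pK_ne

instance M0_noeth (m : ι → ℕ) : IsNoetherian 𝕎 (M0 p κ m) := by
  let L : ((Σ i, Fin (m i)) → 𝕎) →ₗ[𝕎] ((Σ i, Fin (m i)) → K) :=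
    { toFun := fun v x => algebraMap 𝕎 K (v x)
      map_add' := fun v w => by funext x; simp
      map_smul' := fun c v => by funext x; simp [Algebra.smul_def] }
  have : M0 p κ m = LinearMap.range L := by
    apply le_antisymm
    · intro v hv
      choose z hz using hv
      exact ⟨z, funext hz⟩
    · rintro _ ⟨z, rfl⟩ x
      exact ⟨z x, rfl⟩
  rw [this]
  infer_instance

/-- Submodules with `p^e • B ≤ M0` are Noetherian. -/
theorem noeth_of_le (m : ι → ℕ) (e : ℕ) (B : Submodule 𝕎 ((Σ i, Fin (m i)) → K))
    (hB : ∀ v ∈ B, (p : 𝕎) ^ e • v ∈ M0 p κ m) : IsNoetherian 𝕎 B := by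
  let L : B →ₗ[𝕎] M0 p κ m :=
    { toFun := fun v => ⟨(p : 𝕎) ^ e • v.1, hB _ v.2⟩
      map_add' := fun v w => by apply Subtype.ext; simp
      map_smul' := fun c v => by apply Subtype.ext; simp [smul_smul, mul_comm] }
  refine isNoetherian_of_injective L ?_
  intro v w hvw
  apply Subtype.ext
  exact pow_smul_cancel m e _ _ (congrArg Subtype.val hvw)

/-- Image of a submodule under `act`. -/
def actS (σ : K ≃+* K)
    (hσ : ∀ x : 𝕎, σ (algebraMap 𝕎 K x) = algebraMap 𝕎 K (WittVector.frobenius x))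
    (m : ι → ℕ) (d : ι → ℤ) (k : ℤ) (M : Submodule 𝕎 ((Σ i, Fin (m i)) → K)) :
    Submodule 𝕎 ((Σ i, Fin (m i)) → K) where
  carrier := {w | act σ m (-d) (-k) w ∈ M}
  zero_mem' := by
    change act σ m (-d) (-k) 0 ∈ M
    rw [map_zero]; exact M.zero_mem
  add_mem' := fun {v w} hv hw => by
    change act σ m (-d) (-k) (v + w) ∈ M
    rw [map_add]; exact M.add_mem hv hw
  smul_mem' := fun c v hv => by
    change act σ m (-d) (-k) (c • v) ∈ M
    rw [act_smul σ hσ]; exact M.smul_mem _ hv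

theorem mem_actS (σ : K ≃+* K)
    (hσ : ∀ x : 𝕎, σ (algebraMap 𝕎 K x) = algebraMap 𝕎 K (WittVector.frobenius x))
    (m : ι → ℕ) (d : ι → ℤ) (k : ℤ) (M : Submodule 𝕎 ((Σ i, Fin (m i)) → K)) (w) :
    w ∈ actS σ hσ m d k M ↔ act σ m (-d) (-k) w ∈ M := Iff.rfl

theorem act_mem_actS (σ : K ≃+* K)
    (hσ : ∀ x : 𝕎, σ (algebraMap 𝕎 K x) = algebraMap 𝕎 K (WittVector.frobenius x))
    (m : ι → ℕ) (hm : ∀ i, 0 < m i)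
    (d : ι → ℤ) (k : ℤ) (M : Submodule 𝕎 ((Σ i, Fin (m i)) → K)) (w) :
    act σ m d k w ∈ actS σ hσ m d k M ↔ w ∈ M := by
  rw [mem_actS, act_act σ m hm, neg_add_cancel, neg_add_cancel, act_zero σ m hm]

theorem act_act_neg (σ : K ≃+* K) (m : ι → ℕ) (hm : ∀ i, 0 < m i)
    (d : ι → ℤ) (k : ℤ) (w : (Σ i, Fin (m i)) → K) :
    act σ m d k (act σ m (-d) (-k) w) = w := by
  rw [act_act σ m hm, add_neg_cancel, add_neg_cancel, act_zero σ m hm]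

theorem act_inj (σ : K ≃+* K) (m : ι → ℕ) (hm : ∀ i, 0 < m i)
    (d : ι → ℤ) (k : ℤ) : Function.Injective (act σ m d k) := by
  intro v w h
  have := congrArg (act σ m (-d) (-k)) h
  rwa [act_act σ m hm, act_act σ m hm, neg_add_cancel, neg_add_cancel, act_zero σ m hm,
    act_zero σ m hm] at this

end Act

section Chain

variable {p κ}
variable {N : Type*} [AddCommGroup N] [Module (WittVector p κ) N]

theorem stab_of_noeth (B : Submodule 𝕎 N) (hB : IsNoetherian 𝕎 B)
    (f : ℕ → Submodule 𝕎 N) (hf : Monotone f) (hfB : ∀ n, f n ≤ B) :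
    ∃ n, ∀ k, n ≤ k → f k = f n := by
  have := monotone_stabilizes_iff_noetherian.2 hB
  obtain ⟨n, hn⟩ := this ⟨fun n => (f n).comap B.subtype,
    fun a b hab => Submodule.comap_mono (hf hab)⟩
  refine ⟨n, fun k hk => ?_⟩
  have h := congrArg (Submodule.map B.subtype) (hn k hk)
  change Submodule.map B.subtype ((f n).comap B.subtype) =
    Submodule.map B.subtype ((f k).comap B.subtype) at h
  rw [Submodule.map_comap_subtype, Submodule.map_comap_subtype] at h
  rw [inf_eq_right.2 (hfB _), inf_eq_right.2 (hfB _)] at h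
  exact h.symm

theorem li_of_dvd [Module.IsTorsionFree 𝕎 N] {α : Type*} [Fintype α] (f : α → N)
    (hind2 : ∀ c : α → 𝕎, ∑ y, c y • f y = 0 → ∀ y, (p : 𝕎) ∣ c y) :
    LinearIndependent 𝕎 f := by
  rw [Fintype.linearIndependent_iff]
  intro c hc
  have : ∀ N : ℕ, ∃ c' : α → 𝕎,
      (∀ y, c y = (p : 𝕎) ^ N * c' y) ∧ ∑ y, c' y • f y = 0 := by
    intro N
    induction N with
    | zero => exact ⟨c, by simp, hc⟩
    | succ N ih =>
      obtain ⟨c', h1, h2⟩ := ih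
      choose c'' h3 using hind2 c' h2
      refine ⟨c'', fun y => by rw [h1, h3, pow_succ, mul_assoc], ?_⟩
      have h4 : (p : 𝕎) • ∑ y, c'' y • f y = 0 := by
        rw [← h2, Finset.smul_sum]
        exact Finset.sum_congr rfl fun y _ => by rw [smul_smul, h3]
      rcases smul_eq_zero.1 h4 with h | h
      · exact absurd h (WittVector.p_nonzero p κ)
      · exact h
  intro y
  apply witt_eq_zero
  intro N
  obtain ⟨c', h1, _⟩ := this N
  exact ⟨_, h1 y⟩

theorem witt_unit (c : 𝕎) (hc : ¬ (p : 𝕎) ∣ c) : IsUnit c := by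
  rw [witt_p_dvd_iff] at hc
  exact WittVector.isUnit_of_coeff_zero_ne_zero c hc

/-- A chain of submodules between `pT` and `T` has a repetition. -/
theorem chain_rep [Module.IsTorsionFree 𝕎 N] (n : ℕ)
    (hn : ∀ f : Fin (n + 1) → N, ¬ LinearIndependent 𝕎 f)
    (T : Submodule 𝕎 N) (C : ℕ → Submodule 𝕎 N) (hC : Monotone C)
    (hp : ∀ v ∈ T, (p : 𝕎) • v ∈ C 0) (hCT : ∀ r, C r ≤ T) :
    ∃ r ≤ n, C (r + 1) ≤ C r := by
  classical
  by_contra! hcon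
  have h1 : ∀ r : Fin (n + 1), ∃ x, x ∈ C (r + 1) ∧ x ∉ C r := fun r =>
    Set.not_subset.1 (hcon r (by omega))
  choose x hx1 hx2 using h1
  refine hn x (li_of_dvd x ?_)
  intro c hc
  by_contra! hex
  obtain ⟨y, hy⟩ := hex
  let A : Finset (Fin (n + 1)) := Finset.univ.filter fun y => ¬ (p : 𝕎) ∣ c y
  have hA : A.Nonempty := ⟨y, by simp [A, hy]⟩
  let r := A.max' hA
  have hr : ¬ (p : 𝕎) ∣ c r := (Finset.mem_filter.1 (A.max'_mem hA)).2
  have hr2 : ∀ s, r < s → (p : 𝕎) ∣ c s := by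
    intro s hs
    by_contra h
    have : s ≤ r := A.le_max' s (by simp [A, h])
    exact absurd hs (not_lt.2 this)
  obtain ⟨u, hu⟩ := witt_unit _ hr
  apply hx2 r
  have e : c r • x r = - ∑ s ∈ Finset.univ.erase r, c s • x s := by
    rw [← Finset.add_sum_erase _ _ (Finset.mem_univ r)] at hc
    exact eq_neg_of_add_eq_zero_left hc
  have h2 : c r • x r ∈ C r := by
    rw [e]
    refine Submodule.neg_mem _ (Submodule.sum_mem _ fun s hs => ?_)
    rcases lt_or_gt_of_ne (Finset.ne_of_mem_erase hs) with h | h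
    · exact Submodule.smul_mem _ _ (hC (by exact h) (hx1 s))
    · obtain ⟨d, hd⟩ := hr2 s h
      rw [hd, mul_smul]
      exact hC (Nat.zero_le _) (hp _ (Submodule.smul_mem _ _ (hCT _ (hx1 s))))
  have := Submodule.smul_mem (C r) ((u⁻¹ : 𝕎ˣ) : 𝕎) h2
  rwa [← hu, smul_smul, Units.inv_mul, one_smul] at this

/-- The iterates `T_{r+1} = Q ⊔ L T_r`. -/
def iterT (Q : Submodule 𝕎 N) (L : Submodule 𝕎 N → Submodule 𝕎 N) : ℕ → Submodule 𝕎 N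
  | 0 => ⊥
  | r + 1 => Q ⊔ L (iterT Q L r)

theorem chain_lemma [Module.IsTorsionFree 𝕎 N] (n : ℕ)
    (hn : ∀ f : Fin (n + 1) → N, ¬ LinearIndependent 𝕎 f)
    (Q B : Submodule 𝕎 N) (hB : IsNoetherian 𝕎 B) (L : Submodule 𝕎 N → Submodule 𝕎 N)
    (hmono : Monotone L) (hsup : ∀ X Y, L (X ⊔ Y) = L X ⊔ L Y)
    (hLp : ∀ X, L (Ideal.span {(p : 𝕎)} • X) = Ideal.span {(p : 𝕎)} • L X)
    (hQB : Q ≤ B) (hLB : ∀ X, X ≤ B → L X ≤ B) :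
    Q ⊔ L (iterT Q L n) = iterT Q L n := by
  have hTB : ∀ r, iterT Q L r ≤ B := by
    intro r
    induction r with
    | zero => exact bot_le
    | succ r ih => exact sup_le hQB (hLB _ ih)
  have hTm1 : ∀ r, iterT Q L r ≤ iterT Q L (r + 1) := by
    intro r
    induction r with
    | zero => exact bot_le
    | succ r ih => exact sup_le_sup_left (hmono ih) Q
  have hTm : Monotone (iterT Q L) := monotone_nat_of_le_succ hTm1
  obtain ⟨r0, hr0⟩ := stab_of_noeth B hB (iterT Q L) hTm hTB
  set T := iterT Q L r0 with hT
  have hTT : ∀ r, iterT Q L r ≤ T := by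
    intro r
    rcases le_total r0 r with h | h
    · exact (hr0 r h).le
    · exact hTm h
  have hQT : Q ⊔ L T = T := hr0 (r0 + 1) (by omega)
  let I := Ideal.span {(p : 𝕎)}
  let C : ℕ → Submodule 𝕎 N := fun r => iterT Q L r ⊔ I • T
  have hCm : Monotone C := fun a b hab => sup_le_sup_right (hTm hab) _
  have hLT : L T ≤ T := le_sup_right.trans hQT.le
  have hCs : ∀ r, C (r + 1) = Q ⊔ L (C r) ⊔ I • T := by
    intro r
    change Q ⊔ L (iterT Q L r) ⊔ I • T = Q ⊔ L (iterT Q L r ⊔ I • T) ⊔ I • T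
    rw [hsup, hLp, ← sup_assoc, sup_assoc (Q ⊔ L (iterT Q L r)),
      sup_eq_right.2 (smul_mono_right I hLT)]
  obtain ⟨r, hrn, hr⟩ := chain_rep n hn T C hCm (fun v hv => by
      refine Submodule.mem_sup_right ?_
      exact Submodule.smul_mem_smul (Ideal.mem_span_singleton_self _) hv) (fun r =>
      sup_le (hTT r) Submodule.smul_le_right)
  have hst : ∀ k, C (r + k) = C r := by
    intro k
    induction k with
    | zero => rfl
    | succ k ih =>
      rw [← add_assoc, hCs, ih, ← hCs]
      exact le_antisymm hr (hCm (Nat.le_succ r))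
  have hTn : T ≤ iterT Q L n ⊔ I • T := by
    calc T ≤ C r0 := le_sup_left
      _ ≤ C (r + r0) := hCm (by omega)
      _ = C r := hst r0
      _ ≤ C n := hCm hrn
  have hfg : T.FG := by
    have : IsNoetherian 𝕎 T := isNoetherian_of_le (hTB r0)
    exact Module.Finite.iff_fg.1 inferInstance
  have hle : T ≤ iterT Q L n :=
    Submodule.le_of_le_smul_of_le_jacobson_bot (I := I) hfg (IsAdicComplete.le_jacobson_bot _) hTn
  have : iterT Q L n = T := le_antisymm (hTT n) hle
  rw [this]
  exact hQT

end Chain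

section Step1

variable {p κ}
variable {ι : Type} [Fintype ι] [DecidableEq ι]

theorem act_act' (σ : K ≃+* K) (m : ι → ℕ) (hm : ∀ i, 0 < m i) {d d' d'' : ι → ℤ} {k k' k'' : ℤ}
    (hd : ∀ i, d i + d' i = d'' i) (hk : k + k' = k'')
    (v : (Σ i, Fin (m i)) → K) :
    act σ m d k (act σ m d' k' v) = act σ m d'' k'' v := by
  rw [act_act σ m hm, hk, show d + d' = d'' from funext hd]

theorem act_pow_smul (σ : K ≃+* K)
    (hσ : ∀ x : 𝕎, σ (algebraMap 𝕎 K x) = algebraMap 𝕎 K (WittVector.frobenius x))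
    (m : ι → ℕ) (d : ι → ℤ) (k : ℤ) (e : ℕ) (v : (Σ i, Fin (m i)) → K) :
    act σ m d k ((p : 𝕎) ^ e • v) = (p : 𝕎) ^ e • act σ m d k v := by
  rw [act_smul σ hσ, tau_p]

theorem pmono {N : Type*} [AddCommGroup N] [Module (WittVector p κ) N]
    (M : Submodule (WittVector p κ) N) {a b : ℕ} (hab : a ≤ b) {v : N}
    (h : (p : WittVector p κ) ^ a • v ∈ M) : (p : WittVector p κ) ^ b • v ∈ M := by
  obtain ⟨c, rfl⟩ := Nat.exists_eq_add_of_le hab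
  rw [add_comm, pow_add, mul_smul]
  exact M.smul_mem _ h

/-- `M` is commensurable with the standard lattice. -/
def IsLat (m : ι → ℕ) (M : Submodule 𝕎 ((Σ i, Fin (m i)) → K)) : Prop :=
  ∃ e : ℕ, (∀ v ∈ M0 p κ m, (p : 𝕎) ^ e • v ∈ M) ∧ (∀ v ∈ M, (p : 𝕎) ^ e • v ∈ M0 p κ m)

/-- `p^a F M ⊆ M`. -/
def Bd (σ : K ≃+* K) (m : ι → ℕ) (h : ι → ℤ) (a : ℕ)
    (M : Submodule 𝕎 ((Σ i, Fin (m i)) → K)) : Prop :=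
  ∀ v ∈ M, (p : 𝕎) ^ a • act σ m h 1 v ∈ M

theorem F_bound (σ : K ≃+* K)
    (hσ : ∀ x : 𝕎, σ (algebraMap 𝕎 K x) = algebraMap 𝕎 K (WittVector.frobenius x))
    (m : ι → ℕ) (hm : ∀ i, 0 < m i) (h : ι → ℤ) (a : ℕ)
    (M : Submodule 𝕎 ((Σ i, Fin (m i)) → K)) (hM : Bd σ m h a M) (k : ℕ) (v) (hv : v ∈ M) :
    (p : 𝕎) ^ (a * k) • act σ m (fun i => k * h i) k v ∈ M := by
  induction k with
  | zero =>
    have := act_zero σ m hm v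
    simp only [Nat.cast_zero, zero_mul, mul_zero, pow_zero, one_smul]
    change act σ m 0 0 v ∈ M
    rwa [this]
  | succ k ih =>
    have h1 := hM _ ih
    rw [act_pow_smul σ hσ, smul_smul, ← pow_add, act_act' σ m hm
      (d'' := fun i => ((k + 1 : ℕ) : ℤ) * h i) (k'' := ((k + 1 : ℕ) : ℤ))
      (fun i => by push_cast; ring) (by push_cast; ring)] at h1
    convert h1 using 3
    ring

theorem G_bound (σ : K ≃+* K)
    (hσ : ∀ x : 𝕎, σ (algebraMap 𝕎 K x) = algebraMap 𝕎 K (WittVector.frobenius x))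
    (m : ι → ℕ) (hm : ∀ i, 0 < m i) (h : ι → ℤ) (a : ℕ)
    (M : Submodule 𝕎 ((Σ i, Fin (m i)) → K)) (hM : Bd σ m h a M) (e : ℤ) (k : ℕ)
    (v) (hv : v ∈ M) :
    (p : 𝕎) ^ (a * k + e.natAbs) • act σ m (fun i => e * m i + k * h i) k v ∈ M := by
  have h1 := F_bound σ hσ m hm h a M hM k v hv
  rw [pow_add, mul_smul]
  rcases Int.eq_nat_or_neg e with ⟨n, rfl | rfl⟩
  · have : act σ m (fun i => n * m i + k * h i) k v =
        (p : 𝕎) ^ n • act σ m (fun i => k * h i) k v := by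
      rw [← act_p σ m hm]
      exact (act_act' σ m hm (fun i => rfl) (zero_add _) v).symm
    rw [this, smul_comm, smul_comm ((p : 𝕎) ^ (a * k))]
    exact M.smul_mem _ (M.smul_mem _ h1)
  · have : (p : 𝕎) ^ n • act σ m (fun i => (-n : ℤ) * m i + k * h i) k v =
        act σ m (fun i => k * h i) k v := by
      rw [← act_p σ m hm]
      exact act_act' σ m hm (fun i => by ring) (zero_add _) v
    rw [Int.natAbs_neg, Int.natAbs_natCast, this]
    exact h1

theorem actS_mono (σ : K ≃+* K)
    (hσ : ∀ x : 𝕎, σ (algebraMap 𝕎 K x) = algebraMap 𝕎 K (WittVector.frobenius x))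
    (m : ι → ℕ) (d : ι → ℤ) (k : ℤ) : Monotone (actS σ hσ m d k) :=
  fun _ _ h _ hv => h hv

theorem actS_sup (σ : K ≃+* K)
    (hσ : ∀ x : 𝕎, σ (algebraMap 𝕎 K x) = algebraMap 𝕎 K (WittVector.frobenius x))
    (m : ι → ℕ) (hm : ∀ i, 0 < m i) (d : ι → ℤ) (k : ℤ) (X Y) :
    actS σ hσ m d k (X ⊔ Y) = actS σ hσ m d k X ⊔ actS σ hσ m d k Y := by
  apply le_antisymm
  · intro w hw
    rw [mem_actS, Submodule.mem_sup] at hw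
    obtain ⟨x, hx, y, hy, hxy⟩ := hw
    have := congrArg (act σ m d k) hxy
    rw [act_act_neg σ m hm, map_add] at this
    rw [← this]
    exact Submodule.add_mem_sup ((act_mem_actS σ hσ m hm d k X x).2 hx)
      ((act_mem_actS σ hσ m hm d k Y y).2 hy)
  · exact sup_le (actS_mono σ hσ m d k le_sup_left) (actS_mono σ hσ m d k le_sup_right)

theorem mem_span_p_smul {N : Type*} [AddCommGroup N] [Module (WittVector p κ) N]
    (X : Submodule (WittVector p κ) N) (w : N) :
    w ∈ Ideal.span {(p : WittVector p κ)} • X ↔ ∃ x ∈ X, (p : WittVector p κ) • x = w := by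
  rw [Submodule.ideal_span_singleton_smul, Submodule.mem_smul_pointwise_iff_exists]

theorem actS_psmul (σ : K ≃+* K)
    (hσ : ∀ x : 𝕎, σ (algebraMap 𝕎 K x) = algebraMap 𝕎 K (WittVector.frobenius x))
    (m : ι → ℕ) (hm : ∀ i, 0 < m i) (d : ι → ℤ) (k : ℤ) (X) :
    actS σ hσ m d k (Ideal.span {(p : 𝕎)} • X) = Ideal.span {(p : 𝕎)} • actS σ hσ m d k X := by
  have hc : ∀ (d : ι → ℤ) (k : ℤ) (v : (Σ i, Fin (m i)) → K),
      act σ m d k ((p : 𝕎) • v) = (p : 𝕎) • act σ m d k v := by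
    intro d k v
    have := act_pow_smul σ hσ m d k 1 v
    rwa [pow_one] at this
  ext w
  rw [mem_actS, mem_span_p_smul, mem_span_p_smul]
  constructor
  · rintro ⟨x, hx, hxw⟩
    refine ⟨act σ m d k x, (act_mem_actS σ hσ m hm d k X x).2 hx, ?_⟩
    rw [← hc, hxw, act_act_neg σ m hm]
  · rintro ⟨x, hx, rfl⟩
    exact ⟨_, hx, (hc _ _ _).symm⟩

theorem no_li (m : ι → ℕ) (f : Fin (Fintype.card (Σ i, Fin (m i)) + 1) → ((Σ i, Fin (m i)) → K)) :
    ¬ LinearIndependent 𝕎 f := by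
  intro hf
  rw [LinearIndependent.iff_fractionRing 𝕎 K] at hf
  have := hf.fintype_card_le_finrank
  rw [Module.finrank_fintype_fun_eq_card, Fintype.card_fin] at this
  omega

/-- Vectors supported on `S`. -/
def supp (m : ι → ℕ) (S : Finset ι) : Submodule 𝕎 ((Σ i, Fin (m i)) → K) where
  carrier := {v | proj m S v = v}
  zero_mem' := map_zero _
  add_mem' := fun {v w} hv hw => by
    change proj m S (v + w) = v + w
    rw [map_add, hv, hw]
  smul_mem' := fun c v hv => by
    change proj m S (c • v) = c • v
    rw [map_smul, hv]

theorem mem_supp (m : ι → ℕ) (S : Finset ι) (v : (Σ i, Fin (m i)) → K) :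
    v ∈ supp m S ↔ proj m S v = v := Iff.rfl

theorem proj_mem_supp (m : ι → ℕ) (S : Finset ι) (v : (Σ i, Fin (m i)) → K) :
    proj m S v ∈ supp m S := by
  rw [mem_supp, proj_proj, Finset.inter_self]

theorem act_mem_supp (σ : K ≃+* K) (m : ι → ℕ) (d : ι → ℤ) (k : ℤ) (S : Finset ι)
    (v : (Σ i, Fin (m i)) → K) (hv : v ∈ supp m S) : act σ m d k v ∈ supp m S := by
  rw [mem_supp] at *
  rw [← act_proj, hv]

theorem supp_mono (m : ι → ℕ) (S S' : Finset ι) (h : S ⊆ S')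
    (v : (Σ i, Fin (m i)) → K) (hv : v ∈ supp m S) : v ∈ supp m S' := by
  rw [mem_supp] at *
  rw [← hv, proj_proj, Finset.inter_eq_right.2 h]

/-- The lattice `p^{-e} M0`. -/
def MM (p : ℕ) [Fact p.Prime] (κ : Type) [Field κ] [IsAlgClosed κ] [CharP κ p]
    {ι : Type} (m : ι → ℕ) (e : ℕ) :
    Submodule (WittVector p κ) ((Σ i, Fin (m i)) → FractionRing (WittVector p κ)) :=
  (M0 p κ m).comap (LinearMap.lsmul (WittVector p κ) _ ((p : WittVector p κ) ^ e))

theorem mem_MM (m : ι → ℕ) (e : ℕ) (v : (Σ i, Fin (m i)) → K) :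
    v ∈ MM p κ m e ↔ (p : 𝕎) ^ e • v ∈ M0 p κ m := Iff.rfl

theorem act_MM (σ : K ≃+* K)
    (hσ : ∀ x : 𝕎, σ (algebraMap 𝕎 K x) = algebraMap 𝕎 K (WittVector.frobenius x))
    (m : ι → ℕ) (hm : ∀ i, 0 < m i) (d : ι → ℤ) (k : ℤ) (S : Finset ι)
    (hd : ∀ i ∈ S, 0 ≤ d i) (e : ℕ) (v) (hv : v ∈ supp m S ⊓ MM p κ m e) :
    act σ m d k v ∈ supp m S ⊓ MM p κ m e := by
  refine ⟨act_mem_supp σ m d k S v hv.1, ?_⟩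
  rw [SetLike.mem_coe, mem_MM, ← act_pow_smul σ hσ]
  exact act_M0 σ hσ m hm d k S hd _ hv.2 ((mem_supp _ _ _).1 (Submodule.smul_mem _ _ hv.1))

theorem prop1 (σ : K ≃+* K)
    (hσ : ∀ x : 𝕎, σ (algebraMap 𝕎 K x) = algebraMap 𝕎 K (WittVector.frobenius x))
    (m : ι → ℕ) (hm : ∀ i, 0 < m i) (h : ι → ℤ) (a c1 : ℕ) (S S0 : Finset ι)
    (m0 : ℕ) (h0 : ℤ) (hmin : ∀ i ∈ S, h0 * m i ≤ h i * m0)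
    (hS0 : ∀ i, i ∈ S0 ↔ i ∈ S ∧ h i * m0 = h0 * m i)
    (M : Submodule 𝕎 ((Σ i, Fin (m i)) → K)) (hL : IsLat m M) (hB : Bd σ m h a M)
    (hc : ∀ v ∈ M, (p : 𝕎) ^ c1 • proj m S v ∈ M) :
    ∃ T' : Submodule 𝕎 ((Σ i, Fin (m i)) → K),
      (∀ v ∈ M, proj m S0 v ∈ T') ∧
      (∀ v ∈ T', (p : 𝕎) ^ (c1 + Fintype.card (Σ i, Fin (m i)) * (a * m0 + h0.natAbs)) • v ∈ M) ∧
      (∀ v ∈ T', proj m S0 v = v) ∧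
      (∀ v, act σ m (fun i => -h0 * m i + m0 * h i) m0 v ∈ T' ↔ v ∈ T') := by
  obtain ⟨e, he1, he2⟩ := hL
  set dΨ : ι → ℤ := fun i => -h0 * m i + m0 * h i with hdΨ
  set n := Fintype.card (Σ i, Fin (m i)) with hn
  set aΨ := a * m0 + h0.natAbs with haΨ
  have hd0 : ∀ i ∈ S, 0 ≤ dΨ i := by
    intro i hi
    have := hmin i hi
    simp only [hdΨ]; linarith
  have hdz : ∀ i ∈ S0, dΨ i = 0 := by
    intro i hi
    have := ((hS0 i).1 hi).2
    simp only [hdΨ]; linarith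
  have hdp : ∀ i ∈ S \ S0, 1 ≤ dΨ i := by
    intro i hi
    rw [Finset.mem_sdiff, hS0] at hi
    have h1 := hmin i hi.1
    have h2 : h i * m0 ≠ h0 * m i := fun hh => hi.2 ⟨hi.1, hh⟩
    have h3 : h0 * m i < h i * m0 := lt_of_le_of_ne h1 h2.symm
    simp only [hdΨ]; linarith
  have hSS : S0 ⊆ S := fun i hi => ((hS0 i).1 hi).1
  let Q : Submodule 𝕎 ((Σ i, Fin (m i)) → K) := M.map (proj m S)
  let B := supp m S ⊓ MM p κ m e
  have hQB : Q ≤ B := by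
    rintro _ ⟨v, hv, rfl⟩
    refine ⟨proj_mem_supp m S v, ?_⟩
    rw [SetLike.mem_coe, mem_MM, ← map_smul]
    exact proj_M0 m S _ (he2 v hv)
  let Ls := actS σ hσ m dΨ m0
  have hLB : ∀ X, X ≤ B → Ls X ≤ B := by
    intro X hX w hw
    have := act_MM σ hσ m hm dΨ m0 S hd0 e _ (hX hw)
    rwa [act_act_neg σ m hm] at this
  have hBn : IsNoetherian 𝕎 B := noeth_of_le m e B fun v hv => hv.2
  have hchain := chain_lemma n (no_li m) Q B hBn Ls (actS_mono σ hσ m dΨ m0)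
    (actS_sup σ hσ m hm dΨ m0) (actS_psmul σ hσ m hm dΨ m0) hQB hLB
  have hbound : ∀ r, ∀ v ∈ iterT Q Ls r, (p : 𝕎) ^ (c1 + r * aΨ) • v ∈ M := by
    intro r
    induction r with
    | zero =>
      intro v hv
      have hv : v = 0 := (Submodule.mem_bot 𝕎).1 hv
      rw [hv, smul_zero]; exact M.zero_mem
    | succ r ih =>
      intro v hv
      obtain ⟨q, hq, w, hw, rfl⟩ := Submodule.mem_sup.1 hv
      rw [smul_add]
      refine M.add_mem ?_ ?_
      · obtain ⟨u, hu, rfl⟩ := hq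
        exact pmono M (Nat.le_add_right _ _) (hc u hu)
      · have h1 := G_bound σ hσ m hm h a M hB (-h0) m0 _ (ih _ hw)
        rw [act_pow_smul σ hσ, act_act_neg σ m hm, smul_smul, ← pow_add] at h1
        refine pmono M (le_of_eq ?_) h1
        rw [Int.natAbs_neg, haΨ]; ring
  set T := iterT Q Ls n with hT
  have hTB : T ≤ B := by
    have : ∀ r, iterT Q Ls r ≤ B := by
      intro r
      induction r with
      | zero => exact bot_le
      | succ r ih => exact sup_le hQB (hLB _ ih)
    exact this n
  have hQT : Q ≤ T := le_sup_left.trans hchain.le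
  have hΨT : ∀ v ∈ T, act σ m dΨ m0 v ∈ T := fun v hv =>
    hchain.le (Submodule.mem_sup_right ((act_mem_actS σ hσ m hm _ _ _ _).2 hv))
  let T' := T ⊓ supp m S0
  have hT'1 : ∀ v ∈ T', act σ m dΨ m0 v ∈ T' := fun v hv =>
    ⟨hΨT v hv.1, act_mem_supp _ _ _ _ _ _ hv.2⟩
  -- stability
  have hT'2 : ∀ v, act σ m dΨ m0 v ∈ T' ↔ v ∈ T' := by
    intro v
    refine ⟨fun hv => ?_, hT'1 v⟩
    let f : ℕ → Submodule 𝕎 ((Σ i, Fin (m i)) → K) := fun i =>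
      actS σ hσ m (fun j => -(i * dΨ j)) (-(i * m0)) T'
    have hfmem : ∀ i w, w ∈ f i ↔ act σ m (fun j => i * dΨ j) (i * m0) w ∈ T' := by
      intro i w
      rw [mem_actS, neg_neg]
      have : -(fun j => -((i : ℤ) * dΨ j)) = fun j => (i : ℤ) * dΨ j := by
        funext j; simp
      rw [this]
    have hB0 : ∀ i, f i ≤ supp m S0 ⊓ MM p κ m e := by
      intro i w hw
      rw [hfmem] at hw
      have h1 := act_MM σ hσ m hm (-(fun j => (i : ℤ) * dΨ j)) (-(i * m0)) S0 (by
        intro j hj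
        simp [hdz j hj]) e _ ⟨hw.2, (hTB hw.1).2⟩
      rwa [act_act σ m hm, neg_add_cancel, neg_add_cancel, act_zero σ m hm] at h1
    have hfm : Monotone f := by
      apply monotone_nat_of_le_succ
      intro i w hw
      rw [hfmem] at hw ⊢
      have := hT'1 _ hw
      rwa [act_act' σ m hm (d'' := fun j => ((i + 1 : ℕ) : ℤ) * dΨ j)
        (k'' := ((i + 1 : ℕ) : ℤ) * m0) (fun i => by push_cast; ring) (by push_cast; ring)] at this
    obtain ⟨i, hi⟩ := stab_of_noeth _ (noeth_of_le m e (supp m S0 ⊓ MM p κ m e) fun v hv => hv.2)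
      f hfm hB0
    have h1 : act σ m (-(fun j => (i : ℤ) * dΨ j)) (-(i * m0)) v ∈ f (i + 1) := by
      rw [hfmem, act_act' σ m hm (d'' := dΨ) (k'' := (m0 : ℤ)) (fun i => by
        simp only [Pi.neg_apply]; push_cast; ring) (by push_cast; ring)]
      exact hv
    rw [hi (i + 1) (by omega), hfmem, act_act_neg σ m hm] at h1
    exact h1
  have hT'3 : ∀ (i : ℕ) v, act σ m (fun j => i * dΨ j) (i * m0) v ∈ T' → v ∈ T' := by
    intro i
    induction i with
    | zero =>
      intro v hv
      simp only [Nat.cast_zero, zero_mul] at hv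
      change act σ m 0 0 v ∈ T' at hv
      rwa [act_zero σ m hm] at hv
    | succ i ih =>
      intro v hv
      apply ih
      rw [← hT'2, act_act' σ m hm (d'' := fun j => ((i + 1 : ℕ) : ℤ) * dΨ j)
        (k'' := ((i + 1 : ℕ) : ℤ) * m0) (fun i => by push_cast; ring) (by push_cast; ring)]
      exact hv
  have hΨTi : ∀ (i : ℕ) v, v ∈ T → act σ m (fun j => i * dΨ j) (i * m0) v ∈ T := by
    intro i
    induction i with
    | zero =>
      intro v hv
      simp only [Nat.cast_zero, zero_mul]
      change act σ m 0 0 v ∈ T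
      rwa [act_zero σ m hm]
    | succ i ih =>
      intro v hv
      rw [← act_act' σ m hm (d := dΨ) (k := m0) (d' := fun j => (i : ℤ) * dΨ j)
        (k' := (i : ℤ) * m0) (fun i => by push_cast; ring) (by push_cast; ring)]
      exact hΨT _ (ih v hv)
  -- projection to S0 preserves T
  have hproj : ∀ v ∈ T, proj m S0 v ∈ T' := by
    intro v hv
    let I : ℕ := 2 * e * ∑ i, m i
    apply hT'3 I
    refine ⟨?_, act_mem_supp _ _ _ _ _ _ (proj_mem_supp m S0 v)⟩
    have hvS : proj m S v = v := (hTB hv).1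
    have e1 : proj m S0 v = v - proj m (S \ S0) v := by
      rw [proj_sdiff m S S0 hSS, hvS]; abel
    rw [e1, map_sub]
    refine T.sub_mem (hΨTi I v hv) (hQT ?_)
    set w := proj m (S \ S0) v with hw
    have hw1 : w ∈ supp m (S \ S0) := proj_mem_supp _ _ _
    have hw2 : (p : 𝕎) ^ e • w ∈ M0 p κ m := by
      rw [hw, ← map_smul]; exact proj_M0 m _ _ (hTB hv).2
    let d2 : ι → ℤ := fun j => I * dΨ j - 2 * e * m j
    have hd2 : ∀ j ∈ S \ S0, 0 ≤ d2 j := by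
      intro j hj
      have h1 := hdp j hj
      have h2 : m j ≤ ∑ i, m i := Finset.single_le_sum (fun _ _ => Nat.zero_le _) (Finset.mem_univ j)
      have h3 : (2 * e * m j : ℤ) ≤ I := by
        simp only [I]
        exact_mod_cast Nat.mul_le_mul_left (2 * e) h2
      have h4 : (I : ℤ) ≤ I * dΨ j := le_mul_of_one_le_right (by positivity) h1
      simp only [d2]; linarith
    have h5 := act_M0 σ hσ m hm d2 (I * m0) (S \ S0) hd2 _ hw2
      ((mem_supp _ _ _).1 (Submodule.smul_mem _ _ hw1))
    have h6 := he1 _ h5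
    rw [act_pow_smul σ hσ, smul_smul, ← pow_add, ← act_p σ m hm, act_act' σ m hm
      (d'' := fun j => (I : ℤ) * dΨ j) (k'' := (I : ℤ) * m0) (fun i => by
        simp only [d2]; push_cast; ring) (zero_add _)] at h6
    refine ⟨_, h6, ?_⟩
    exact act_mem_supp σ m _ _ S _ (supp_mono m _ _ Finset.sdiff_subset _ hw1)
  refine ⟨T', ?_, fun v hv => hbound n v hv.1, fun v hv => hv.2, hT'2⟩
  intro v hv
  have h1 := hproj _ (hQT ⟨v, hv, rfl⟩)
  rwa [proj_proj, Finset.inter_eq_left.2 hSS] at h1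

end Step1

section Step2

variable {p κ}
variable {ι : Type} [Fintype ι] [DecidableEq ι]

theorem act_iter (σ : K ≃+* K) (m : ι → ℕ) (hm : ∀ i, 0 < m i) (d : ι → ℤ) (k : ℤ) (n : ℕ)
    (v : (Σ i, Fin (m i)) → K) :
    (act σ m d k)^[n] v = act σ m (fun i => n * d i) (n * k) v := by
  induction n with
  | zero =>
    simp only [Nat.cast_zero, zero_mul]
    exact (act_zero σ m hm v).symm
  | succ n ih =>
    rw [Function.iterate_succ_apply', ih]
    exact act_act' σ m hm (fun i => by push_cast; ring) (by push_cast; ring) v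

/-- Uniform boundedness of the projection to the blocks in `S`. -/
def GoodU (σ : K ≃+* K) (m : ι → ℕ) (h : ι → ℤ) (a : ℕ) (S : Finset ι) : Prop :=
  ∃ c : ℕ, ∀ M : Submodule 𝕎 ((Σ i, Fin (m i)) → K), IsLat m M → Bd σ m h a M →
    ∀ v ∈ M, (p : 𝕎) ^ c • proj m S v ∈ M

theorem slope_iff (a b : ℤ) (c d : ℕ) (hc : 0 < c) (hd : 0 < d) :
    (a : ℚ) / c = (b : ℚ) / d ↔ a * d = b * c := by
  rw [div_eq_div_iff (by positivity) (by positivity)]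
  exact_mod_cast Iff.rfl

theorem slope_le_iff (a b : ℤ) (c d : ℕ) (hc : 0 < c) (hd : 0 < d) :
    (a : ℚ) / c ≤ (b : ℚ) / d ↔ a * d ≤ b * c := by
  rw [div_le_div_iff₀ (by positivity) (by positivity)]
  exact_mod_cast Iff.rfl

theorem good_class (σ : K ≃+* K)
    (hσ : ∀ x : 𝕎, σ (algebraMap 𝕎 K x) = algebraMap 𝕎 K (WittVector.frobenius x))
    (m : ι → ℕ) (hm : ∀ i, 0 < m i) (h : ι → ℤ) (a : ℕ) (q : ℚ) (n : ℕ) :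
    ∀ S : Finset ι, S.card ≤ n → GoodU σ m h a S →
      GoodU σ m h a (S.filter fun i => (h i : ℚ) / m i = q) := by
  induction n with
  | zero =>
    intro S hS hg
    have : S = ∅ := Finset.card_eq_zero.1 (by omega)
    subst this
    simpa using hg
  | succ n ih =>
    intro S hS hg
    rcases S.eq_empty_or_nonempty with rfl | hne
    · simpa using hg
    obtain ⟨i0, hi0, hmin⟩ := S.exists_min_image (fun i => (h i : ℚ) / m i) hne
    let S0 := S.filter fun i => (h i : ℚ) / m i = (h i0 : ℚ) / m i0
    have hS0 : ∀ i, i ∈ S0 ↔ i ∈ S ∧ h i * m i0 = h i0 * m i := by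
      intro i
      rw [Finset.mem_filter, slope_iff _ _ _ _ (hm i) (hm i0)]
    have hSS : S0 ⊆ S := Finset.filter_subset _ _
    obtain ⟨c, hc⟩ := hg
    have hp1 := fun M hL hB => prop1 σ hσ m hm h a c S S0 (m i0) (h i0) (fun i hi => by
      have := hmin i hi
      rwa [slope_le_iff _ _ _ _ (hm i0) (hm i)] at this) hS0 M hL hB (hc M hL hB)
    have hg0 : GoodU σ m h a S0 := by
      refine ⟨c + Fintype.card (Σ i, Fin (m i)) * (a * m i0 + (h i0).natAbs),
        fun M hL hB v hv => ?_⟩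
      obtain ⟨T', h1, h2, -⟩ := hp1 M hL hB
      exact h2 _ (h1 v hv)
    by_cases hq : (h i0 : ℚ) / m i0 = q
    · rw [← hq]; exact hg0
    · obtain ⟨c0, hc0⟩ := hg0
      have hg1 : GoodU σ m h a (S \ S0) := by
        refine ⟨max c c0, fun M hL hB v hv => ?_⟩
        rw [proj_sdiff m S S0 hSS, smul_sub]
        exact M.sub_mem (pmono M (le_max_left _ _) (hc M hL hB v hv))
          (pmono M (le_max_right _ _) (hc0 M hL hB v hv))
      have hi00 : i0 ∈ S0 := (hS0 i0).2 ⟨hi0, rfl⟩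
      have hcard : (S \ S0).card ≤ n := by
        have : (S \ S0).card < S.card := Finset.card_lt_card
          ⟨Finset.sdiff_subset, fun hh => (Finset.mem_sdiff.1 (hh hi0)).2 hi00⟩
        omega
      have h3 := ih _ hcard hg1
      convert h3 using 1
      ext i
      simp only [Finset.mem_filter, Finset.mem_sdiff, S0]
      constructor
      · rintro ⟨h1, h2⟩
        exact ⟨⟨h1, fun hh => hq (by rw [← hh.2, h2])⟩, h2⟩
      · rintro ⟨⟨h1, _⟩, h2⟩
        exact ⟨h1, h2⟩

theorem rank_lemma (m : ι → ℕ) (S : Finset ι) (m0 : ℕ) (hS : ∀ i ∈ S, m i = m0)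
    (T : Submodule 𝕎 ((Σ i, Fin (m i)) → K)) (e1 e2 : ℕ)
    (h1 : ∀ v ∈ T, proj m S v = v ∧ (p : 𝕎) ^ e1 • v ∈ M0 p κ m)
    (h2 : ∀ u ∈ M0 p κ m, proj m S u = u → (p : 𝕎) ^ e2 • u ∈ T) :
    Module.finrank 𝕎 T = m0 * S.card := by
  have : IsNoetherian 𝕎 T := noeth_of_le m e1 T fun v hv => (h1 v hv).2
  let inc : ({x : Σ i, Fin (m i) // x.1 ∈ S} → 𝕎) →ₗ[𝕎] ((Σ i, Fin (m i)) → K) :=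
    { toFun := fun a x => if hx : x.1 ∈ S then algebraMap 𝕎 K (a ⟨x, hx⟩) else 0
      map_add' := fun a b => by
        funext x
        simp only [Pi.add_apply]; split_ifs <;> simp
      map_smul' := fun c a => by
        funext x
        simp only [Pi.smul_apply, RingHom.id_apply]
        split_ifs <;> simp [Algebra.smul_def] }
  have hinc : ∀ a x, inc a x = if hx : x.1 ∈ S then algebraMap 𝕎 K (a ⟨x, hx⟩) else 0 :=
    fun _ _ => rfl
  have hincinj : Function.Injective inc := by
    intro a b hab
    funext ⟨x, hx⟩
    have := congrFun hab x
    rw [hinc, hinc, dif_pos hx, dif_pos hx] at this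
    exact IsFractionRing.injective 𝕎 K this
  have hM0 : ∀ a, inc a ∈ M0 p κ m := by
    intro a x
    rw [hinc]
    split_ifs
    · exact ⟨_, rfl⟩
    · exact ⟨0, map_zero _⟩
  have hpr : ∀ a, proj m S (inc a) = inc a := by
    intro a
    funext x
    rw [proj_apply, hinc]
    split_ifs <;> rfl
  have hrange : ∀ v ∈ M0 p κ m, proj m S v = v → v ∈ LinearMap.range inc := by
    intro v hv hv2
    choose z hz using hv
    refine ⟨fun x => z x.1, ?_⟩
    funext x
    rw [hinc, ← hv2, proj_apply]
    split_ifs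
    · exact hz x
    · rfl
  let f1 : ({x : Σ i, Fin (m i) // x.1 ∈ S} → 𝕎) →ₗ[𝕎] T :=
    { toFun := fun a => ⟨(p : 𝕎) ^ e2 • inc a, h2 _ (hM0 a) (hpr a)⟩
      map_add' := fun v w => by apply Subtype.ext; simp
      map_smul' := fun c v => by apply Subtype.ext; simp [smul_smul, mul_comm] }
  let f2 : T →ₗ[𝕎] LinearMap.range inc :=
    { toFun := fun v => ⟨(p : 𝕎) ^ e1 • v.1, hrange _ (h1 _ v.2).2 (by
        rw [map_smul, (h1 _ v.2).1])⟩
      map_add' := fun v w => by apply Subtype.ext; simp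
      map_smul' := fun c v => by apply Subtype.ext; simp [smul_smul, mul_comm] }
  have hf1 : Function.Injective f1 := by
    intro a b hab
    exact hincinj (pow_smul_cancel m e2 _ _ (congrArg Subtype.val hab))
  have hf2 : Function.Injective f2 := by
    intro a b hab
    exact Subtype.ext (pow_smul_cancel m e1 _ _ (congrArg Subtype.val hab))
  have g1 := LinearMap.finrank_le_finrank_of_injective hf1
  have g2 := LinearMap.finrank_le_finrank_of_injective hf2
  rw [← (LinearEquiv.ofInjective inc hincinj).finrank_eq] at g2
  have hA : Module.finrank 𝕎 ({x : Σ i, Fin (m i) // x.1 ∈ S} → 𝕎) = m0 * S.card := by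
    rw [Module.finrank_fintype_fun_eq_card, Fintype.card_subtype]
    have : (Finset.univ.filter fun x : Σ i, Fin (m i) => x.1 ∈ S) =
        S.sigma fun i => Finset.univ := by
      ext x; simp
    rw [this, Finset.card_sigma]
    simp only [Finset.card_univ, Fintype.card_fin]
    rw [Finset.sum_congr rfl hS]
    simp [mul_comm]
  omega

end Step2

section Step2b

variable {p κ}
variable {ι : Type} [Fintype ι] [DecidableEq ι]

theorem bezout_nat (m : ℕ) (hm : 0 < m) (h : ℤ) (hc : Int.gcd m h = 1) :
    ∃ (x : ℕ) (y : ℤ), x * h + y * m = 1 := by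
  have h1 := Int.gcd_eq_gcd_ab m h
  rw [hc] at h1
  set A := Int.gcdA m h
  set B := Int.gcdB m h
  have hm' : (m : ℤ) ≠ 0 := by exact_mod_cast hm.ne'
  have h2 := Int.emod_add_mul_ediv B m
  refine ⟨(B % m).toNat, A + (B / m) * h, ?_⟩
  rw [Int.toNat_of_nonneg (Int.emod_nonneg _ hm')]
  push_cast at h1
  linear_combination (h : ℤ) * h2 - h1

theorem prop2_lattice (σ : K ≃+* K)
    (hσ : ∀ x : 𝕎, σ (algebraMap 𝕎 K x) = algebraMap 𝕎 K (WittVector.frobenius x))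
    (m : ι → ℕ) (hm : ∀ i, 0 < m i) (h : ι → ℤ) (a c2 : ℕ) (S : Finset ι)
    (m0 : ℕ) (hm0 : 0 < m0) (h0 : ℤ) (hSm : ∀ i ∈ S, m i = m0)
    (x : ℕ) (y : ℤ) (hxy : x * h0 + y * m0 = 1)
    (M : Submodule 𝕎 ((Σ i, Fin (m i)) → K)) (hL : IsLat m M) (hB : Bd σ m h a M)
    (T' : Submodule 𝕎 ((Σ i, Fin (m i)) → K))
    (hT1 : ∀ v ∈ M, proj m S v ∈ T')
    (hT2 : ∀ v ∈ T', (p : 𝕎) ^ c2 • v ∈ M)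
    (hT3 : ∀ v ∈ T', proj m S v = v)
    (hT4 : ∀ v, act σ m (fun i => -h0 * m i + m0 * h i) m0 v ∈ T' ↔ v ∈ T') :
    ∃ T : Submodule 𝕎 ((Σ i, Fin (m i)) → K),
      (∀ v ∈ M, proj m S v ∈ T) ∧
      (∀ v ∈ T, (p : 𝕎) ^ (c2 + a * (m0 * x) + m0 * y.natAbs) • v ∈ M) ∧
      (∀ v ∈ T, proj m S v = v) ∧
      (∀ v, act σ m (fun i => -h0 * m i + m0 * h i) m0 v ∈ T ↔ v ∈ T) ∧
      (∀ v ∈ T, act σ m (fun i => y * m i + x * h i) x v ∈ T) ∧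
      IsNoetherian 𝕎 T ∧
      Module.finrank 𝕎 T = m0 * S.card := by
  set dΨ : ι → ℤ := fun i => -h0 * m i + m0 * h i with hdΨ
  set dθ : ι → ℤ := fun i => y * m i + x * h i with hdθ
  let U : Fin m0 → Submodule 𝕎 ((Σ i, Fin (m i)) → K) := fun j =>
    actS σ hσ m (fun i => (j : ℕ) * dθ i) ((j : ℕ) * x) T'
  have hU : ∀ j w, w ∈ U j → ∃ t ∈ T', w = act σ m (fun i => (j : ℕ) * dθ i) ((j : ℕ) * x) t :=
    fun j w hw => ⟨_, hw, (act_act_neg σ m hm _ _ _).symm⟩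
  have hU' : ∀ j t, t ∈ T' → act σ m (fun i => (j : ℕ) * dθ i) ((j : ℕ) * x) t ∈ U j :=
    fun j t ht => (act_mem_actS σ hσ m hm _ _ _ _).2 ht
  have hT'T : ∀ t ∈ T', t ∈ ⨆ j, U j := by
    intro t ht
    refine Submodule.mem_iSup_of_mem ⟨0, hm0⟩ ?_
    have := hU' ⟨0, hm0⟩ t ht
    simp only [Nat.cast_zero, zero_mul] at this
    rwa [show act σ m (fun i => (0 : ℤ)) 0 t = t from act_zero σ m hm t] at this
  have hΨx : ∀ (n : ℕ) t, t ∈ T' → act σ m (fun i => n * dΨ i) (n * m0) t ∈ T' := by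
    intro n t ht
    rw [← act_iter σ m hm]
    induction n with
    | zero => exact ht
    | succ n ih =>
      rw [Function.iterate_succ_apply']
      exact (hT4 _).2 ih
  have hb1 : ∀ v ∈ ⨆ j, U j, (p : 𝕎) ^ (c2 + a * (m0 * x) + m0 * y.natAbs) • v ∈ M := by
    intro v hv
    induction hv using Submodule.iSup_induction' with
    | mem j w hw =>
      obtain ⟨t, ht, rfl⟩ := hU j w hw
      have h1 := G_bound σ hσ m hm h a M hB ((j : ℕ) * y) ((j : ℕ) * x) _ (hT2 t ht)
      have e1 : act σ m (fun i => ((j : ℕ) * y) * m i + (((j : ℕ) * x : ℕ) : ℤ) * h i)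
          (((j : ℕ) * x : ℕ) : ℤ) = act σ m (fun i => (j : ℕ) * dθ i) ((j : ℕ) * x) := by
        congr 1
        · funext i; simp only [hdθ]; push_cast; ring
      rw [e1, act_pow_smul σ hσ, smul_smul, ← pow_add] at h1
      refine pmono M ?_ h1
      have hj := j.2.le
      rw [Int.natAbs_mul, Int.natAbs_natCast]
      have h3 : a * ((j : ℕ) * x) ≤ a * (m0 * x) :=
        Nat.mul_le_mul_left _ (Nat.mul_le_mul_right _ hj)
      have h4 : (j : ℕ) * y.natAbs ≤ m0 * y.natAbs := Nat.mul_le_mul_right _ hj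
      omega
    | zero => rw [smul_zero]; exact M.zero_mem
    | add v w _ _ hv hw => rw [smul_add]; exact M.add_mem hv hw
  have hb2 : ∀ v ∈ ⨆ j, U j, proj m S v = v := by
    have : (⨆ j, U j) ≤ supp m S := by
      refine iSup_le fun j w hw => ?_
      obtain ⟨t, ht, rfl⟩ := hU j w hw
      exact act_mem_supp _ _ _ _ _ _ (hT3 t ht)
    exact fun v hv => this hv
  have hb4 : ∀ v ∈ ⨆ j, U j, act σ m dθ x v ∈ ⨆ j, U j := by
    intro v hv
    induction hv using Submodule.iSup_induction' with
    | mem j w hw =>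
      obtain ⟨t, ht, rfl⟩ := hU j w hw
      rw [act_act' σ m hm (d'' := fun i => (((j : ℕ) + 1 : ℕ) : ℤ) * dθ i)
        (k'' := (((j : ℕ) + 1 : ℕ) : ℤ) * x) (fun i => by push_cast; ring) (by push_cast; ring)]
      rcases Nat.lt_or_ge ((j : ℕ) + 1) m0 with hj | hj
      · exact Submodule.mem_iSup_of_mem ⟨_, hj⟩ (hU' ⟨_, hj⟩ t ht)
      · have hj' : (j : ℕ) + 1 = m0 := le_antisymm j.2 hj
        rw [hj']
        have e1 : act σ m (fun i => (m0 : ℤ) * dθ i) ((m0 : ℤ) * x) t =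
            (p : 𝕎) ^ 1 • act σ m (fun i => x * dΨ i) (x * m0) t := by
          rw [← act_p σ m hm, act_act' σ m hm (fun i => ?_) ?_]
          · ring
          · simp only [hdθ, hdΨ]
            push_cast
            linear_combination (-(m i : ℤ)) * hxy
        rw [e1]
        exact Submodule.smul_mem _ _ (hT'T _ (hΨx x t ht))
    | zero => rw [map_zero]; exact Submodule.zero_mem _
    | add v w _ _ hv hw => rw [map_add]; exact Submodule.add_mem _ hv hw
  have hb3 : ∀ v, act σ m dΨ m0 v ∈ ⨆ j, U j ↔ v ∈ ⨆ j, U j := by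
    have key : ∀ (d : ι → ℤ) (k : ℤ), (∀ t ∈ T', act σ m d k t ∈ T') →
        ∀ v ∈ ⨆ j, U j, act σ m d k v ∈ ⨆ j, U j := by
      intro d k hdk v hv
      induction hv using Submodule.iSup_induction' with
      | mem j w hw =>
        obtain ⟨t, ht, rfl⟩ := hU j w hw
        rw [act_act σ m hm, add_comm, add_comm k, ← act_act σ m hm]
        exact Submodule.mem_iSup_of_mem j (hU' j _ (hdk t ht))
      | zero => rw [map_zero]; exact Submodule.zero_mem _
      | add v w _ _ hv hw => rw [map_add]; exact Submodule.add_mem _ hv hw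
    intro v
    constructor
    · intro hv
      have := key (-dΨ) (-m0) (fun t ht => by
        rw [← hT4, act_act_neg σ m hm]; exact ht) _ hv
      rwa [act_act σ m hm, neg_add_cancel, neg_add_cancel, act_zero σ m hm] at this
    · exact key _ _ (fun t ht => (hT4 t).2 ht) v
  obtain ⟨e, he1, he2⟩ := hL
  have hM0 : ∀ v ∈ ⨆ j, U j,
      (p : 𝕎) ^ (e + (c2 + a * (m0 * x) + m0 * y.natAbs)) • v ∈ M0 p κ m := by
    intro v hv
    rw [pow_add, mul_smul]
    exact he2 _ (hb1 v hv)
  refine ⟨⨆ j, U j, fun v hv => hT'T _ (hT1 v hv), hb1, hb2, hb3, hb4,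
    noeth_of_le m _ _ hM0, ?_⟩
  refine rank_lemma m S m0 hSm _ _ e (fun v hv => ⟨hb2 v hv, hM0 v hv⟩) ?_
  intro u hu hu2
  have := hT'T _ (hT1 _ (he1 u hu))
  rwa [map_smul, hu2] at this

theorem prop2_basis (σ : K ≃+* K)
    (hσ : ∀ x : 𝕎, σ (algebraMap 𝕎 K x) = algebraMap 𝕎 K (WittVector.frobenius x))
    (m : ι → ℕ) (hm : ∀ i, 0 < m i) (h : ι → ℤ) (S : Finset ι)
    (m0 : ℕ) (hm0 : 0 < m0) (h0 : ℤ)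
    (x : ℕ) (y : ℤ) (hxy : x * h0 + y * m0 = 1)
    (T : Submodule 𝕎 ((Σ i, Fin (m i)) → K))
    (hT4 : ∀ v, act σ m (fun i => -h0 * m i + m0 * h i) m0 v ∈ T ↔ v ∈ T)
    (hT5 : ∀ v ∈ T, act σ m (fun i => y * m i + x * h i) x v ∈ T)
    (hT6 : IsNoetherian 𝕎 T)
    (hT7 : Module.finrank 𝕎 T = m0 * S.card) :
    ∃ f : ι → ℤ → ((Σ i, Fin (m i)) → K),
      (∀ i ∈ S, ∀ t, act σ m h 1 (f i t) = f i (t + h0)) ∧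
      (∀ i ∈ S, ∀ t, f i (t + m0) = (p : 𝕎) • f i t) ∧
      (∀ i ∈ S, ∀ j : ℕ, f i j ∈ T) ∧
      (∀ v ∈ T, v ∈ Submodule.span 𝕎 {w | ∃ i ∈ S, ∃ j : ℕ, j < m0 ∧ w = f i j}) := by
  set dΨ : ι → ℤ := fun i => -h0 * m i + m0 * h i with hdΨ
  set dθ : ι → ℤ := fun i => y * m i + x * h i with hdθ
  let θ : T →+ T :=
    { toFun := fun v => ⟨act σ m dθ x v.1, hT5 _ v.2⟩
      map_zero' := Subtype.ext (map_zero _)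
      map_add' := fun v w => Subtype.ext (map_add _ _ _) }
  let Ψ : T →+ T :=
    { toFun := fun v => ⟨act σ m dΨ m0 v.1, (hT4 _).2 v.2⟩
      map_zero' := Subtype.ext (map_zero _)
      map_add' := fun v w => Subtype.ext (map_add _ _ _) }
  have hθ1 : ∀ v : T, (θ v).1 = act σ m dθ x v.1 := fun _ => rfl
  have hΨ1 : ∀ v : T, (Ψ v).1 = act σ m dΨ m0 v.1 := fun _ => rfl
  have hθi : ∀ (n : ℕ) (v : T), (θ^[n] v).1 = act σ m (fun i => n * dθ i) (n * x) v.1 := by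
    intro n v
    rw [← act_iter σ m hm]
    induction n with
    | zero => rfl
    | succ n ih => rw [Function.iterate_succ_apply', hθ1, ih, Function.iterate_succ_apply']
  have hΨi : ∀ (n : ℕ) (v : T), (Ψ^[n] v).1 = act σ m (fun i => n * dΨ i) (n * m0) v.1 := by
    intro n v
    rw [← act_iter σ m hm]
    induction n with
    | zero => rfl
    | succ n ih => rw [Function.iterate_succ_apply', hΨ1, ih, Function.iterate_succ_apply']
  have hpw : ∀ (n : ℤ) v, act σ m (fun i => n * dθ i + m0 * dθ i) (n * x + m0 * x) v =
      (p : 𝕎) • act σ m (fun i => x * dΨ i) (x * m0) (act σ m (fun i => n * dθ i) (n * x) v) := by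
    intro n v
    have : ∀ w : (Σ i, Fin (m i)) → K, (p : 𝕎) • w = act σ m (fun i => (1 : ℕ) * m i) 0 w := by
      intro w; rw [act_p σ m hm, pow_one]
    rw [this, act_act σ m hm, act_act σ m hm]
    congr 2
    · funext i
      simp only [hdθ, hdΨ, Pi.add_apply]
      push_cast
      linear_combination (m i : ℤ) * hxy
    · ring
  have hfree : Module.Free 𝕎 T := inferInstance
  have hfin : Module.Finite 𝕎 T := inferInstance
  obtain ⟨v, hv1, hv2⟩ := iso_lemma (p := p) (κ := κ) (T := T) m0 S.card x hm0 hT7 (tau x) θ Ψ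
    (fun v w hvw => Subtype.ext (act_inj σ m hm dθ x (congrArg Subtype.val hvw)))
    ⟨fun v w hvw => Subtype.ext (act_inj σ m hm dΨ m0 (congrArg Subtype.val hvw)),
      fun w => ⟨⟨act σ m (-dΨ) (-m0) w.1, by
        rw [← hT4, act_act_neg σ m hm]; exact w.2⟩, Subtype.ext (act_act_neg σ m hm _ _ _)⟩⟩
    (fun c v => Subtype.ext (act_smul σ hσ m dθ x c v.1))
    (fun c v => Subtype.ext (by
      rw [hΨ1, Submodule.coe_smul, act_smul σ hσ, tau_nat]; rfl))
    (fun v => Subtype.ext (by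
      rw [hθ1, hΨ1, hΨ1, hθ1, act_act σ m hm, act_act σ m hm, add_comm, add_comm (x : ℤ)]))
    (fun v => Subtype.ext (by
      rw [hθi, Submodule.coe_smul, hΨi]
      have := hpw 0 v.1
      simp only [zero_mul, zero_add] at this
      rwa [show act σ m (fun i => (0 : ℤ)) 0 v.1 = v.1 from act_zero σ m hm v.1] at this))
  have hΨv : ∀ k, act σ m dΨ m0 (v k).1 = (v k).1 := fun k => congrArg Subtype.val (hv1 k)
  have hΨvn : ∀ (n : ℕ) k, act σ m (fun i => n * dΨ i) (n * m0) (v k).1 = (v k).1 := by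
    intro n k
    rw [← act_iter σ m hm]
    exact Function.iterate_fixed (hΨv k) n
  have hΨvz : ∀ (n : ℤ) k, act σ m (fun i => n * dΨ i) (n * m0) (v k).1 = (v k).1 := by
    intro n k
    rcases Int.eq_nat_or_neg n with ⟨n, rfl | rfl⟩
    · exact hΨvn n k
    · apply act_inj σ m hm (fun i => n * dΨ i) (n * m0)
      rw [hΨvn, act_act' σ m hm (d'' := 0) (k'' := 0) (fun i => by
        simp) (by ring), act_zero σ m hm]
  let f : ι → ℤ → ((Σ i, Fin (m i)) → K) := fun i t =>
    if hi : i ∈ S then act σ m (fun i => t * dθ i) (t * x) (v (S.equivFin ⟨i, hi⟩)).1 else 0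
  have hf : ∀ i (hi : i ∈ S) t, f i t = act σ m (fun i => t * dθ i) (t * x)
      (v (S.equivFin ⟨i, hi⟩)).1 := fun i hi t => dif_pos hi
  refine ⟨f, ?_, ?_, ?_, ?_⟩
  · intro i hi t
    rw [hf i hi, hf i hi, ← hΨvz y]
    rw [act_act σ m hm, act_act σ m hm, act_act σ m hm]
    have hyk : ∀ z : (Σ i, Fin (m i)) → K, act σ m (fun i => y * dΨ i) (y * m0) z = z →
        act σ m ((h + fun i => t * dθ i) + fun i => y * dΨ i) (1 + t * x + y * m0) z =
        act σ m ((fun i => (t + h0) * dθ i) + fun i => y * dΨ i) ((t + h0) * x + y * m0) z := by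
      intro z hz
      have e1 : act σ m ((h + fun i => t * dθ i) + fun i => y * dΨ i) (1 + t * x + y * m0) z =
          act σ m (h + fun i => t * dθ i) (1 + t * x) z := by
        conv_rhs => rw [← hz]
        rw [act_act σ m hm]
      rw [e1]
      congr 2
      · funext i
        simp only [Pi.add_apply, hdθ, hdΨ]
        linear_combination (-(h i : ℤ)) * hxy
      · linear_combination (-1 : ℤ) * hxy
    exact hyk _ (hΨvz y _)
  · intro i hi t
    have h1 := hpw t (v (S.equivFin ⟨i, hi⟩)).1
    rw [hf i hi, hf i hi]
    have e1 : act σ m (fun i => (t + m0) * dθ i) ((t + m0) * x) (v (S.equivFin ⟨i, hi⟩)).1 =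
        act σ m (fun i => t * dθ i + m0 * dθ i) (t * x + m0 * x) (v (S.equivFin ⟨i, hi⟩)).1 := by
      congr 2
      · funext i; ring
      · ring
    rw [e1, h1, act_act σ m hm, add_comm, add_comm ((x : ℤ) * m0), ← act_act σ m hm]
    rw [hΨvn x]
  · intro i hi j
    rw [hf i hi, ← hθi]
    exact (θ^[j] _).2
  · intro w hw
    have h1 := Submodule.mem_map_of_mem (f := T.subtype) (hv2 ⟨w, hw⟩)
    rw [Submodule.map_span] at h1
    refine Submodule.span_mono ?_ h1
    rintro _ ⟨_, ⟨⟨j, k⟩, rfl⟩, rfl⟩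
    refine ⟨(S.equivFin.symm k).1, (S.equivFin.symm k).2, j, j.2, ?_⟩
    rw [hf _ (S.equivFin.symm k).2]
    simp only [Subtype.coe_eta, Equiv.apply_symm_apply]
    exact hθi j (v k)

theorem prop2 (σ : K ≃+* K)
    (hσ : ∀ x : 𝕎, σ (algebraMap 𝕎 K x) = algebraMap 𝕎 K (WittVector.frobenius x))
    (m : ι → ℕ) (hm : ∀ i, 0 < m i) (h : ι → ℤ) (hco : ∀ i, Int.gcd (m i) (h i) = 1) (a : ℕ)
    (i0 : ι) (S : Finset ι) (hS : ∀ i, i ∈ S ↔ m i = m i0 ∧ h i = h i0) :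
    ∃ c : ℕ, ∀ M : Submodule 𝕎 ((Σ i, Fin (m i)) → K), IsLat m M → Bd σ m h a M →
    ∃ f : ι → ℤ → ((Σ i, Fin (m i)) → K),
      (∀ i ∈ S, ∀ t, act σ m h 1 (f i t) = f i (t + h i0)) ∧
      (∀ i ∈ S, ∀ t, f i (t + m i0) = (p : 𝕎) • f i t) ∧
      (∀ i ∈ S, ∀ j : ℕ, (p : 𝕎) ^ c • f i j ∈ M) ∧
      (∀ v ∈ M, proj m S v ∈ Submodule.span 𝕎 {w | ∃ i ∈ S, ∃ j : ℕ, j < m i0 ∧ w = f i j}) := by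
  have hcl : S = Finset.univ.filter fun i => (h i : ℚ) / m i = (h i0 : ℚ) / m i0 := by
    ext i
    rw [hS, Finset.mem_filter]
    constructor
    · rintro ⟨h1, h2⟩
      exact ⟨Finset.mem_univ _, by rw [h1, h2]⟩
    · rintro ⟨-, h1⟩
      have hcop : ∀ i, Nat.Coprime (h i).natAbs ((m i : ℤ)).natAbs := fun i => by
        have := hco i
        rw [Int.gcd_comm] at this
        exact this
      have := Rat.div_int_inj (a := h i) (b := m i) (c := h i0) (d := m i0)
        (by exact_mod_cast hm i) (by exact_mod_cast hm i0) (hcop i) (hcop i0) (by exact_mod_cast h1)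
      exact ⟨by exact_mod_cast this.2, this.1⟩
  have hgood : GoodU σ m h a S := by
    rw [hcl]
    refine good_class σ hσ m hm h a _ _ Finset.univ le_rfl ⟨0, fun M _ _ v hv => ?_⟩
    rw [pow_zero, one_smul, proj_univ]; exact hv
  obtain ⟨c1, hc1⟩ := hgood
  obtain ⟨x, y, hxy⟩ := bezout_nat (m i0) (hm i0) (h i0) (hco i0)
  let c2 := c1 + Fintype.card (Σ i, Fin (m i)) * (a * m i0 + (h i0).natAbs)
  refine ⟨c2 + a * (m i0 * x) + m i0 * y.natAbs, fun M hL hB => ?_⟩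
  obtain ⟨T', hT1, hT2, hT3, hT4⟩ := prop1 σ hσ m hm h a c1 S S (m i0) (h i0)
    (fun i hi => by rw [((hS i).1 hi).1, ((hS i).1 hi).2])
    (fun i => ⟨fun hi => ⟨hi, by rw [((hS i).1 hi).1, ((hS i).1 hi).2]⟩, fun hi => hi.1⟩)
    M hL hB (hc1 M hL hB)
  obtain ⟨T, g1, g2, g3, g4, g5, g6, g7⟩ := prop2_lattice σ hσ m hm h a c2 S (m i0) (hm i0) (h i0)
    (fun i hi => ((hS i).1 hi).1) x y hxy M hL hB T' hT1 hT2 hT3 hT4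
  obtain ⟨f, f1, f2, f3, f4⟩ := prop2_basis σ hσ m hm h S (m i0) (hm i0) (h i0) x y hxy T g4 g5 g6 g7
  exact ⟨f, f1, f2, fun i hi j => g2 _ (f3 i hi j), fun v hv => f4 _ (g1 v hv)⟩

end Step2b

section Smith

variable {p κ}

theorem smith_raw {R : Type*} [CommRing R] [IsDomain R] [IsPrincipalIdealRing R] {n : ℕ}
    (X : Matrix (Fin n) (Fin n) R) (hX : X.det ≠ 0) :
    ∃ (C1 C2 : Matrix (Fin n) (Fin n) R) (a : Fin n → R), IsUnit C1.det ∧ IsUnit C2.det ∧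
      X = C1 * Matrix.diagonal a * C2 := by
  have hinj : Function.Injective X.mulVecLin := by
    rw [← LinearMap.ker_eq_bot, Matrix.ker_mulVecLin_eq_bot_iff]
    intro v hv
    by_contra hne
    exact hX (Matrix.exists_mulVec_eq_zero_iff.1 ⟨v, hne, hv⟩)
  obtain ⟨b', a, ab', hab⟩ := Submodule.exists_smith_normal_form_of_rank_eq
    (N := LinearMap.range X.mulVecLin) (Pi.basisFun R (Fin n))
    (LinearMap.finrank_range_of_inj hinj)
  let C1 : Matrix (Fin n) (Fin n) R := (Pi.basisFun R (Fin n)).toMatrix b'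
  have hC1 : IsUnit C1.det := by
    have := (Pi.basisFun R (Fin n)).isUnit_det b'
    rwa [Module.Basis.det_apply] at this
  have hC1v : ∀ i r, C1 r i = b' i r := fun i r => by
    simp [C1, Module.Basis.toMatrix_apply]
  -- columns of X in terms of the basis
  let u : Fin n → LinearMap.range X.mulVecLin := fun k => ⟨X.mulVecLin (Pi.single k 1), ⟨_, rfl⟩⟩
  let C2 : Matrix (Fin n) (Fin n) R := fun i k => ab'.repr (u k) i
  have e1 : X = C1 * Matrix.diagonal a * C2 := by
    ext r k
    have h1 := congrArg Subtype.val (ab'.sum_repr (u k))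
    have h2 := congrFun h1 r
    simp only [Submodule.coe_sum, Submodule.coe_smul, hab, Finset.sum_apply, Pi.smul_apply,
      smul_eq_mul] at h2
    have h3 : (u k).1 r = X r k := by simp [u]
    rw [← h3, ← h2, Matrix.mul_apply]
    refine Finset.sum_congr rfl fun i _ => ?_
    rw [Matrix.mul_diagonal, hC1v]
    ring
  have hex : ∀ i, ∃ w, X.mulVecLin w = (ab' i).1 := fun i => (ab' i).2
  choose w hw using hex
  have e2 : C1 * Matrix.diagonal a = X * Matrix.of (fun r i => w i r) := by
    ext r i
    rw [Matrix.mul_diagonal, hC1v]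
    have := congrFun (hw i) r
    rw [hab] at this
    simp only [Pi.smul_apply, smul_eq_mul] at this
    rw [mul_comm, ← this]
    rfl
  refine ⟨C1, C2, a, hC1, ?_, e1⟩
  rw [e2] at e1
  have := congrArg Matrix.det e1
  rw [Matrix.det_mul, Matrix.det_mul, mul_assoc] at this
  have h4 := mul_left_cancel₀ hX ((mul_one X.det).trans this)
  exact IsUnit.of_mul_eq_one_right _ h4.symm

theorem smith_hodge {n : ℕ} (c : ℕ) (X Y : Matrix (Fin n) (Fin n) 𝕎)
    (hXY : X * Y = (p : 𝕎) ^ c • (1 : Matrix (Fin n) (Fin n) 𝕎)) :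
    ∃ μg : Fin n → ℤ, (∀ i, 0 ≤ μg i ∧ μg i ≤ c) ∧
      IsHodgePoint p κ (X.map (algebraMap 𝕎 K)) μg := by
  have hp : (p : 𝕎) ≠ 0 := WittVector.p_nonzero p κ
  have hX : X.det ≠ 0 := by
    intro h0
    have := congrArg Matrix.det hXY
    rw [Matrix.det_mul, h0, zero_mul, Matrix.det_smul, Matrix.det_one, mul_one] at this
    exact pow_ne_zero _ (pow_ne_zero _ hp) this.symm
  obtain ⟨C1, C2, a, h1, h2, e⟩ := smith_raw X hX
  have ha : ∀ i, a i ≠ 0 := by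
    intro i hi
    apply hX
    rw [e, Matrix.det_mul, Matrix.det_mul, Matrix.det_diagonal,
      Finset.prod_eq_zero (Finset.mem_univ i) hi, mul_zero, zero_mul]
  have := fun i => WittVector.exists_eq_pow_p_mul' (a i) (ha i)
  choose k u hku using this
  -- bounds
  have hk : ∀ i, k i ≤ c := by
    intro i
    have e3 : Matrix.diagonal a * (C2 * Y * C1) = (p : 𝕎) ^ c • (1 : Matrix (Fin n) (Fin n) 𝕎) := by
      have hu : IsUnit C1 := (Matrix.isUnit_iff_isUnit_det _).2 h1
      apply hu.mul_left_cancel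
      calc C1 * (Matrix.diagonal a * (C2 * Y * C1)) = (C1 * Matrix.diagonal a * C2) * Y * C1 := by
            simp only [Matrix.mul_assoc]
        _ = C1 * ((p : 𝕎) ^ c • (1 : Matrix (Fin n) (Fin n) 𝕎)) := by
            rw [← e, hXY]; simp
    have e4 := congrFun (congrFun e3 i) i
    rw [Matrix.diagonal_mul, Matrix.smul_apply, Matrix.one_apply_eq, smul_eq_mul, mul_one,
      hku] at e4
    have hd : (p : 𝕎) ^ k i ∣ (p : 𝕎) ^ c := ⟨_, by rw [← e4, mul_assoc]⟩
    exact (pow_dvd_pow_iff hp (WittVector.irreducible p).not_isUnit).1 hd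
  let s : Equiv.Perm (Fin n) := Tuple.sort (fun i => -(k i : ℤ))
  have hs : Monotone ((fun i => -(k i : ℤ)) ∘ s) := Tuple.monotone_sort _
  let P : Matrix (Fin n) (Fin n) 𝕎 := (1 : Matrix (Fin n) (Fin n) 𝕎).submatrix id s
  let Q : Matrix (Fin n) (Fin n) 𝕎 := (1 : Matrix (Fin n) (Fin n) 𝕎).submatrix s id
  have hPQ : P * Q = 1 := by
    simp only [P, Q]
    rw [Matrix.submatrix_mul_equiv, Matrix.one_mul, Matrix.submatrix_id_id]
  have hdet := congrArg Matrix.det hPQ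
  rw [Matrix.det_mul, Matrix.det_one] at hdet
  have hdiag : Matrix.diagonal a =
      P * Matrix.diagonal (fun i => (p : 𝕎) ^ k (s i)) * Q * Matrix.diagonal (fun i => (u i : 𝕎)) := by
    have e5 : P * Matrix.diagonal (fun i => (p : 𝕎) ^ k (s i)) * Q =
        Matrix.diagonal (fun i => (p : 𝕎) ^ k i) := by
      have : Matrix.diagonal (fun i => (p : 𝕎) ^ k (s i)) =
          (Matrix.diagonal (fun i => (p : 𝕎) ^ k i)).submatrix s s := by
        rw [Matrix.submatrix_diagonal_equiv]; rfl
      rw [this]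
      simp only [P, Q]
      rw [Matrix.submatrix_mul_equiv, Matrix.submatrix_mul_equiv, Matrix.one_mul, Matrix.mul_one,
        Matrix.submatrix_id_id]
    rw [e5, Matrix.diagonal_mul_diagonal]
    congr 1
    funext i
    exact hku i
  refine ⟨fun i => k (s i), fun i => ⟨by positivity, Int.ofNat_le.2 (hk _)⟩, ?_,
    (C1 * P).map (algebraMap 𝕎 K),
    (Q * Matrix.diagonal (fun i => (u i : 𝕎)) * C2).map (algebraMap 𝕎 K),
    ⟨_, ?_, rfl⟩, ⟨_, ?_, rfl⟩, ?_⟩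
  · intro i j hij
    have := hs hij
    simp only [Function.comp_apply] at this
    simp only
    linarith
  · rw [Matrix.det_mul]
    exact h1.mul (IsUnit.of_mul_eq_one _ hdet)
  · rw [Matrix.det_mul, Matrix.det_mul, Matrix.det_diagonal]
    refine ((IsUnit.of_mul_eq_one_right _ hdet).mul ?_).mul h2
    exact IsUnit.prod_univ_iff.2 fun i => (u i).isUnit
  · have e6 : Matrix.diagonal (fun i => (p : K) ^ ((k (s i) : ℕ) : ℤ)) =
        (Matrix.diagonal (fun i => (p : 𝕎) ^ k (s i))).map (algebraMap 𝕎 K) := by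
      rw [Matrix.diagonal_map (map_zero _)]
      congr 1
      funext i
      simp
    have e7 : X = C1 * P * Matrix.diagonal (fun i => (p : 𝕎) ^ k (s i)) *
        (Q * Matrix.diagonal (fun i => (u i : 𝕎)) * C2) := by
      rw [e, hdiag]
      simp only [Matrix.mul_assoc]
    rw [e6, ← Matrix.map_mul, ← Matrix.map_mul, ← e7]

end Smith

section Combine

variable {p κ}
variable {ι : Type} [Fintype ι] [DecidableEq ι]

theorem prop3 (σ : K ≃+* K)
    (hσ : ∀ x : 𝕎, σ (algebraMap 𝕎 K x) = algebraMap 𝕎 K (WittVector.frobenius x))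
    (m : ι → ℕ) (hm : ∀ i, 0 < m i) (h : ι → ℤ) (hco : ∀ i, Int.gcd (m i) (h i) = 1) (a : ℕ) :
    ∃ c : ℕ, ∀ M : Submodule 𝕎 ((Σ i, Fin (m i)) → K), IsLat m M → Bd σ m h a M →
    ∃ f : ι → ℤ → ((Σ i, Fin (m i)) → K),
      (∀ i t, act σ m h 1 (f i t) = f i (t + h i)) ∧
      (∀ i t, f i (t + m i) = (p : 𝕎) • f i t) ∧
      (∀ i, ∀ j : ℕ, (p : 𝕎) ^ c • f i j ∈ M) ∧
      (∀ v ∈ M, v ∈ Submodule.span 𝕎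
        (Set.range fun x : (Σ i, Fin (m i)) => f x.1 ((x.2 : ℕ) : ℤ))) := by
  classical
  let S : ℕ × ℤ → Finset ι := fun q => Finset.univ.filter fun i => (m i, h i) = q
  have hSmem : ∀ q i, i ∈ S q ↔ (m i, h i) = q := fun q i => by simp [S]
  have key : ∀ q : ℕ × ℤ, ∃ c : ℕ, ∀ M : Submodule 𝕎 ((Σ i, Fin (m i)) → K), IsLat m M →
      Bd σ m h a M → ∃ f : ι → ℤ → ((Σ i, Fin (m i)) → K),
      (∀ i ∈ S q, ∀ t, act σ m h 1 (f i t) = f i (t + h i)) ∧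
      (∀ i ∈ S q, ∀ t, f i (t + m i) = (p : 𝕎) • f i t) ∧
      (∀ i ∈ S q, ∀ j : ℕ, (p : 𝕎) ^ c • f i j ∈ M) ∧
      (∀ v ∈ M, proj m (S q) v ∈ Submodule.span 𝕎
        {w | ∃ i ∈ S q, ∃ j : ℕ, j < m i ∧ w = f i j}) := by
    intro q
    by_cases hq : ∃ i0, (m i0, h i0) = q
    · obtain ⟨i0, rfl⟩ := hq
      have hS' : ∀ i, i ∈ S (m i0, h i0) ↔ m i = m i0 ∧ h i = h i0 := fun i => by
        rw [hSmem, Prod.mk.injEq]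
      obtain ⟨c, hc⟩ := prop2 σ hσ m hm h hco a i0 (S (m i0, h i0)) hS'
      refine ⟨c, fun M hL hB => ?_⟩
      obtain ⟨f, f1, f2, f3, f4⟩ := hc M hL hB
      refine ⟨f, fun i hi t => ?_, fun i hi t => ?_, f3, fun v hv => ?_⟩
      · rw [((hS' i).1 hi).2]; exact f1 i hi t
      · rw [((hS' i).1 hi).1]; exact f2 i hi t
      · refine Submodule.span_mono ?_ (f4 v hv)
        rintro w ⟨i, hi, j, hj, rfl⟩
        exact ⟨i, hi, j, by rw [((hS' i).1 hi).1]; exact hj, rfl⟩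
    · have hne : ∀ i, i ∉ S q := fun i hi => hq ⟨i, (hSmem q i).1 hi⟩
      refine ⟨0, fun M _ _ => ⟨0, fun i hi => absurd hi (hne i), fun i hi => absurd hi (hne i),
        fun i hi => absurd hi (hne i), fun v _ => ?_⟩⟩
      have : proj m (S q) v = 0 := by
        funext x
        rw [proj_apply, if_neg (hne _)]; rfl
      rw [this]
      exact Submodule.zero_mem _
  choose c hc using key
  let I : Finset (ℕ × ℤ) := Finset.univ.image fun i => (m i, h i)
  have hI : ∀ i, (m i, h i) ∈ I := fun i => Finset.mem_image_of_mem _ (Finset.mem_univ i)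
  refine ⟨∑ q ∈ I, c q, fun M hL hB => ?_⟩
  choose f f1 f2 f3 f4 using fun q => hc q M hL hB
  refine ⟨fun i => f (m i, h i) i, fun i => f1 _ i ((hSmem _ i).2 rfl),
    fun i => f2 _ i ((hSmem _ i).2 rfl), fun i j => ?_, fun v hv => ?_⟩
  · exact pmono M (Finset.single_le_sum (f := c) (fun q _ => Nat.zero_le _) (hI i))
      (f3 _ i ((hSmem _ i).2 rfl) j)
  · have hsum : v = ∑ q ∈ I, proj m (S q) v := by
      funext x
      rw [Finset.sum_apply, Finset.sum_eq_single (m x.1, h x.1)]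
      · rw [proj_apply, if_pos ((hSmem _ _).2 rfl)]
      · intro q _ hq
        rw [proj_apply, if_neg (fun hx => hq ((hSmem _ _).1 hx).symm)]
      · exact fun hx => absurd (hI _) hx
    rw [hsum]
    refine Submodule.sum_mem _ fun q _ => ?_
    refine Submodule.span_mono ?_ (f4 q v hv)
    rintro w ⟨i, hi, j, hj, rfl⟩
    refine ⟨⟨i, ⟨j, hj⟩⟩, ?_⟩
    simp only
    rw [(hSmem q i).1 hi]

theorem f_shift (m : ℕ) (f : ℤ → ι → K) (hf : ∀ t, f (t + m) = (p : 𝕎) • f t) (t q : ℤ) :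
    f (t + m * q) = (p : K) ^ q • f t := by
  have hs : ∀ v : ι → K, (p : 𝕎) • v = (p : K) • v := by
    intro v
    rw [← map_natCast (algebraMap 𝕎 K), algebraMap_smul]
  have h1 : ∀ (q : ℕ) t, f (t + m * q) = (p : K) ^ q • f t := by
    intro q
    induction q with
    | zero => intro t; simp
    | succ q ih =>
      intro t
      rw [show t + m * ((q + 1 : ℕ) : ℤ) = (t + m * q) + m by push_cast; ring, hf, ih, hs,
        smul_smul, pow_succ']
  rcases Int.eq_nat_or_neg q with ⟨q, rfl | rfl⟩
  · rw [h1]; simp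
  · have := h1 q (t + m * -q)
    rw [show t + m * -q + m * q = t by ring] at this
    rw [this, smul_smul, _root_.zpow_neg, zpow_natCast, inv_mul_cancel₀ (pow_ne_zero _ pK_ne), one_smul]

end Combine

section Final

variable {p κ}

theorem frac_bound (z : K) : ∃ (e : ℕ), ∀ e' ≥ e, ∃ (y : 𝕎), algebraMap 𝕎 K y = (p : K) ^ e' * z := by
  obtain ⟨r, s, hs, rfl⟩ := IsFractionRing.div_surjective (A := 𝕎) z
  obtain ⟨m, u, hu⟩ := WittVector.exists_eq_pow_p_mul' s (nonZeroDivisors.ne_zero hs)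
  refine ⟨m, fun e' he' => ⟨(p : 𝕎) ^ (e' - m) * (↑u⁻¹ : 𝕎) * r, ?_⟩⟩
  have hs0 : algebraMap 𝕎 K s ≠ 0 := by
    intro h0
    exact nonZeroDivisors.ne_zero hs ((IsFractionRing.injective 𝕎 K) (h0.trans (map_zero _).symm))
  rw [← mul_div_assoc, eq_div_iff hs0, ← map_natCast (algebraMap 𝕎 K) p, ← map_pow, ← map_mul,
    ← map_mul]
  congr 1
  obtain ⟨d, rfl⟩ := Nat.exists_eq_add_of_le he'
  rw [hu, Nat.add_sub_cancel_left, pow_add]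
  have := u.inv_mul
  linear_combination (p : 𝕎) ^ d * r * (p : 𝕎) ^ m * this

theorem mat_bound {n : ℕ} (G : Matrix (Fin n) (Fin n) K) :
    ∃ (e : ℕ) (Y : Matrix (Fin n) (Fin n) 𝕎), Y.map (algebraMap 𝕎 K) = (p : K) ^ e • G := by
  choose e he using fun (x : Fin n × Fin n) => frac_bound (G x.1 x.2)
  have h1 : ∀ i j, e (i, j) ≤ ∑ x, e x := fun i j =>
    Finset.single_le_sum (f := e) (fun _ _ => Nat.zero_le _) (Finset.mem_univ _)
  choose Y hY using fun i j => he (i, j) _ (h1 i j)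
  refine ⟨∑ x, e x, Matrix.of Y, ?_⟩
  ext i j
  simp [hY]

theorem hodge_bound {n : ℕ} (b : Matrix (Fin n) (Fin n) K) (μ : Fin n → ℤ)
    (hb : IsHodgePoint p κ b μ) (a : ℕ) (ha : ∀ i, 0 ≤ a + μ i) :
    ∃ Y : Matrix (Fin n) (Fin n) 𝕎, Y.map (algebraMap 𝕎 K) = (p : K) ^ a • b := by
  obtain ⟨-, _, _, ⟨d1, -, rfl⟩, ⟨d2, -, rfl⟩, rfl⟩ := hb
  refine ⟨d1 * Matrix.diagonal (fun i => (p : 𝕎) ^ (a + μ i).toNat) * d2, ?_⟩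
  rw [Matrix.map_mul, Matrix.map_mul, Matrix.diagonal_map (map_zero _), ← Matrix.smul_mul,
    ← Matrix.mul_smul, ← Matrix.diagonal_smul]
  congr 3
  funext i
  rw [map_pow, map_natCast, ← zpow_natCast, Int.toNat_of_nonneg (ha i), _root_.zpow_add₀ pK_ne,
    zpow_natCast]
  rfl

theorem act_min {n : ℕ} (σ : K ≃+* K) (D : BlockData n) (v : (Σ i, Fin (D.m i)) → K) (r : Fin n) :
    act σ D.m D.h 1 v (D.equiv.symm r) =
      (minMatrix p κ D *ᵥ fun k => σ (v (D.equiv.symm k))) r := by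
  rw [act_apply, Matrix.mulVec, dotProduct, ← D.equiv.sum_comp, Fintype.sum_sigma,
    Finset.sum_eq_single (D.equiv.symm r).1]
  · refine Finset.sum_congr rfl fun j _ => ?_
    rw [sig_one]
    simp [minMatrix, Matrix.blockDiagonal'_apply]
  · intro i _ hi
    refine Finset.sum_eq_zero fun j _ => ?_
    simp [minMatrix, Matrix.blockDiagonal'_apply, hi.symm]
  · intro h; exact absurd (Finset.mem_univ _) h

theorem mul_minMatrix {n : ℕ} (D : BlockData n) (J : Matrix (Fin n) (Fin n) K) (r : Fin n)
    (x : Σ i, Fin (D.m i)) :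
    (J * minMatrix p κ D) r (D.equiv x) = ∑ j, J r (D.equiv ⟨x.1, j⟩) *
      Bmat p κ (D.m x.1) (D.h x.1) j x.2 := by
  rw [Matrix.mul_apply, ← D.equiv.sum_comp, Fintype.sum_sigma,
    Finset.sum_eq_single x.1]
  · refine Finset.sum_congr rfl fun j _ => ?_
    simp [minMatrix, Matrix.blockDiagonal'_apply]
  · intro i _ hi
    refine Finset.sum_eq_zero fun j _ => ?_
    simp [minMatrix, Matrix.blockDiagonal'_apply, hi]
  · intro h; exact absurd (Finset.mem_univ _) h

theorem minMatrix_comm {n : ℕ} (σ : K ≃+* K) (D : BlockData n)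
    (f : Fin D.len → ℤ → ((Σ i, Fin (D.m i)) → K))
    (f1 : ∀ i t, act σ D.m D.h 1 (f i t) = f i (t + D.h i))
    (f2 : ∀ i t, f i (t + D.m i) = (p : 𝕎) • f i t)
    (J : Matrix (Fin n) (Fin n) K)
    (hJ : ∀ r x, J r (D.equiv x) = f x.1 ((x.2 : ℕ) : ℤ) (D.equiv.symm r)) :
    minMatrix p κ D * J.map σ = J * minMatrix p κ D := by
  ext r k
  obtain ⟨⟨i, j⟩, rfl⟩ := D.equiv.surjective k
  rw [mul_minMatrix]
  have h1 := act_min σ D (f i ((j : ℕ) : ℤ)) r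
  have h2 : (minMatrix p κ D * J.map σ) r (D.equiv ⟨i, j⟩) =
      (minMatrix p κ D *ᵥ fun k => σ (f i ((j : ℕ) : ℤ) (D.equiv.symm k))) r := by
    rw [Matrix.mul_apply, Matrix.mulVec, dotProduct]
    simp only [Matrix.map_apply, hJ]
  rw [h2, ← h1, f1]
  simp only [hJ]
  have hm0 : (D.m i : ℤ) ≠ 0 := by exact_mod_cast (D.m_pos i).ne'
  have hlt : ((((j : ℕ) : ℤ) + D.h i) % D.m i).toNat < D.m i := by
    have := Int.emod_lt_of_pos (((j : ℕ) : ℤ) + D.h i) (b := D.m i) (by exact_mod_cast D.m_pos i)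
    have := Int.emod_nonneg (((j : ℕ) : ℤ) + D.h i) hm0
    omega
  have hto : ((((((j : ℕ) : ℤ) + D.h i) % D.m i).toNat : ℕ) : ℤ) =
      (((j : ℕ) : ℤ) + D.h i) % D.m i := Int.toNat_of_nonneg (Int.emod_nonneg _ hm0)
  rw [Finset.sum_eq_single ⟨_, hlt⟩]
  · rw [Bmat, if_pos (by simp only [hto]; exact Int.emod_emod_of_dvd _ (dvd_refl _))]
    simp only [hto]
    have h3 := f_shift (D.m i) (f i) (f2 i) ((((j : ℕ) : ℤ) + D.h i) % D.m i)
      ((((j : ℕ) : ℤ) + D.h i) / D.m i)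
    rw [Int.emod_add_mul_ediv] at h3
    rw [h3, Pi.smul_apply, smul_eq_mul, mul_comm]
  · intro j' _ hj'
    rw [Bmat, if_neg, mul_zero]
    intro h4
    apply hj'
    rw [Int.emod_eq_of_lt (by positivity) (by exact_mod_cast j'.2), ← hto] at h4
    exact Fin.ext (by exact_mod_cast h4)
  · intro h; exact absurd (Finset.mem_univ _) h

/-- The lattice spanned by the columns of `G`. -/
def colLat {n : ℕ} (D : BlockData n) (G : Matrix (Fin n) (Fin n) (FractionRing (WittVector p κ))) :
    Submodule (WittVector p κ) ((Σ i, Fin (D.m i)) → FractionRing (WittVector p κ)) :=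
  Submodule.span (WittVector p κ) (Set.range fun k : Fin n => fun x => G (D.equiv x) k)

theorem mem_span_col {n : ℕ} (D : BlockData n) (F : Fin n → ((Σ i, Fin (D.m i)) → K))
    (v : (Σ i, Fin (D.m i)) → K) :
    v ∈ Submodule.span 𝕎 (Set.range F) ↔ ∃ z : Fin n → 𝕎, ∀ r,
      v (D.equiv.symm r) =
        (Matrix.of (fun r k => F k (D.equiv.symm r)) *ᵥ fun k => algebraMap 𝕎 K (z k)) r := by
  rw [Submodule.mem_span_range_iff_exists_fun]
  refine exists_congr fun z => ?_
  have h1 : ∀ x, (∑ k, z k • F k) x = ∑ k, F k x * algebraMap 𝕎 K (z k) := by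
    intro x
    rw [Finset.sum_apply]
    exact Finset.sum_congr rfl fun k _ => by rw [Pi.smul_apply, Algebra.smul_def, mul_comm]
  constructor
  · rintro rfl r
    rw [h1]; rfl
  · intro h
    funext x
    have := h (D.equiv x)
    rw [Equiv.symm_apply_apply] at this
    rw [this, h1]
    simp [Matrix.mulVec, dotProduct]

theorem mem_colLat {n : ℕ} (D : BlockData n) (G : Matrix (Fin n) (Fin n) K)
    (v : (Σ i, Fin (D.m i)) → K) :
    v ∈ colLat D G ↔ ∃ z : Fin n → 𝕎, ∀ r,
      v (D.equiv.symm r) = (G *ᵥ fun k => algebraMap 𝕎 K (z k)) r := by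
  rw [colLat, mem_span_col]
  simp only [Equiv.apply_symm_apply]
  rfl

theorem pw_smul {N : Type*} [AddCommGroup N] [Module (FractionRing (WittVector p κ)) N]
    [Module (WittVector p κ) N]
    [IsScalarTower (WittVector p κ) (FractionRing (WittVector p κ)) N] (e : ℕ) (v : N) :
    (p : WittVector p κ) ^ e • v = (p : FractionRing (WittVector p κ)) ^ e • v := by
  rw [← map_natCast (algebraMap (WittVector p κ) (FractionRing (WittVector p κ))), ← map_pow,
    algebraMap_smul]

theorem mv_int {n : ℕ} (Y : Matrix (Fin n) (Fin n) 𝕎) (z : Fin n → 𝕎) :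
    (fun k => algebraMap 𝕎 K ((Y *ᵥ z) k)) =
      Y.map (algebraMap 𝕎 K) *ᵥ fun k => algebraMap 𝕎 K (z k) := by
  funext k
  exact RingHom.map_mulVec _ _ _ _

theorem colLat_isLat {n : ℕ} (D : BlockData n) (G : Matrix (Fin n) (Fin n) K) (hG : IsUnit G.det) :
    IsLat D.m (colLat D G) := by
  obtain ⟨e1, Y1, h1⟩ := mat_bound G
  obtain ⟨e2, Y2, h2⟩ := mat_bound G⁻¹
  refine ⟨e1 + e2, fun v hv => ?_, fun v hv => ?_⟩
  · refine pmono _ (Nat.le_add_left e2 e1) ?_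
    choose y hy using hv
    rw [mem_colLat]
    refine ⟨Y2 *ᵥ fun r => y (D.equiv.symm r), fun r => ?_⟩
    rw [mv_int, h2, Matrix.mulVec_mulVec, Matrix.mul_smul, Matrix.mul_nonsing_inv _ hG,
      Matrix.smul_mulVec, Matrix.one_mulVec, pw_smul]
    simp only [Pi.smul_apply, hy]
  · refine pmono _ (Nat.le_add_right e1 e2) ?_
    obtain ⟨z, hz⟩ := (mem_colLat D G v).1 hv
    intro x
    refine ⟨(Y1 *ᵥ z) (D.equiv x), ?_⟩
    have := congrFun (mv_int Y1 z) (D.equiv x)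
    rw [this, h1, Matrix.smul_mulVec, Pi.smul_apply, ← hz, Equiv.symm_apply_apply, pw_smul]
    rfl

theorem colLat_bd {n : ℕ} (σ : K ≃+* K)
    (hσ : ∀ x : 𝕎, σ (algebraMap 𝕎 K x) = algebraMap 𝕎 K (WittVector.frobenius x))
    (D : BlockData n) (G b : Matrix (Fin n) (Fin n) K)
    (hb : G * b = minMatrix p κ D * G.map σ) (a : ℕ) (Y : Matrix (Fin n) (Fin n) 𝕎)
    (hY : Y.map (algebraMap 𝕎 K) = (p : K) ^ a • b) :
    Bd σ D.m D.h a (colLat D G) := by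
  intro v hv
  obtain ⟨z, hz⟩ := (mem_colLat D G v).1 hv
  rw [mem_colLat]
  refine ⟨Y *ᵥ fun k => WittVector.frobenius (z k), fun r => ?_⟩
  rw [mv_int, hY, Matrix.mulVec_mulVec, Matrix.mul_smul, hb, pw_smul, Pi.smul_apply, act_min,
    Matrix.smul_mulVec, Pi.smul_apply, ← Matrix.mulVec_mulVec]
  congr 3
  funext k
  rw [hz]
  have := RingHom.map_mulVec (σ : K →+* K) G (fun k => algebraMap 𝕎 K (z k)) k
  simp only [RingHom.coe_coe] at this
  rw [this]
  congr 1
  funext l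
  simp [hσ]

theorem main_aux {n : ℕ} (σ : K ≃+* K)
    (hσ : ∀ x : 𝕎, σ (algebraMap 𝕎 K x) = algebraMap 𝕎 K (WittVector.frobenius x))
    (D : BlockData n) (μ : Fin n → ℤ) :
    ∃ c : ℕ, ∀ b : Matrix (Fin n) (Fin n) K, IsHodgePoint p κ b μ →
      ∀ G : Matrix (Fin n) (Fin n) K, IsUnit G.det → b = G⁻¹ * minMatrix p κ D * G.map ⇑σ →
      ∃ X Y : Matrix (Fin n) (Fin n) 𝕎, X * Y = (p : 𝕎) ^ c • (1 : Matrix (Fin n) (Fin n) 𝕎) ∧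
        X.map (algebraMap 𝕎 K) * b = minMatrix p κ D * (X.map (algebraMap 𝕎 K)).map σ := by
  let a : ℕ := ∑ i, (μ i).natAbs
  have ha : ∀ i, 0 ≤ (a : ℤ) + μ i := by
    intro i
    have : (μ i).natAbs ≤ a := Finset.single_le_sum (f := fun i => (μ i).natAbs)
      (fun _ _ => Nat.zero_le _) (Finset.mem_univ i)
    omega
  obtain ⟨c, hc⟩ := prop3 σ hσ D.m D.m_pos D.h D.coprime a
  refine ⟨c, fun b hb G hG hbG => ?_⟩
  obtain ⟨Yb, hYb⟩ := hodge_bound b μ hb a ha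
  have hGb : G * b = minMatrix p κ D * G.map σ := by
    rw [hbG, Matrix.mul_assoc, Matrix.mul_nonsing_inv_cancel_left _ _ hG]
  obtain ⟨f, f1, f2, f3, f4⟩ := hc (colLat D G) (colLat_isLat D G hG)
    (colLat_bd σ hσ D G b hGb a Yb hYb)
  let F : Fin n → ((Σ i, Fin (D.m i)) → K) := fun k =>
    f (D.equiv.symm k).1 (((D.equiv.symm k).2 : ℕ) : ℤ)
  let J : Matrix (Fin n) (Fin n) K := Matrix.of fun r k => F k (D.equiv.symm r)
  have hJ : ∀ r x, J r (D.equiv x) = f x.1 ((x.2 : ℕ) : ℤ) (D.equiv.symm r) := by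
    intro r x
    have : D.equiv.symm (D.equiv x) = x := D.equiv.symm_apply_apply x
    simp only [J, F, Matrix.of_apply]
    rw [this]
  have hcomm := minMatrix_comm σ D f f1 f2 J hJ
  have hrange : (Set.range fun x : (Σ i, Fin (D.m i)) => f x.1 ((x.2 : ℕ) : ℤ)) = Set.range F :=
    (D.equiv.symm.surjective.range_comp (fun x : (Σ i, Fin (D.m i)) =>
      f x.1 ((x.2 : ℕ) : ℤ))).symm
  have hX : ∀ k, ∃ z : Fin n → 𝕎, ∀ r, G r k = (J *ᵥ fun l => algebraMap 𝕎 K (z l)) r := by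
    intro k
    have h1 := f4 (fun x => G (D.equiv x) k) (Submodule.subset_span ⟨k, rfl⟩)
    rw [hrange, mem_span_col] at h1
    obtain ⟨z, hz⟩ := h1
    refine ⟨z, fun r => ?_⟩
    have := hz r
    simp only [Equiv.apply_symm_apply] at this
    exact this
  have hY : ∀ k, ∃ z : Fin n → 𝕎, ∀ r,
      (p : K) ^ c * J r k = (G *ᵥ fun l => algebraMap 𝕎 K (z l)) r := by
    intro k
    have h1 := f3 (D.equiv.symm k).1 (D.equiv.symm k).2
    rw [mem_colLat] at h1
    obtain ⟨z, hz⟩ := h1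
    refine ⟨z, fun r => ?_⟩
    rw [← hz r, pw_smul]
    rfl
  choose X' hX' using hX
  choose Y' hY' using hY
  let X : Matrix (Fin n) (Fin n) 𝕎 := Matrix.of fun l k => X' k l
  let Y : Matrix (Fin n) (Fin n) 𝕎 := Matrix.of fun l k => Y' k l
  have eX : G = J * X.map (algebraMap 𝕎 K) := by
    ext r k
    exact hX' k r
  have eY : (p : K) ^ c • J = G * Y.map (algebraMap 𝕎 K) := by
    ext r k
    exact hY' k r
  have hJu : IsUnit J := by
    rw [Matrix.isUnit_iff_isUnit_det]
    rw [eX, Matrix.det_mul] at hG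
    exact isUnit_of_mul_isUnit_left hG
  refine ⟨X, Y, ?_, ?_⟩
  · have h1 : (X * Y).map (algebraMap 𝕎 K) =
        ((p : 𝕎) ^ c • (1 : Matrix (Fin n) (Fin n) 𝕎)).map (algebraMap 𝕎 K) := by
      apply hJu.mul_left_cancel
      rw [Matrix.map_mul, ← Matrix.mul_assoc, ← eX, ← eY]
      have : ((p : 𝕎) ^ c • (1 : Matrix (Fin n) (Fin n) 𝕎)).map (algebraMap 𝕎 K) =
          (p : K) ^ c • (1 : Matrix (Fin n) (Fin n) K) := by
        ext r k
        by_cases hrk : r = k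
        · subst hrk; simp
        · simp [Matrix.one_apply_ne hrk]
      rw [this, Matrix.mul_smul, Matrix.mul_one]
    exact Matrix.map_injective (IsFractionRing.injective 𝕎 K) h1
  · apply hJu.mul_left_cancel
    rw [← Matrix.mul_assoc, ← eX, hGb, ← Matrix.mul_assoc, ← hcomm, Matrix.mul_assoc]
    congr 1
    conv_lhs => rw [eX]
    exact Matrix.map_mul (f := (σ : K →+* K))

end Final

theorem statement_9 (n : ℕ) (σ : K ≃+* K)
    (hσ : ∀ x : 𝕎, σ (algebraMap 𝕎 K x) = algebraMap 𝕎 K (WittVector.frobenius x))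
    (D : BlockData n) (μ : Fin n → ℤ) (hμanti : Antitone μ) :
    ∃ 𝒮 : Finset (Fin n → ℤ), (∀ s ∈ 𝒮, Antitone s) ∧
      ∀ b : Matrix (Fin n) (Fin n) K, IsUnit b.det → IsHodgePoint p κ b μ →
        (∃ g' : Matrix (Fin n) (Fin n) K, IsUnit g'.det ∧
          b = g'⁻¹ * minMatrix p κ D * g'.map ⇑σ) →
        ∃ g : Matrix (Fin n) (Fin n) K, IsUnit g.det ∧
          (∃ μg ∈ 𝒮, IsHodgePoint p κ g μg) ∧
          b = g⁻¹ * minMatrix p κ D * g.map ⇑σ := by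
  classical
  obtain ⟨c, hc⟩ := main_aux σ hσ D μ
  refine ⟨(Fintype.piFinset fun _ : Fin n => Finset.Icc (0 : ℤ) c).filter fun s => Antitone s,
    fun s hs => (Finset.mem_filter.1 hs).2, ?_⟩
  rintro b - hb ⟨G, hG, hbG⟩
  obtain ⟨X, Y, hXY, hXb⟩ := hc b hb G hG hbG
  obtain ⟨μg, hμ1, hμ2⟩ := smith_hodge c X Y hXY
  have hdet : IsUnit (X.map (algebraMap 𝕎 K)).det := by
    rw [isUnit_iff_ne_zero]
    intro h0
    have h1 : (X * Y).det ≠ 0 := by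
      rw [hXY, Matrix.det_smul, Matrix.det_one, mul_one]
      exact pow_ne_zero _ (pow_ne_zero _ (WittVector.p_nonzero p κ))
    rw [Matrix.det_mul] at h1
    have h2 : algebraMap 𝕎 K X.det = 0 := by
      rw [RingHom.map_det]; exact h0
    exact left_ne_zero_of_mul h1 ((IsFractionRing.injective 𝕎 K) (h2.trans (map_zero _).symm))
  refine ⟨X.map (algebraMap 𝕎 K), hdet, ⟨μg, ?_, hμ2⟩, ?_⟩
  · refine Finset.mem_filter.2 ⟨Fintype.mem_piFinset.2 fun i => Finset.mem_Icc.2 (hμ1 i), hμ2.1⟩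
  · rw [Matrix.mul_assoc, ← hXb, Matrix.nonsing_inv_mul_cancel_left _ _ hdet]

end
end
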